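/- arXiv:1508.07451 — 4 statements merged into one kernel-verified Lean document; each statement's English description precedes it below -/
import Mathlib

section
/- Let (G, a, b) be an atomic chiral rotation pair of type (p, q) with q > p. Then either there exist an odd prime m and integers α, β ≥ 1 such that p = 2·m^α and q = m^(α+β), or both p and q are powers of 2. -/
/-- A rotation pair of type `(p, q)`: the group is generated by `a` and `b`,
`a` has order `p`, `b` has order `q`, `p, q ≥ 2`, `(a*b)^2 = 1`, and the cyclic
subgroups generated by `a` and `b` intersect trivially. -/
def IsRotPair {G : Type*} [Group G] (a b : G) (p q : ℕ) : Prop :=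
  Subgroup.closure ({a, b} : Set G) = ⊤ ∧ orderOf a = p ∧ orderOf b = q ∧
    2 ≤ p ∧ 2 ≤ q ∧ (a * b) ^ 2 = 1 ∧
    Subgroup.zpowers a ⊓ Subgroup.zpowers b = ⊥

/-- Tightness: every element is `a ^ i * b ^ j` for some integers `i, j`. -/
def IsTight {G : Type*} [Group G] (a b : G) : Prop :=
  ∀ g : G, ∃ i j : ℤ, g = a ^ i * b ^ j

/-- Orientably regular: some group automorphism inverts both generators. -/
def IsOrientablyRegular {G : Type*} [Group G] (a b : G) : Prop :=
  ∃ φ : G ≃* G, φ a = a⁻¹ ∧ φ b = b⁻¹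

/-- Chiral: no group automorphism inverts both generators. -/
def IsChiral {G : Type*} [Group G] (a b : G) : Prop :=
  ¬ IsOrientablyRegular a b

/-- `(G, a, b)` covers `(H, a', b')` if a homomorphism sends `a ↦ a'`, `b ↦ b'`. -/
def Covers {G H : Type*} [Group G] [Group H] (a b : G) (a' b' : H) : Prop :=
  ∃ f : G →* H, f a = a' ∧ f b = b'

/-- An atomic chiral rotation pair of type `(p, q)`: a tight chiral rotation pair
covering no tight chiral rotation pair of type `(p', q)` with `p' < p` nor one of
type `(p, q')` with `q' < q`. -/
def IsAtomicPair {G : Type*} [Group G] (a b : G) (p q : ℕ) : Prop :=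
  IsRotPair a b p q ∧ IsTight a b ∧ IsChiral a b ∧
  (∀ (H : Type) (instH : Group H) (_ : Finite H) (a' b' : H) (p' : ℕ), p' < p →
      @IsRotPair H instH a' b' p' q → @IsTight H instH a' b' → @IsChiral H instH a' b' →
      ¬ @Covers G H _ instH a b a' b') ∧
  (∀ (H : Type) (instH : Group H) (_ : Finite H) (a' b' : H) (q' : ℕ), q' < q →
      @IsRotPair H instH a' b' p q' → @IsTight H instH a' b' → @IsChiral H instH a' b' →
      ¬ @Covers G H _ instH a b a' b')

namespace TightChiral

open Subgroup
open scoped commutatorElement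

/-- In a finite cyclic group, divisibility of orders gives membership. -/
lemma mem_zpowers_of_dvd {G : Type*} [Group G] [Finite G] {g x y : G}
    (hx : x ∈ zpowers g) (hy : y ∈ zpowers g) (hd : orderOf x ∣ orderOf y) :
    x ∈ zpowers y := by
  classical
  have hpos : 0 < orderOf y := orderOf_pos y
  have : Fintype (zpowers g) := Fintype.ofFinite _
  let S : Finset (zpowers g) := Finset.univ.filter (fun z => z ^ orderOf y = 1)
  have hS : S.card ≤ orderOf y := IsCyclic.card_pow_eq_one_le hpos
  let T : Finset (zpowers g) :=
    (Finset.range (orderOf y)).image (fun i => (⟨y, hy⟩ : zpowers g) ^ i)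
  have hT : T.card = orderOf y := by
    rw [Finset.card_image_of_injOn, Finset.card_range]
    intro i hi j hj hij
    have h1 : y ^ i = y ^ j := by simpa using congrArg Subtype.val hij
    simp only [Finset.coe_range, Set.mem_Iio] at hi hj
    exact pow_injOn_Iio_orderOf hi hj h1
  have hTS : T ⊆ S := by
    intro z hz
    simp only [T, Finset.mem_image] at hz
    obtain ⟨i, _, rfl⟩ := hz
    simp only [S, Finset.mem_filter, Finset.mem_univ, true_and]
    apply Subtype.ext
    show (y ^ i) ^ orderOf y = 1
    rw [← pow_mul, mul_comm i, pow_mul, pow_orderOf_eq_one, one_pow]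
  have hEq : T = S := Finset.eq_of_subset_of_card_le hTS (by omega)
  have hxS : (⟨x, hx⟩ : zpowers g) ∈ S := by
    simp only [S, Finset.mem_filter, Finset.mem_univ, true_and]
    apply Subtype.ext
    simpa using orderOf_dvd_iff_pow_eq_one.mp hd
  rw [← hEq] at hxS
  simp only [T, Finset.mem_image] at hxS
  obtain ⟨i, _, hi⟩ := hxS
  have : y ^ i = x := by simpa using congrArg Subtype.val hi
  rw [← this]
  exact npow_mem_zpowers y i

/-- The other order of factors. -/
lemma tight_swap {G : Type*} [Group G] {a b : G} (hT : IsTight a b) (g : G) :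
    ∃ i j : ℤ, g = b ^ i * a ^ j := by
  obtain ⟨i, j, h⟩ := hT g⁻¹
  refine ⟨-j, -i, ?_⟩
  rw [← inv_inv g, h]
  simp [mul_inv_rev]

lemma normal_of_conj {G : Type*} [Group G] [Finite G] {a b : G} (hT : IsTight a b)
    {K : Subgroup G} (ha : ∀ x ∈ K, a * x * a⁻¹ ∈ K) (hb : ∀ x ∈ K, b * x * b⁻¹ ∈ K) :
    K.Normal := by
  have key : ∀ c : G, (∀ x ∈ K, c * x * c⁻¹ ∈ K) → ∀ i : ℤ, ∀ x ∈ K, c ^ i * x * (c ^ i)⁻¹ ∈ K := by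
    intro c hc i
    have hn : ∀ n : ℕ, ∀ x ∈ K, c ^ n * x * (c ^ n)⁻¹ ∈ K := by
      intro n
      induction n with
      | zero => intro x hx; simpa using hx
      | succ n ih =>
        intro x hx
        have := hc _ (ih x hx)
        have e : c ^ (n + 1) * x * (c ^ (n + 1))⁻¹ = c * (c ^ n * x * (c ^ n)⁻¹) * c⁻¹ := by
          rw [pow_succ']; group
        rw [e]; exact this
    have : c ^ i ∈ Submonoid.powers c := by
      rw [mem_powers_iff_mem_zpowers]; exact zpow_mem_zpowers c i
    obtain ⟨n, hn'⟩ := this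
    rw [← hn']
    exact hn n
  refine ⟨fun x hx g => ?_⟩
  obtain ⟨i, j, rfl⟩ := hT g
  have h1 := key a ha i _ (key b hb j x hx)
  have e : a ^ i * b ^ j * x * (a ^ i * b ^ j)⁻¹
      = a ^ i * (b ^ j * x * (b ^ j)⁻¹) * (a ^ i)⁻¹ := by group
  rw [e]; exact h1

lemma normal_zpowers {G : Type*} [Group G] [Finite G] {a b : G} (hT : IsTight a b)
    {x : G} (ha : a * x * a⁻¹ ∈ zpowers x) (hb : b * x * b⁻¹ ∈ zpowers x) :
    (zpowers x).Normal := by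
  have key : ∀ c : G, c * x * c⁻¹ ∈ zpowers x → ∀ y ∈ zpowers x, c * y * c⁻¹ ∈ zpowers x := by
    intro c hc y hy
    obtain ⟨k, rfl⟩ := mem_zpowers_iff.mp hy
    rw [← conj_zpow]
    exact zpow_mem hc k
  exact normal_of_conj hT (key a ha) (key b hb)

/-- A subgroup of a normal cyclic subgroup is normal. -/
lemma normal_of_mem_normal {G : Type*} [Group G] {x y : G} (hx : (zpowers x).Normal)
    (hy : y ∈ zpowers x) : (zpowers y).Normal := by
  obtain ⟨k, rfl⟩ := mem_zpowers_iff.mp hy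
  refine ⟨fun z hz g => ?_⟩
  obtain ⟨l, rfl⟩ := mem_zpowers_iff.mp hz
  obtain ⟨r, hr⟩ := mem_zpowers_iff.mp (hx.conj_mem x (mem_zpowers x) g)
  rw [← conj_zpow, ← conj_zpow, ← hr, mem_zpowers_iff]
  exact ⟨r * l, by rw [← zpow_mul, ← zpow_mul, ← zpow_mul]; congr 1; ring⟩

/-- If the images of `a`, `b` commute modulo `K` then the quotient is abelian. -/
lemma commutator_le_of {G : Type*} [Group G] {a b : G} (hT : IsTight a b)
    {K : Subgroup G} (hK : K.Normal) (h : a * b * a⁻¹ * b⁻¹ ∈ K) : commutator G ≤ K := by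
  have hc : Commute (a : G ⧸ K) (b : G ⧸ K) := by
    have h1 : ((a * b * a⁻¹ * b⁻¹ : G) : G ⧸ K) = 1 := (QuotientGroup.eq_one_iff _).mpr h
    simp only [QuotientGroup.mk_mul, QuotientGroup.mk_inv] at h1
    show (a : G ⧸ K) * b = b * a
    rw [mul_inv_eq_one, mul_inv_eq_iff_eq_mul] at h1
    exact h1
  rw [commutator_def, commutator_le]
  intro g _ g' _
  obtain ⟨i, j, rfl⟩ := hT g
  obtain ⟨k, l, rfl⟩ := hT g'
  rw [← QuotientGroup.eq_one_iff, commutatorElement_def]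
  simp only [QuotientGroup.mk_mul, QuotientGroup.mk_inv, QuotientGroup.mk_zpow]
  have c1 : Commute ((a : G ⧸ K) ^ i * (b : G ⧸ K) ^ j) ((a : G ⧸ K) ^ k * (b : G ⧸ K) ^ l) := by
    apply Commute.mul_left <;> apply Commute.mul_right
    · exact (Commute.refl _).zpow_zpow _ _
    · exact hc.zpow_zpow _ _
    · exact hc.symm.zpow_zpow _ _
    · exact (Commute.refl _).zpow_zpow _ _
  rw [c1.eq, mul_inv_cancel_right, mul_inv_cancel]

/-- Ito: the product of two cyclic groups is metabelian. -/
lemma ito {G : Type*} [Group G] [Finite G] {a b : G} (hT : IsTight a b) :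
    ∀ f ∈ commutator G, ∀ g ∈ commutator G, f * g = g * f := by
  let X : Set G := {g | ∃ i j : ℤ, g = ⁅a ^ i, b ^ j⁆}
  let K : Subgroup G := closure X
  have eA : ∀ (i : ℤ) (j k : ℤ), ⁅a ^ i, b ^ j * a ^ k⁆ = ⁅a ^ i, b ^ j⁆ := by
    intro i j k
    simp only [commutatorElement_def]
    have : a ^ i * (b ^ j * a ^ k) * (a ^ i)⁻¹ * (b ^ j * a ^ k)⁻¹
      = a ^ i * b ^ j * (a ^ k * (a ^ i)⁻¹ * (a ^ k)⁻¹) * (b ^ j)⁻¹ := by group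
    rw [this]
    congr 2
    group
  have eB : ∀ (i : ℤ) (j k : ℤ), ⁅a ^ i * b ^ k, b ^ j⁆ = ⁅a ^ i, b ^ j⁆ := by
    intro i j k
    simp only [commutatorElement_def]
    have : a ^ i * b ^ k * b ^ j * (a ^ i * b ^ k)⁻¹ * (b ^ j)⁻¹
      = a ^ i * (b ^ k * b ^ j * (b ^ k)⁻¹) * (a ^ i)⁻¹ * (b ^ j)⁻¹ := by group
    rw [this]
    congr 3
    group
  have conjA : ∀ i j k l m : ℤ, a ^ k * b ^ j * (a ^ k)⁻¹ = b ^ l * a ^ m →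
      a ^ k * ⁅a ^ i, b ^ j⁆ * (a ^ k)⁻¹ = ⁅a ^ i, b ^ l⁆ := by
    intro i j k l m h
    have : a ^ k * ⁅a ^ i, b ^ j⁆ * (a ^ k)⁻¹ = ⁅a ^ i, a ^ k * b ^ j * (a ^ k)⁻¹⁆ := by
      simp only [commutatorElement_def]
      group
    rw [this, h, eA]
  have conjB : ∀ i j k l m : ℤ, b ^ k * a ^ i * (b ^ k)⁻¹ = a ^ l * b ^ m →
      b ^ k * ⁅a ^ i, b ^ j⁆ * (b ^ k)⁻¹ = ⁅a ^ l, b ^ j⁆ := by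
    intro i j k l m h
    have : b ^ k * ⁅a ^ i, b ^ j⁆ * (b ^ k)⁻¹ = ⁅b ^ k * a ^ i * (b ^ k)⁻¹, b ^ j⁆ := by
      simp only [commutatorElement_def]
      group
    rw [this, h, eB]
  have comm : ∀ x ∈ X, ∀ y ∈ X, x * y = y * x := by
    rintro _ ⟨k, l, rfl⟩ _ ⟨i, j, rfl⟩
    obtain ⟨u, v, h1⟩ := tight_swap hT (a ^ (-k) * b ^ j * (a ^ (-k))⁻¹)
    obtain ⟨w, z, h2⟩ := hT (b ^ (-l) * a ^ i * (b ^ (-l))⁻¹)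
    have e1 : a ^ (-k) * (b ^ (-l) * ⁅a ^ i, b ^ j⁆ * (b ^ (-l))⁻¹) * (a ^ (-k))⁻¹
        = b ^ (-l) * (a ^ (-k) * ⁅a ^ i, b ^ j⁆ * (a ^ (-k))⁻¹) * (b ^ (-l))⁻¹ := by
      rw [conjB i j (-l) w z h2, conjA w j (-k) u v h1, conjA i j (-k) u v h1,
        conjB i u (-l) w z h2]
    rw [commutatorElement_def (a ^ k)]
    generalize ⁅a ^ i, b ^ j⁆ = c at e1 ⊢
    have e2 : a ^ k * b ^ l * (a ^ k)⁻¹ * (b ^ l)⁻¹ * c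
        = a ^ k * b ^ l * (a ^ (-k) * (b ^ (-l) * c * (b ^ (-l))⁻¹) * (a ^ (-k))⁻¹)
          * (a ^ k)⁻¹ * (b ^ l)⁻¹ := by group
    rw [e2, e1]
    group
  have normK : K.Normal := by
    apply normal_of_conj hT
    · intro x hx
      have : K ≤ K.comap (MulAut.conj a).toMonoidHom := by
        apply (closure_le _).mpr
        rintro _ ⟨i, j, rfl⟩
        obtain ⟨u, v, h1⟩ := tight_swap hT (a ^ (1 : ℤ) * b ^ j * (a ^ (1 : ℤ))⁻¹)
        have := conjA i j 1 u v h1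
        rw [zpow_one] at this
        show a * ⁅a ^ i, b ^ j⁆ * a⁻¹ ∈ K
        rw [this]
        exact subset_closure ⟨i, u, rfl⟩
      exact this hx
    · intro x hx
      have : K ≤ K.comap (MulAut.conj b).toMonoidHom := by
        apply (closure_le _).mpr
        rintro _ ⟨i, j, rfl⟩
        obtain ⟨u, v, h1⟩ := hT (b ^ (1 : ℤ) * a ^ i * (b ^ (1 : ℤ))⁻¹)
        have := conjB i j 1 u v h1
        rw [zpow_one] at this
        show b * ⁅a ^ i, b ^ j⁆ * b⁻¹ ∈ K
        rw [this]
        exact subset_closure ⟨u, j, rfl⟩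
      exact this hx
  have hle : commutator G ≤ K := by
    apply commutator_le_of hT normK
    have := subset_closure (k := X) ⟨1, 1, rfl⟩
    simpa [commutatorElement_def] using this
  have hK : ∀ x ∈ K, ∀ y ∈ K, x * y = y * x := by
    intro x hx y hy
    have h1 : K ≤ centralizer X := (closure_le _).mpr fun x hx y hy => comm y hy x hx
    have h2 : K ≤ centralizer (K : Set G) := by
      rw [le_centralizer_iff] 
      exact (closure_le _).mpr fun x hx y hy => (h1 hy x hx).symm
    exact (h2 hy x hx)
  exact fun f hf g hg => hK f (hle hf) g (hle hg)

end TightChiral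

namespace TightChiral

open Subgroup
open scoped commutatorElement

/-- Evaluation of words in the two generators. -/
def wd {G : Type*} [Group G] (a b : G) : FreeGroup Bool →* G :=
  FreeGroup.lift (fun c => cond c a b)

lemma wd_true {G : Type*} [Group G] (a b : G) : wd a b (FreeGroup.of true) = a := by simp [wd]

lemma wd_false {G : Type*} [Group G] (a b : G) : wd a b (FreeGroup.of false) = b := by simp [wd]

/-- `K` is stable under the mirror operation. -/
def Reg {G : Type*} [Group G] (a b : G) (K : Subgroup G) : Prop :=
  ∀ w : FreeGroup Bool, wd a b w ∈ K → wd a⁻¹ b⁻¹ w ∈ K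

lemma Reg.inf {G : Type*} [Group G] {a b : G} {K L : Subgroup G} (hK : Reg a b K)
    (hL : Reg a b L) : Reg a b (K ⊓ L) :=
  fun w hw => ⟨hK w hw.1, hL w hw.2⟩

lemma wd_map {G H : Type*} [Group G] [Group H] (f : G →* H) (a b : G) (w : FreeGroup Bool) :
    f (wd a b w) = wd (f a) (f b) w := by
  have : f.comp (wd a b) = wd (f a) (f b) := by
    ext c
    cases c <;> simp [wd]
  exact DFunLike.congr_fun this w

lemma wd_surj {G : Type*} [Group G] {a b : G} (h : IsTight a b) :
    Function.Surjective (wd a b) := by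
  intro g
  obtain ⟨i, j, rfl⟩ := h g
  exact ⟨FreeGroup.of true ^ i * FreeGroup.of false ^ j, by simp [wd]⟩

lemma regular_of_reg_bot {G : Type*} [Group G] [Finite G] {a b : G} (h : IsTight a b)
    (hr : Reg a b ⊥) : IsOrientablyRegular a b := by
  have hs := wd_surj h
  have hker : (wd a b).ker ≤ (wd a⁻¹ b⁻¹).ker := by
    intro w hw
    have := hr w (by simpa [MonoidHom.mem_ker] using hw)
    simpa [MonoidHom.mem_ker] using this
  let φ : G →* G := (wd a b).liftOfSurjective hs ⟨wd a⁻¹ b⁻¹, hker⟩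
  have hφ : ∀ w, φ (wd a b w) = wd a⁻¹ b⁻¹ w := fun w =>
    (wd a b).liftOfRightInverse_comp_apply _ (Function.rightInverse_surjInv hs)
      ⟨wd a⁻¹ b⁻¹, hker⟩ w
  have ha : φ a = a⁻¹ := by simpa [wd_true] using hφ (FreeGroup.of true)
  have hb : φ b = b⁻¹ := by simpa [wd_false] using hφ (FreeGroup.of false)
  have hinv : ∀ g, φ (φ g) = g := by
    intro g
    obtain ⟨i, j, rfl⟩ := h g
    simp [ha, hb]
  exact ⟨{ φ with invFun := φ, left_inv := hinv, right_inv := hinv }, ha, hb⟩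

lemma reg_of_quot {G : Type*} [Group G] {a b : G} {K : Subgroup G} [K.Normal]
    (h : IsOrientablyRegular (a : G ⧸ K) (b : G ⧸ K)) : Reg a b K := by
  obtain ⟨φ, ha, hb⟩ := h
  intro w hw
  rw [← QuotientGroup.eq_one_iff] at hw ⊢
  have e1 : ((wd a b w : G) : G ⧸ K) = wd (a : G ⧸ K) b w := wd_map (QuotientGroup.mk' K) a b w
  have e2 : ((wd a⁻¹ b⁻¹ w : G) : G ⧸ K) = wd (a : G ⧸ K)⁻¹ (b : G ⧸ K)⁻¹ w :=
    wd_map (QuotientGroup.mk' K) a⁻¹ b⁻¹ w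
  have e3 : φ (wd (a : G ⧸ K) b w) = wd (a : G ⧸ K)⁻¹ (b : G ⧸ K)⁻¹ w := by
    rw [← ha, ← hb]
    exact wd_map φ.toMonoidHom _ _ w
  rw [e2, ← e3, ← e1, hw, map_one]

lemma reg_of_comm {G : Type*} [Group G] {a b : G} {K : Subgroup G} [K.Normal]
    (h : commutator G ≤ K) : Reg a b K := by
  apply reg_of_quot
  have hc := Subgroup.Normal.quotient_commutative_iff_commutator_le.mpr h
  have hc' : ∀ x y : G ⧸ K, x * y = y * x := fun x y => hc.is_comm.comm x y
  exact ⟨{ toFun := fun x => x⁻¹, invFun := fun x => x⁻¹, left_inv := inv_inv,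
           right_inv := inv_inv, map_mul' := fun x y => by rw [mul_inv_rev, hc'] }, rfl, rfl⟩

/-- Transport of the quotient to `Type`. -/
lemma shrink_quot {G : Type*} [Group G] [Finite G] {a b : G} {K : Subgroup G} [K.Normal] :
    ∃ (H : Type) (_ : Group H) (_ : Finite H) (e : (G ⧸ K) ≃* H), True :=
  ⟨Shrink.{0} (G ⧸ K), inferInstance, inferInstance, Shrink.mulEquiv.symm, trivial⟩

lemma regular_of_equiv {G H : Type*} [Group G] [Group H] (e : G ≃* H) {a b : G}
    (h : IsOrientablyRegular (e a) (e b)) : IsOrientablyRegular a b := by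
  obtain ⟨φ, h1, h2⟩ := h
  exact ⟨(e.trans φ).trans e.symm, by simp [h1], by simp [h2]⟩

lemma tight_map {G H : Type*} [Group G] [Group H] (f : G →* H) (hf : Function.Surjective f)
    {a b : G} (h : IsTight a b) : IsTight (f a) (f b) := by
  intro y
  obtain ⟨g, rfl⟩ := hf y
  obtain ⟨i, j, rfl⟩ := h g
  exact ⟨i, j, by simp⟩

lemma closure_of_tight {G : Type*} [Group G] {a b : G} (h : IsTight a b) :
    closure ({a, b} : Set G) = ⊤ := by
  rw [eq_top_iff]
  intro g _
  obtain ⟨i, j, rfl⟩ := h g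
  exact mul_mem (zpow_mem (subset_closure (by simp)) _) (zpow_mem (subset_closure (by simp)) _)

lemma inf_bot {G : Type*} [Group G] {a b : G} (h : zpowers a ⊓ zpowers b = ⊥) {x : G}
    (h1 : x ∈ zpowers a) (h2 : x ∈ zpowers b) : x = 1 := by
  have : x ∈ zpowers a ⊓ zpowers b := ⟨h1, h2⟩
  rwa [h, mem_bot] at this

/-- order of an image, with kernel meeting the cyclic group trivially -/
lemma orderOf_map_of_ker {G H : Type*} [Group G] [Group H] (f : G →* H) {a : G}
    (h : ∀ x ∈ zpowers a, f x = 1 → x = 1) : orderOf (f a) = orderOf a := by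
  apply Nat.dvd_antisymm (orderOf_map_dvd f a)
  apply orderOf_dvd_of_pow_eq_one
  apply h _ (npow_mem_zpowers a _)
  rw [map_pow, pow_orderOf_eq_one]

lemma orderOf_map_lt {G H : Type*} [Group G] [Finite G] [Group H] (f : G →* H) {b x : G}
    (hx : x ∈ zpowers b) (hx1 : x ≠ 1) (hf : f x = 1) : orderOf (f b) < orderOf b := by
  apply lt_of_le_of_ne (Nat.le_of_dvd (orderOf_pos b) (orderOf_map_dvd f b))
  intro he
  obtain ⟨k, rfl⟩ := mem_zpowers_iff.mp hx
  apply hx1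
  rw [← orderOf_dvd_iff_zpow_eq_one, ← he, orderOf_dvd_iff_zpow_eq_one, ← map_zpow, hf]

lemma commutator_le_of_mem_b {G : Type*} [Group G] {a b : G} (hT : IsTight a b)
    {K : Subgroup G} (hK : K.Normal) (h : b ∈ K) : commutator G ≤ K := by
  apply commutator_le_of hT hK
  exact mul_mem (hK.conj_mem b h a) (inv_mem h)

lemma commutator_le_of_mem_a {G : Type*} [Group G] {a b : G} (hT : IsTight a b)
    {K : Subgroup G} (hK : K.Normal) (h : a ∈ K) : commutator G ≤ K := by
  apply commutator_le_of hT hK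
  have := mul_mem h (hK.conj_mem _ (inv_mem h) b)
  simpa [mul_assoc] using this

lemma two_le_orderOf {G : Type*} [Group G] [Finite G] {x : G} (h : x ≠ 1) : 2 ≤ orderOf x := by
  have h1 := orderOf_pos x
  have h2 : orderOf x ≠ 1 := fun h' => h (orderOf_eq_one_iff.mp h')
  omega

lemma reg_of_le_b {G : Type*} [Group G] [Finite G] {a b : G} {p q : ℕ}
    (h : IsAtomicPair a b p q) {K : Subgroup G} [hK : K.Normal] (hKb : K ≤ zpowers b)
    {x : G} (hxK : x ∈ K) (hx1 : x ≠ 1) : Reg a b K := by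
  obtain ⟨⟨_, hp, hq, hp2, hq2, ht, hAB⟩, hT, hch, hat1, hat2⟩ := h
  by_cases hb : b ∈ K
  · exact reg_of_comm (commutator_le_of_mem_b hT hK hb)
  apply reg_of_quot
  obtain ⟨H, iH, fH, e, _⟩ := shrink_quot (a := a) (b := b) (K := K)
  apply regular_of_equiv e
  by_contra hc
  let f : G →* H := e.toMonoidHom.comp (QuotientGroup.mk' K)
  have hf1 : ∀ g, f g = 1 ↔ g ∈ K := by
    intro g
    simp [f]
  have hfs : Function.Surjective f := e.surjective.comp (QuotientGroup.mk'_surjective K)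
  have hTf := tight_map f hfs hT
  refine hat2 H iH fH (f a) (f b) (orderOf (f b)) ?_ ?_ hTf hc ⟨f, rfl, rfl⟩
  · rw [← hq]
    exact orderOf_map_lt f (hKb hxK) hx1 ((hf1 x).mpr hxK)
  · refine ⟨closure_of_tight hTf, ?_, rfl, hp2, two_le_orderOf ?_, ?_, ?_⟩
    · rw [← hp]
      apply orderOf_map_of_ker
      intro y hy hy1
      exact inf_bot hAB hy (hKb ((hf1 y).mp hy1))
    · rw [Ne, hf1]; exact hb
    · rw [← map_mul, ← map_pow, ht, map_one]
    · rw [eq_bot_iff]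
      rintro y ⟨h1, h2⟩
      obtain ⟨i, rfl⟩ := mem_zpowers_iff.mp h1
      obtain ⟨j, hj⟩ := mem_zpowers_iff.mp h2
      have h3 : a ^ i * (b ^ j)⁻¹ ∈ K := by
        rw [← hf1]; simp [hj]
      have h4 : a ^ i ∈ zpowers b := by
        have := mul_mem (hKb h3) (zpow_mem_zpowers b j)
        simpa using this
      have h5 := inf_bot hAB (zpow_mem_zpowers a i) h4
      rw [mem_bot, ← map_zpow, h5, map_one]

lemma reg_of_le_a {G : Type*} [Group G] [Finite G] {a b : G} {p q : ℕ}
    (h : IsAtomicPair a b p q) {K : Subgroup G} [hK : K.Normal] (hKa : K ≤ zpowers a)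
    {x : G} (hxK : x ∈ K) (hx1 : x ≠ 1) : Reg a b K := by
  obtain ⟨⟨_, hp, hq, hp2, hq2, ht, hAB⟩, hT, hch, hat1, hat2⟩ := h
  by_cases ha : a ∈ K
  · exact reg_of_comm (commutator_le_of_mem_a hT hK ha)
  apply reg_of_quot
  obtain ⟨H, iH, fH, e, _⟩ := shrink_quot (a := a) (b := b) (K := K)
  apply regular_of_equiv e
  by_contra hc
  let f : G →* H := e.toMonoidHom.comp (QuotientGroup.mk' K)
  have hf1 : ∀ g, f g = 1 ↔ g ∈ K := by
    intro g
    simp [f]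
  have hfs : Function.Surjective f := e.surjective.comp (QuotientGroup.mk'_surjective K)
  have hTf := tight_map f hfs hT
  refine hat1 H iH fH (f a) (f b) (orderOf (f a)) ?_ ?_ hTf hc ⟨f, rfl, rfl⟩
  · rw [← hp]
    exact orderOf_map_lt f (hKa hxK) hx1 ((hf1 x).mpr hxK)
  · refine ⟨closure_of_tight hTf, rfl, ?_, two_le_orderOf ?_, hq2, ?_, ?_⟩
    · rw [← hq]
      apply orderOf_map_of_ker
      intro y hy hy1
      exact inf_bot hAB (hKa ((hf1 y).mp hy1)) hy
    · rw [Ne, hf1]; exact ha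
    · rw [← map_mul, ← map_pow, ht, map_one]
    · rw [eq_bot_iff]
      rintro y ⟨h1, h2⟩
      obtain ⟨i, rfl⟩ := mem_zpowers_iff.mp h1
      obtain ⟨j, hj⟩ := mem_zpowers_iff.mp h2
      have h3 : (a ^ i)⁻¹ * b ^ j ∈ K := by
        rw [← hf1]; simp [hj]
      have h4 : b ^ j ∈ zpowers a := by
        have := mul_mem (zpow_mem_zpowers a i) (hKa h3)
        simpa using this
      have h5 := inf_bot hAB h4 (zpow_mem_zpowers b j)
      rw [mem_bot, ← hj, ← map_zpow, h5, map_one]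

end TightChiral

namespace TightChiral
open Subgroup
open scoped commutatorElement

lemma inv_F {G : Type*} [Group G] [Finite G] {a b : G} (hT : IsTight a b)
    (ht : (a * b) ^ 2 = 1) : ∀ f ∈ commutator G, (a * b) * f * (a * b)⁻¹ = f⁻¹ := by
  have hito := ito hT
  generalize htt : a * b = t at ht ⊢
  have hti : t⁻¹ = t := by
    rw [inv_eq_iff_mul_eq_one, ← pow_two, ht]
  let F0 : Subgroup G :=
    { carrier := {f | f ∈ commutator G ∧ t * f * t⁻¹ = f⁻¹}
      one_mem' := ⟨one_mem _, by simp⟩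
      mul_mem' := by
        rintro x y ⟨hx, hx'⟩ ⟨hy, hy'⟩
        refine ⟨mul_mem hx hy, ?_⟩
        rw [hito x hx y hy, mul_inv_rev, ← hx', ← hy', hx', hy']
        have : t * (y * x) * t⁻¹ = (t * y * t⁻¹) * (t * x * t⁻¹) := by group
        rw [this, hx', hy']
        exact hito _ (inv_mem hy) _ (inv_mem hx)
      inv_mem' := by
        rintro x ⟨hx, hx'⟩
        refine ⟨inv_mem hx, ?_⟩
        have h1 : t * x⁻¹ * t⁻¹ = (t * x * t⁻¹)⁻¹ := by group
        rw [h1, hx'] }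
  have hn : F0.Normal := by
    refine ⟨?_⟩
    rintro f ⟨hf, hf'⟩ g
    refine ⟨Subgroup.Normal.conj_mem inferInstance f hf g, ?_⟩
    have hφ : ⁅g⁻¹, t⁆ ∈ commutator G := Subgroup.commutator_mem_commutator (mem_top _) (mem_top _)
    have h1 : t * (g * f * g⁻¹) * t⁻¹ = g * (⁅g⁻¹, t⁆ * (t * f * t⁻¹) * ⁅g⁻¹, t⁆⁻¹) * g⁻¹ := by
      simp only [commutatorElement_def]; group
    rw [h1, hf', hito _ hφ _ (inv_mem hf)]
    group
  have hle : commutator G ≤ F0 := by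
    apply commutator_le_of hT hn
    have h1 : a * t * a⁻¹ * t⁻¹ ∈ F0 := by
      refine ⟨?_, ?_⟩
      · rw [← commutatorElement_def]
        exact Subgroup.commutator_mem_commutator (mem_top _) (mem_top _)
      · simp only [mul_inv_rev, inv_inv, hti]
        simp only [mul_assoc]
        rw [← pow_two, ht, mul_one]
    have h2 := hn.conj_mem _ h1 a⁻¹
    convert h2 using 1
    rw [← htt]; group
  intro f hf
  exact (hle hf).2

lemma card_tight {G : Type*} [Group G] [Finite G] {a b : G} (hT : IsTight a b)
    (hAB : zpowers a ⊓ zpowers b = ⊥) : Nat.card G = orderOf a * orderOf b := by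
  rw [← Nat.card_zpowers, ← Nat.card_zpowers, ← Nat.card_prod]
  symm
  apply Nat.card_congr
  refine Equiv.ofBijective (fun x : zpowers a × zpowers b => (x.1 : G) * x.2) ⟨?_, ?_⟩
  · rintro ⟨⟨x, hx⟩, ⟨y, hy⟩⟩ ⟨⟨x', hx'⟩, ⟨y', hy'⟩⟩ h
    simp only at h
    have h1 : x'⁻¹ * x = y' * y⁻¹ := by
      rw [inv_mul_eq_iff_eq_mul, ← mul_assoc, ← h]; group
    have h2 : x'⁻¹ * x = 1 :=
      inf_bot hAB (mul_mem (inv_mem hx') hx) (by rw [h1]; exact mul_mem hy' (inv_mem hy))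
    have h3 : x = x' := by rwa [inv_mul_eq_one, eq_comm] at h2
    subst h3
    have h4 : y = y' := mul_left_cancel h
    subst h4; rfl
  · intro g
    obtain ⟨i, j, rfl⟩ := hT g
    exact ⟨⟨⟨a ^ i, zpow_mem_zpowers a i⟩, ⟨b ^ j, zpow_mem_zpowers b j⟩⟩, rfl⟩

/-- elements of `⟨b⟩` whose conjugate by `a` lies in `⟨b⟩` -/
def core {G : Type*} [Group G] (a b : G) : Subgroup G :=
  zpowers b ⊓ (zpowers b).comap (MulAut.conj a).toMonoidHom

lemma mem_core {G : Type*} [Group G] {a b x : G} :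
    x ∈ core a b ↔ x ∈ zpowers b ∧ a * x * a⁻¹ ∈ zpowers b := by
  simp only [core, mem_inf, mem_comap]
  rfl

lemma orderOf_conj' {G : Type*} [Group G] (a x : G) : orderOf (a * x * a⁻¹) = orderOf x := by
  have := orderOf_injective (MulAut.conj a).toMonoidHom (MulAut.conj a).injective x
  simpa using this

lemma core_normal {G : Type*} [Group G] [Finite G] {a b x : G} (hT : IsTight a b)
    (hx : x ∈ core a b) : (zpowers x).Normal := by
  obtain ⟨h1, h2⟩ := mem_core.mp hx
  apply normal_zpowers hT
  · exact mem_zpowers_of_dvd h2 h1 (by rw [orderOf_conj'])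
  · obtain ⟨k, rfl⟩ := mem_zpowers_iff.mp h1
    convert mem_zpowers (b ^ k) using 1
    group

lemma core_of_normal {G : Type*} [Group G] [Finite G] {a b x : G} (hx : x ∈ zpowers b)
    (hn : (zpowers x).Normal) : x ∈ core a b :=
  mem_core.mpr ⟨hx, (zpowers_le.mpr hx) (hn.conj_mem x (mem_zpowers x) a)⟩

lemma card_core {G : Type*} [Group G] [Finite G] {a b : G} (hT : IsTight a b)
    (hAB : zpowers a ⊓ zpowers b = ⊥) (ha : a ≠ 1) :
    orderOf b ≤ Nat.card (core a b) * (orderOf a - 1) := by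
  classical
  have : Fintype G := Fintype.ofFinite G
  have haB : a ∉ zpowers b := fun h => ha (inf_bot hAB (mem_zpowers a) h)
  let S : Finset G := Finset.univ.filter (· ∈ zpowers b)
  let f : G × G → G := fun z => z.1 * a * z.2
  have hS : S.card = orderOf b := by
    rw [← Nat.card_zpowers, Nat.card_eq_fintype_card, Fintype.card_subtype]
  have hC : Nat.card (core a b) = (Finset.univ.filter (· ∈ core a b)).card := by
    rw [Nat.card_eq_fintype_card, Fintype.card_subtype]
  have hSm : ∀ x, x ∈ S ↔ x ∈ zpowers b := by simp [S]
  have h1 := Finset.card_le_mul_card_image (f := f) (S ×ˢ S) (Nat.card (core a b)) (by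
    intro g hg
    obtain ⟨⟨x0, y0⟩, h0, rfl⟩ := Finset.mem_image.mp hg
    rw [Finset.mem_product, hSm, hSm] at h0
    rw [hC]
    apply Finset.card_le_card_of_injOn (fun z => y0 * z.2⁻¹)
    · rintro ⟨x, y⟩ hz
      simp only [Finset.coe_filter, Set.mem_ofPred_eq, Finset.mem_product, hSm] at hz
      obtain ⟨⟨hx, hy⟩, he⟩ := hz
      simp only [Finset.coe_filter, Set.mem_ofPred_eq, Finset.mem_univ, true_and]
      refine mem_core.mpr ⟨mul_mem h0.2 (inv_mem hy), ?_⟩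
      have : a * (y0 * y⁻¹) * a⁻¹ = x0⁻¹ * x := by
        have he' : x * a * y = x0 * a * y0 := he
        have : a * y0 = x0⁻¹ * (x * a * y) := by rw [he']; group
        rw [← mul_assoc, this]; group
      rw [this]
      exact mul_mem (inv_mem h0.1) hx
    · rintro ⟨x, y⟩ hz ⟨x', y'⟩ hz' hh
      simp only [Finset.coe_filter, Set.mem_ofPred_eq, Finset.mem_product, hSm] at hz hz'
      have hh' : y = y' := by simpa using hh
      subst hh'
      have : x * a * y = x' * a * y := hz.2.trans hz'.2.symm
      have : x = x' := by simpa using this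
      rw [this])
  have h2 : ((S ×ˢ S).image f).card ≤ (Finset.univ \ S).card := by
    apply Finset.card_le_card
    intro g hg
    obtain ⟨⟨x0, y0⟩, h0, rfl⟩ := Finset.mem_image.mp hg
    rw [Finset.mem_product, hSm, hSm] at h0
    rw [Finset.mem_sdiff, hSm]
    refine ⟨Finset.mem_univ _, fun hm => haB ?_⟩
    have : a = x0⁻¹ * (x0 * a * y0) * y0⁻¹ := by group
    rw [this]
    exact mul_mem (mul_mem (inv_mem h0.1) hm) (inv_mem h0.2)
  rw [Finset.card_sdiff_of_subset (Finset.subset_univ _), Finset.card_univ,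
    ← Nat.card_eq_fintype_card, card_tight hT hAB, hS] at h2
  rw [Finset.card_product, hS] at h1
  have h3 := h1.trans (Nat.mul_le_mul_left _ h2)
  have h4 : orderOf a * orderOf b - orderOf b = (orderOf a - 1) * orderOf b := by
    rw [Nat.sub_mul, one_mul]
  rw [h4, ← mul_assoc] at h3
  exact Nat.le_of_mul_le_mul_right h3 (orderOf_pos b)

end TightChiral

namespace TightChiral
open Subgroup
open scoped commutatorElement

/-- Structural facts about an atomic pair with `p < q`. -/
structure Ctx {G : Type*} [Group G] (a b : G) (p q m : ℕ) : Prop where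
  hT : IsTight a b
  hpa : orderOf a = p
  hqb : orderOf b = q
  hp2 : 2 ≤ p
  hq2 : 2 ≤ q
  ht : (a * b) ^ 2 = 1
  hAB : zpowers a ⊓ zpowers b = ⊥
  hch : IsChiral a b
  hm : m.Prime
  coreA : ∀ x ∈ zpowers a, (zpowers x).Normal → x = 1
  coreB : ∀ x ∈ zpowers b, (zpowers x).Normal → ∀ s : ℕ, s.Prime → s ∣ orderOf x → s = m
  hn : ∃ n ∈ core a b, orderOf n = m ∧ n ∈ commutator G

lemma prime_disj {G : Type*} [Group G] [Finite G] {n : G} {K : Subgroup G}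
    (hn : (orderOf n).Prime) (h : n ∉ K) : zpowers n ⊓ K = ⊥ := by
  rw [eq_bot_iff]
  rintro x ⟨hx, hxK⟩
  rw [mem_bot]
  by_contra hx1
  apply h
  have h1 : orderOf x = orderOf n := by
    have := orderOf_dvd_of_mem_zpowers hx
    rcases (Nat.dvd_prime hn).mp this with h | h
    · exact absurd (orderOf_eq_one_iff.mp h) hx1
    · exact h
  have h2 : n ∈ zpowers x := mem_zpowers_of_dvd (mem_zpowers n) hx (by rw [h1])
  exact (zpowers_le.mpr hxK) h2

lemma exists_ctx {G : Type*} [Group G] [Finite G] {a b : G} {p q : ℕ}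
    (hpq : p < q) (h : IsAtomicPair a b p q) : ∃ m, Ctx a b p q m := by
  have h0 := h
  obtain ⟨⟨_, hp, hq, hp2, hq2, ht, hAB⟩, hT, hch, -, -⟩ := h
  have ha1 : a ≠ 1 := by
    rintro rfl
    simp at hp; omega
  have hcc := card_core hT hAB ha1
  have hC1 : Nat.card (core a b) ≠ 1 := by
    intro h1
    rw [h1] at hcc; omega
  obtain ⟨m, hm, hmd⟩ := Nat.exists_prime_and_dvd hC1
  have := Fact.mk hm
  obtain ⟨⟨n, hnC⟩, hn⟩ := exists_prime_orderOf_dvd_card' (G := core a b) m hmd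
  rw [Subgroup.orderOf_mk] at hn
  have hnN := core_normal hT hnC
  have hnB := (mem_core.mp hnC).1
  have hn1 : n ≠ 1 := by
    rintro rfl
    rw [orderOf_one] at hn
    exact hm.one_lt.ne hn
  have hnR : Reg a b (zpowers n) :=
    reg_of_le_b h0 (zpowers_le.mpr hnB) (mem_zpowers n) hn1
  have key : ∀ K : Subgroup G, Reg a b K → n ∈ K := by
    intro K hK
    by_contra hc
    apply hch
    apply regular_of_reg_bot hT
    rw [← prime_disj (hn ▸ hm) hc]
    exact hnR.inf hK
  refine ⟨m, hT, hp, hq, hp2, hq2, ht, hAB, hch, hm, ?_, ?_, n, hnC, hn, ?_⟩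
  · intro x hx hxN
    by_contra hx1
    have h1 := key _ (reg_of_le_a h0 (zpowers_le.mpr hx) (mem_zpowers x) hx1)
    exact hn1 (inf_bot hAB ((zpowers_le.mpr hx) h1) hnB)
  · intro x hx hxN s hs hsd
    have e : orderOf (x ^ (orderOf x / s)) = s := orderOf_pow_orderOf_div (orderOf_pos x).ne' hsd
    have hyN := normal_of_mem_normal hxN (npow_mem_zpowers x (orderOf x / s))
    have hyB : x ^ (orderOf x / s) ∈ zpowers b := pow_mem hx _
    have h1 := key _ (reg_of_le_b h0 (zpowers_le.mpr hyB) (mem_zpowers _) (by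
      intro h1
      rw [h1, orderOf_one] at e
      exact hs.one_lt.ne e))
    have h2 := orderOf_dvd_of_mem_zpowers h1
    rw [e, hn] at h2
    exact ((Nat.prime_dvd_prime_iff_eq hm hs).mp h2).symm
  · exact key _ (reg_of_comm le_rfl)

namespace Ctx
variable {G : Type*} [Group G] [Finite G] {a b : G} {p q m : ℕ}

lemma invF (c : Ctx a b p q m) {f : G} (hf : f ∈ commutator G) :
    (a * b) * f * (a * b)⁻¹ = f⁻¹ := inv_F c.hT c.ht f hf

lemma conj_b (c : Ctx a b p q m) {f : G} (hf : f ∈ commutator G) :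
    b * f * b⁻¹ = a⁻¹ * f⁻¹ * a := by
  rw [← c.invF hf]; group

lemma conj_a (c : Ctx a b p q m) {f : G} (hf : f ∈ commutator G) :
    a * f * a⁻¹ = b⁻¹ * f⁻¹ * b := by
  have h1 := c.invF (f := b⁻¹ * f * b) (by
    have := Subgroup.Normal.conj_mem (H := commutator G) inferInstance f hf b⁻¹
    simpa using this)
  have : a * f * a⁻¹ = a * b * (b⁻¹ * f * b) * (a * b)⁻¹ := by group
  rw [this, h1]; group

lemma comm_of_mem {x y g : G} (hx : x ∈ zpowers g) (hy : y ∈ zpowers g) : x * y = y * x := by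
  obtain ⟨k, rfl⟩ := mem_zpowers_iff.mp hx
  obtain ⟨l, rfl⟩ := mem_zpowers_iff.mp hy
  rw [← zpow_add, ← zpow_add, add_comm]

lemma conj_eq {x y : G} (h : x * y = y * x) : x * y * x⁻¹ = y := by rw [h]; group

lemma AF (c : Ctx a b p q m) {x : G} (hx : x ∈ zpowers a) (hF : x ∈ commutator G) : x = 1 := by
  apply c.coreA x hx
  apply normal_zpowers c.hT
  · rw [conj_eq (comm_of_mem (mem_zpowers a) hx)]
    exact mem_zpowers x
  · rw [c.conj_b hF]
    have h1 : a⁻¹ * x⁻¹ * a = x⁻¹ := by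
      have := conj_eq (comm_of_mem (inv_mem (mem_zpowers a)) (inv_mem hx))
      simpa using this
    rw [h1]
    exact inv_mem (mem_zpowers x)

lemma BF (c : Ctx a b p q m) {x : G} (hx : x ∈ zpowers b) (hF : x ∈ commutator G) :
    (zpowers x).Normal := by
  apply normal_zpowers c.hT
  · rw [c.conj_a hF]
    have h1 : b⁻¹ * x⁻¹ * b = x⁻¹ := by
      have := conj_eq (comm_of_mem (inv_mem (mem_zpowers b)) (inv_mem hx))
      simpa using this
    rw [h1]
    exact inv_mem (mem_zpowers x)
  · rw [conj_eq (comm_of_mem (mem_zpowers b) hx)]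
    exact mem_zpowers x

lemma commQ (x y : G ⧸ commutator G) : x * y = y * x :=
  (Subgroup.Normal.quotient_commutative_iff_commutator_le.mpr
    (le_refl (commutator G))).is_comm.comm x y

lemma abpow (c : Ctx a b p q m) (k : ℕ) : a ^ (2 * k) * b ^ (2 * k) ∈ commutator G := by
  rw [← QuotientGroup.eq_one_iff]
  have h1 : ((a : G ⧸ commutator G) * b) ^ 2 = 1 := by
    have := congrArg (fun g : G => (g : G ⧸ commutator G)) c.ht
    simpa using this
  have hc : Commute (a : G ⧸ commutator G) b := commQ _ _
  have : ((a ^ (2 * k) * b ^ (2 * k) : G) : G ⧸ commutator G)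
      = (((a : G ⧸ commutator G) * b) ^ 2) ^ k := by
    rw [← pow_mul, hc.mul_pow]; simp
  rw [this, h1, one_pow]

lemma apow_mem (c : Ctx a b p q m) {k : ℕ} (h : b ^ (2 * k) ∈ commutator G) : p ∣ 2 * k := by
  rw [← c.hpa, orderOf_dvd_iff_pow_eq_one]
  apply c.AF (npow_mem_zpowers a _)
  exact (Subgroup.mul_mem_cancel_right _ h).mp (c.abpow k)

lemma p_dvd (c : Ctx a b p q m) : p ∣ 2 * q := by
  apply c.apow_mem
  have : b ^ (2 * q) = 1 := by rw [← orderOf_dvd_iff_pow_eq_one, c.hqb]; exact Dvd.intro_left _ rfl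
  rw [this]; exact one_mem _

lemma order_pow (c : Ctx a b p q m) {x : G} (hx : x ∈ zpowers b) (hN : (zpowers x).Normal) :
    ∃ j, orderOf x = m ^ j := by
  refine ⟨_, Nat.eq_prime_pow_of_unique_prime_dvd (orderOf_pos x).ne' ?_⟩
  intro d hd hdd
  exact c.coreB x hx hN d hd hdd

lemma b2p_mem (c : Ctx a b p q m) : b ^ (2 * p) ∈ commutator G := by
  have h := c.abpow p
  have : a ^ (2 * p) = 1 := by rw [← orderOf_dvd_iff_pow_eq_one, c.hpa]; exact Dvd.intro_left _ rfl
  rwa [this, one_mul] at h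

lemma q_dvd (c : Ctx a b p q m) : ∃ j, q ∣ 2 * p * m ^ j := by
  obtain ⟨j, hj⟩ := c.order_pow (npow_mem_zpowers b (2 * p)) (c.BF (npow_mem_zpowers b _) c.b2p_mem)
  refine ⟨j, ?_⟩
  rw [← c.hqb, orderOf_dvd_iff_pow_eq_one, pow_mul, ← hj, pow_orderOf_eq_one]

lemma cardG (c : Ctx a b p q m) : Nat.card G = p * q := by
  rw [card_tight c.hT c.hAB, c.hpa, c.hqb]

lemma card_F_dvd (c : Ctx a b p q m) : Nat.card (commutator G) ∣ q := by
  have h1 : orderOf (QuotientGroup.mk' (commutator G) a) = orderOf a := by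
    apply orderOf_map_of_ker
    intro x hx h
    exact c.AF hx ((QuotientGroup.eq_one_iff x).mp h)
  have h2 : p ∣ Nat.card (G ⧸ commutator G) := by
    rw [← c.hpa, ← h1]; exact orderOf_dvd_natCard _
  have h3 := Subgroup.card_eq_card_quotient_mul_card_subgroup (commutator G)
  rw [c.cardG] at h3
  obtain ⟨k, hk⟩ := h2
  rw [hk, mul_assoc] at h3
  have := Nat.eq_of_mul_eq_mul_left (by have := c.hp2; omega) h3
  rw [this]; exact Dvd.intro_left _ rfl

lemma q_dvd_F (c : Ctx a b p q m) : q ∣ 2 * Nat.card (commutator G) := by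
  let Q := G ⧸ commutator G
  let A : Q := (a : G)
  let T : Q := ((a * b : G) : Q)
  let φ : zpowers A × zpowers T →* Q :=
    { toFun := fun z => (z.1 : Q) * z.2
      map_one' := by simp
      map_mul' := by
        rintro ⟨x, y⟩ ⟨x', y'⟩
        simp only [Prod.mk_mul_mk, Subgroup.coe_mul]
        rw [mul_assoc, mul_assoc, ← mul_assoc (x' : Q), commQ (x' : Q) y, mul_assoc] }
  have hφ : Function.Surjective φ := by
    intro g
    obtain ⟨g, rfl⟩ := QuotientGroup.mk_surjective g
    obtain ⟨i, j, rfl⟩ := c.hT g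
    refine ⟨⟨⟨A ^ (i - j), zpow_mem_zpowers _ _⟩, ⟨T ^ j, zpow_mem_zpowers _ _⟩⟩, ?_⟩
    have hT' : T = A * (b : Q) := rfl
    have hc : Commute A (b : Q) := commQ _ _
    change A ^ (i - j) * T ^ j = _
    rw [hT', hc.mul_zpow, ← mul_assoc, ← zpow_add, sub_add_cancel]
    rfl
  have h1 := Subgroup.card_dvd_of_surjective φ hφ
  rw [Nat.card_prod, Nat.card_zpowers, Nat.card_zpowers] at h1
  have h2 : orderOf A ∣ p := by
    rw [← c.hpa]; exact orderOf_map_dvd (QuotientGroup.mk' (commutator G)) a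
  have h3 : orderOf T ∣ 2 := by
    refine (orderOf_map_dvd (QuotientGroup.mk' (commutator G)) (a * b)).trans ?_
    exact orderOf_dvd_of_pow_eq_one c.ht
  have h4 : Nat.card Q ∣ p * 2 := h1.trans (mul_dvd_mul h2 h3)
  have h5 := Subgroup.card_eq_card_quotient_mul_card_subgroup (commutator G)
  rw [c.cardG] at h5
  have h6 : p * q ∣ p * (2 * Nat.card (commutator G)) := by
    rw [h5, ← mul_assoc]; exact mul_dvd_mul_right h4 _
  exact Nat.dvd_of_mul_dvd_mul_left (by have := c.hp2; omega) h6

end Ctx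
end TightChiral

namespace TightChiral
open Subgroup
open scoped commutatorElement

/-- torsion in a commuting subgroup -/
def tors {G : Type*} [Group G] (F : Subgroup G) (hF : ∀ f ∈ F, ∀ g ∈ F, f * g = g * f)
    (k : ℕ) : Subgroup G where
  carrier := {f | f ∈ F ∧ f ^ k = 1}
  one_mem' := ⟨one_mem _, one_pow _⟩
  mul_mem' := by
    rintro x y ⟨hx, hx'⟩ ⟨hy, hy'⟩
    refine ⟨mul_mem hx hy, ?_⟩
    have hc : Commute x y := hF x hx y hy
    rw [hc.mul_pow, hx', hy', one_mul]
  inv_mem' := by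
    rintro x ⟨hx, hx'⟩
    exact ⟨inv_mem hx, by rw [inv_pow, hx', inv_one]⟩

lemma tors_normal {G : Type*} [Group G] (F : Subgroup G) [hN : F.Normal]
    (hF : ∀ f ∈ F, ∀ g ∈ F, f * g = g * f) (k : ℕ) : (tors F hF k).Normal := by
  refine ⟨?_⟩
  rintro f ⟨hf, hf'⟩ g
  exact ⟨hN.conj_mem f hf g, by rw [conj_pow, hf']; group⟩

lemma card_tors_le {G : Type*} [Group G] [Finite G] (F : Subgroup G)
    (hF : ∀ f ∈ F, ∀ g ∈ F, f * g = g * f) {s k M : ℕ} (hs : s.Prime)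
    (hc : Nat.card F = s ^ k * M) (hM : ¬ s ∣ M) : Nat.card (tors F hF (s ^ k)) ≤ s ^ k := by
  have := Fact.mk hs
  have h1 : IsPGroup s (tors F hF (s ^ k)) := by
    rintro ⟨x, hx⟩
    exact ⟨k, Subtype.ext hx.2⟩
  obtain ⟨l, hl⟩ := IsPGroup.iff_card.mp h1
  have h2 : Nat.card (tors F hF (s ^ k)) ∣ Nat.card F :=
    Subgroup.card_dvd_of_le (fun x hx => hx.1)
  rw [hl, hc] at h2
  have h3 : Nat.Coprime (s ^ l) M := Nat.Coprime.pow_left _ ((Nat.Prime.coprime_iff_not_dvd hs).mpr hM)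
  have h4 := h3.dvd_of_dvd_mul_right h2
  rw [hl]
  exact Nat.le_of_dvd (pow_pos hs.pos _) h4

lemma fixed_exists {G : Type*} [Group G] [Finite G] {V : Subgroup G} [V.Normal] {s v : ℕ}
    (hs : s.Prime) {z : G} (hz : orderOf z = s ^ v) (hd : s ∣ Nat.card V) :
    ∃ f ∈ V, f ≠ 1 ∧ z * f = f * z := by
  have := Fact.mk hs
  have hP : IsPGroup s (zpowers z) := IsPGroup.of_card (n := v) (by rw [Nat.card_zpowers, hz])
  letI : MulAction (zpowers z) V :=
    MulAction.compHom V ((MulAut.conjNormal (H := V)).comp (zpowers z).subtype)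
  have hsm : ∀ (g : zpowers z) (x : V), ((g • x : V) : G) = g * x * (g : G)⁻¹ := fun g x => rfl
  obtain ⟨f, hf, hf1⟩ := hP.exists_fixed_point_of_prime_dvd_card_of_fixed_point V hd (a := 1) (by
    intro g
    apply Subtype.ext
    rw [hsm]; simp)
  refine ⟨f, f.2, ?_, ?_⟩
  · intro h; apply hf1; apply Subtype.ext; simp [h]
  · have h1 := congrArg (Subtype.val) (hf ⟨z, mem_zpowers z⟩)
    rw [hsm] at h1
    exact mul_inv_eq_iff_eq_mul.mp h1

lemma orbit_small {G : Type*} [Group G] [Finite G] (F : Subgroup G) [hN : F.Normal]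
    (hF : ∀ f ∈ F, ∀ g ∈ F, f * g = g * f) {s k M v : ℕ} (hs : s.Prime)
    (hc : Nat.card F = s ^ k * M) (hM : ¬ s ∣ M) (hkv : k ≤ v) {z : G} (hz : orderOf z = s ^ v)
    {g : G} (hg : g ∈ tors F hF (s ^ k)) (hg1 : g ≠ 1) :
    ∃ y ∈ zpowers z, y ≠ 1 ∧ y * g = g * y := by
  have hTN := tors_normal F hF (s ^ k)
  let φ : zpowers z → tors F hF (s ^ k) := fun y => ⟨y * g * (y : G)⁻¹, hTN.conj_mem g hg y⟩
  by_cases hi : Function.Injective φ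
  · exfalso
    have h1 : Nat.card (tors F hF (s ^ k)) ≤ Nat.card (zpowers z) := by
      rw [Nat.card_zpowers, hz]
      exact (card_tors_le F hF hs hc hM).trans (Nat.pow_le_pow_right hs.pos hkv)
    have hb := hi.bijective_of_nat_card_le h1
    obtain ⟨y, hy⟩ := hb.2 1
    have h2 : (y : G) * g * (y : G)⁻¹ = 1 := congrArg Subtype.val hy
    apply hg1
    simpa using h2
  · simp only [Function.Injective, not_forall] at hi
    obtain ⟨y1, y2, he, hne⟩ := hi
    have he' : (y1 : G) * g * (y1 : G)⁻¹ = y2 * g * (y2 : G)⁻¹ := congrArg Subtype.val he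
    refine ⟨(y2 : G)⁻¹ * y1, mul_mem (inv_mem y2.2) y1.2, ?_, ?_⟩
    · intro h
      apply hne
      apply Subtype.ext
      rw [inv_mul_eq_one] at h
      exact h.symm
    · have : (y2 : G)⁻¹ * y1 * g = (y2 : G)⁻¹ * (y1 * g * (y1 : G)⁻¹) * y1 := by group
      rw [this, he']; group

namespace Ctx
variable {G : Type*} [Group G] [Finite G] {a b : G} {p q m : ℕ}

/-- arithmetic input for the elimination of other odd primes -/
lemma odd_arith (c : Ctx a b p q m) {s : ℕ} (hs : s.Prime) (hs2 : s ≠ 2) (hsm : s ≠ m)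
    (h : s ∣ p ∨ s ∣ q) : ∃ v p' k M : ℕ, p = s ^ v * p' ∧ ¬ s ∣ p' ∧
      Nat.card (commutator G) = s ^ k * M ∧ ¬ s ∣ M ∧ k ≤ v ∧ s ∣ Nat.card (commutator G) := by
  have hn2 : ¬ s ∣ 2 := fun h => hs2 ((Nat.prime_dvd_prime_iff_eq hs Nat.prime_two).mp h)
  have hnm : ¬ s ∣ m := fun h => hsm ((Nat.prime_dvd_prime_iff_eq hs c.hm).mp h)
  have hq : s ∣ q := by
    rcases h with h | h
    · exact (hs.dvd_mul.mp (h.trans c.p_dvd)).resolve_left hn2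
    · exact h
  have hF : s ∣ Nat.card (commutator G) :=
    (hs.dvd_mul.mp (hq.trans c.q_dvd_F)).resolve_left hn2
  have hp0 : p ≠ 0 := by have := c.hp2; omega
  obtain ⟨v, p', hp', hpe⟩ := Nat.exists_eq_pow_mul_and_not_dvd hp0 s hs.ne_one
  obtain ⟨k, M, hM, hFe⟩ := Nat.exists_eq_pow_mul_and_not_dvd
    (Nat.card_pos (α := commutator G)).ne' s hs.ne_one
  refine ⟨v, p', k, M, hpe, hp', hFe, hM, ?_, hF⟩
  obtain ⟨j, hj⟩ := c.q_dvd
  have h1 : s ^ k ∣ 2 * p * m ^ j := by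
    refine Dvd.dvd.trans ?_ (c.card_F_dvd.trans hj)
    rw [hFe]; exact Dvd.intro _ rfl
  have hc2 : Nat.Coprime (s ^ k) 2 := Nat.Coprime.pow_left _ ((Nat.Prime.coprime_iff_not_dvd hs).mpr hn2)
  have hcm : Nat.Coprime (s ^ k) (m ^ j) :=
    Nat.Coprime.pow _ _ ((Nat.Prime.coprime_iff_not_dvd hs).mpr hnm)
  have hcp : Nat.Coprime (s ^ k) p' := Nat.Coprime.pow_left _ ((Nat.Prime.coprime_iff_not_dvd hs).mpr hp')
  have h2 := hc2.dvd_of_dvd_mul_left (hcm.dvd_of_dvd_mul_right h1)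
  rw [hpe] at h2
  exact (Nat.pow_dvd_pow_iff_le_right hs.one_lt).mp (hcp.dvd_of_dvd_mul_right h2)

end Ctx
end TightChiral

namespace TightChiral
open Subgroup
open scoped commutatorElement

namespace Ctx
variable {G : Type*} [Group G] [Finite G] {a b : G} {p q m : ℕ}

lemma W_step (c : Ctx a b p q m) {s v p' : ℕ} (hs : s.Prime) (hsm : s ≠ m)
    (hp : p = s ^ v * p') (hp' : ¬ s ∣ p') (hF : s ∣ Nat.card (commutator G)) {z : G}
    (hzA : z ∈ zpowers a) (hz : orderOf z = s ^ v) :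
    ∃ w x : G, w ∈ commutator G ∧ x ∈ zpowers z ∧ w * x ∈ zpowers b ∧ orderOf w = s ∧
      orderOf x = s ∧ orderOf (w * x) = s ∧ x * w = w * x ∧ (zpowers w).Normal := by
  have := Fact.mk hs
  have hito := ito c.hT
  have hza : a * z = z * a := comm_of_mem (mem_zpowers a) hzA
  have hza' : a⁻¹ * z = z * a⁻¹ := comm_of_mem (inv_mem (mem_zpowers a)) hzA
  let V := tors (commutator G) hito s
  have hVN : V.Normal := tors_normal _ hito s
  have hV : s ∣ Nat.card V := by
    obtain ⟨⟨f, hfF⟩, hf⟩ := exists_prime_orderOf_dvd_card' (G := commutator G) s hF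
    rw [Subgroup.orderOf_mk] at hf
    have hfV : f ∈ V := ⟨hfF, by rw [← hf, pow_orderOf_eq_one]⟩
    rw [← hf]
    exact Subgroup.orderOf_dvd_natCard V hfV
  obtain ⟨w0, hw0V, hw01, hw0z⟩ := fixed_exists hs hz hV
  let W : Subgroup G :=
    { carrier := {f | f ∈ V ∧ z * f = f * z}
      one_mem' := ⟨one_mem _, by simp⟩
      mul_mem' := by
        rintro x y ⟨hx, hx'⟩ ⟨hy, hy'⟩
        exact ⟨mul_mem hx hy, by rw [← mul_assoc, hx', mul_assoc, hy', mul_assoc]⟩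
      inv_mem' := by
        rintro x ⟨hx, hx'⟩
        refine ⟨inv_mem hx, ?_⟩
        have : Commute z x := hx'
        exact this.inv_right }
  have hWF : ∀ f ∈ W, f ∈ commutator G := fun f hf => hf.1.1
  have hconj : ∀ g : G, g * z = z * g → ∀ f ∈ W, g * f * g⁻¹ ∈ W := by
    rintro g hg f ⟨hf, hf'⟩
    refine ⟨hVN.conj_mem f hf g, ?_⟩
    have h1 : Commute z g := hg.symm
    have h2 : Commute z f := hf'
    exact (h1.mul_right h2).mul_right h1.inv_right
  have hWN : W.Normal := by
    apply normal_of_conj c.hT (hconj a hza)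
    intro f hf
    rw [c.conj_b (hWF f hf)]
    have := hconj a⁻¹ hza' f⁻¹ (inv_mem hf)
    simpa using this
  have hw0W : w0 ∈ W := ⟨hw0V, hw0z⟩
  have hWA : ∀ f ∈ W, f ∈ zpowers a → f = 1 := fun f hf hA => c.AF hA (hWF f hf)
  have hWord : ∀ f ∈ W, f ≠ 1 → orderOf f = s := by
    intro f hf hf1
    exact orderOf_eq_prime hf.1.2 hf1
  let D : Subgroup G := zpowers b ⊓ (W ⊔ zpowers a)
  have hDdec : ∀ d ∈ D, ∃ w ∈ W, ∃ x ∈ zpowers a, d = w * x := by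
    rintro d ⟨_, hd⟩
    obtain ⟨w, hw, x, hx, h⟩ := Subgroup.mem_sup_of_normal_left.mp hd
    exact ⟨w, hw, x, hx, h.symm⟩
  have hWdec : ∀ w ∈ W, ∃ x ∈ zpowers a, w * x ∈ D := by
    intro w hw
    obtain ⟨i, j, h⟩ := tight_swap c.hT w
    refine ⟨a ^ (-j), zpow_mem_zpowers _ _, ?_, mul_mem (mem_sup_left hw)
      (mem_sup_right (zpow_mem_zpowers _ _))⟩
    rw [h, mul_assoc, ← zpow_add, add_neg_cancel, zpow_zero, mul_one]
    exact zpow_mem_zpowers _ _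
  have hDB : ∀ d ∈ D, d ∈ zpowers b := fun d hd => hd.1
  have hDle : Nat.card D ≤ Nat.card W := by
    choose f hf x hx he using hDdec
    apply Nat.card_le_card_of_injective (fun d : D => (⟨f d d.2, hf d d.2⟩ : W))
    intro d d' h
    have h1 : f d d.2 = f d' d'.2 := congrArg Subtype.val h
    have h2 : (d : G)⁻¹ * d' = (x d d.2)⁻¹ * x d' d'.2 := by
      conv_lhs => rw [he d d.2, he d' d'.2, h1]
      group
    have h3 : (d : G)⁻¹ * d' = 1 := by
      apply inf_bot c.hAB
      · rw [h2]; exact mul_mem (inv_mem (hx _ _)) (hx _ _)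
      · exact mul_mem (inv_mem (hDB _ d.2)) (hDB _ d'.2)
    apply Subtype.ext
    rwa [inv_mul_eq_one] at h3
  have hWle : Nat.card W ≤ Nat.card D := by
    choose x hx hxD using hWdec
    apply Nat.card_le_card_of_injective (fun w : W => (⟨w * x w w.2, hxD w w.2⟩ : D))
    intro w w' h
    have h1 : (w : G) * x w w.2 = w' * x w' w'.2 := congrArg Subtype.val h
    have h2 : (w' : G)⁻¹ * w = x w' w'.2 * (x w w.2)⁻¹ := by
      rw [inv_mul_eq_iff_eq_mul, ← mul_assoc, ← h1]; group
    have h3 : (w' : G)⁻¹ * w = 1 := by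
      apply hWA _ (mul_mem (inv_mem w'.2) w.2)
      rw [h2]; exact mul_mem (hx _ _) (inv_mem (hx _ _))
    apply Subtype.ext
    rw [inv_mul_eq_one] at h3
    exact h3.symm
  have hDW : Nat.card D = Nat.card W := le_antisymm hDle hWle
  have hWp : IsPGroup s W := by
    rintro ⟨x, hx⟩
    exact ⟨1, Subtype.ext (by rw [pow_one]; exact hx.1.2)⟩
  obtain ⟨N, hN⟩ := IsPGroup.iff_card.mp hWp
  have hxz : ∀ w ∈ W, ∀ x ∈ zpowers a, w * x ∈ D → x ∈ zpowers z ∧ x ^ s = 1 ∧ (w * x) ^ s = 1 := by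
    intro w hw x hx hd
    have h1 : (w * x) ^ (s ^ N) = 1 := by
      rw [← hN, ← hDW]
      exact orderOf_dvd_iff_pow_eq_one.mp (Subgroup.orderOf_dvd_natCard D hd)
    have h2 : x ^ (s ^ N) ∈ W := by
      rw [← QuotientGroup.eq_one_iff]
      have h3 : ((w : G) : G ⧸ W) = 1 := (QuotientGroup.eq_one_iff _).mpr hw
      have h4 := congrArg (fun g : G => (g : G ⧸ W)) h1
      simpa [h3] using h4
    have h3 := hWA _ h2 (pow_mem hx _)
    have h4 : orderOf x ∣ s ^ N := orderOf_dvd_of_pow_eq_one h3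
    have h5 : orderOf x ∣ s ^ v := by
      have h6 : orderOf x ∣ s ^ v * p' := by
        rw [← hp, ← c.hpa]; exact orderOf_dvd_of_mem_zpowers hx
      have h7 : Nat.Coprime (orderOf x) p' :=
        Nat.Coprime.coprime_dvd_left h4
          (Nat.Coprime.pow_left _ ((Nat.Prime.coprime_iff_not_dvd hs).mpr hp'))
      exact h7.dvd_of_dvd_mul_right h6
    have h8 : x ∈ zpowers z := mem_zpowers_of_dvd hx hzA (by rw [hz]; exact h5)
    have hcz : Commute z w := hw.2
    have hcx : Commute w x := by
      obtain ⟨i, rfl⟩ := mem_zpowers_iff.mp h8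
      exact (hcz.zpow_left i).symm
    have h9 : (w * x) ^ s = x ^ s := by
      rw [hcx.mul_pow, hw.1.2, one_mul]
    have h10 : x ^ s = 1 := inf_bot c.hAB (pow_mem hx _) (by
      rw [← h9]; exact pow_mem (hDB _ hd) _)
    exact ⟨h8, h10, by rw [h9, h10]⟩
  obtain ⟨x, hx, hxD⟩ := hWdec w0 hw0W
  obtain ⟨hxz0, hxs, hds⟩ := hxz w0 hw0W x hx hxD
  have hd1 : w0 * x ≠ 1 := by
    intro h
    apply hw01
    apply hWA w0 hw0W
    rw [mul_eq_one_iff_eq_inv.mp h]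
    exact inv_mem hx
  have hdo : orderOf (w0 * x) = s := orderOf_eq_prime hds hd1
  have hDz : D ≤ zpowers (w0 * x) := by
    intro d hd
    obtain ⟨w, hw, y, hy, rfl⟩ := hDdec d hd
    apply mem_zpowers_of_dvd (hDB _ hd) (hDB _ hxD)
    rw [hdo]
    exact orderOf_dvd_of_pow_eq_one (hxz w hw y hy hd).2.2
  have hDs : Nat.card D ≤ s := by
    have := Nat.le_of_dvd Nat.card_pos (Subgroup.card_dvd_of_le hDz)
    rwa [Nat.card_zpowers, hdo] at this
  have hw0o := hWord w0 hw0W hw01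
  have hWz : zpowers w0 = W := by
    apply Subgroup.eq_of_le_of_card_ge (zpowers_le.mpr hw0W)
    rw [Nat.card_zpowers, hw0o, ← hDW]
    exact hDs
  have hx1 : x ≠ 1 := by
    rintro rfl
    rw [mul_one] at hxD hdo
    exact hsm (c.coreB w0 (hDB _ hxD) (c.BF (hDB _ hxD) (hWF _ hw0W)) s hs (by rw [hdo]))
  refine ⟨w0, x, hWF _ hw0W, hxz0, hDB _ hxD, hw0o, orderOf_eq_prime hxs hx1, hdo, ?_, ?_⟩
  · have hcz : Commute z w0 := hw0z
    obtain ⟨i, rfl⟩ := mem_zpowers_iff.mp hxz0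
    exact (hcz.zpow_left i)
  · rw [hWz]; exact hWN

lemma no_odd (c : Ctx a b p q m) {s : ℕ} (hs : s.Prime) (hs2 : s ≠ 2) (hsm : s ≠ m)
    (h : s ∣ p ∨ s ∣ q) : False := by
  have hito := ito c.hT
  obtain ⟨v, p', k, M, hp, hp', hFc, hM, hkv, hsF⟩ := c.odd_arith hs hs2 hsm h
  have hz : orderOf (a ^ p') = s ^ v := by
    rw [orderOf_pow_of_dvd, c.hpa, hp, Nat.mul_div_cancel]
    · exact Nat.pos_of_ne_zero (by rintro rfl; simp at hp')
    · rintro rfl; simp at hp'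
    · rw [c.hpa, hp]; exact Dvd.intro_left _ rfl
  obtain ⟨w, x, hwF, hxz, hdB, hw, hx, hd, hxw, hWN⟩ :=
    c.W_step hs hsm hp hp' hsF (npow_mem_zpowers a p') hz
  have hxA : x ∈ zpowers a := (zpowers_le.mpr (npow_mem_zpowers a p')) hxz
  have hne : ∀ g : G, orderOf g = s → g ≠ 1 := by
    rintro g hg rfl
    rw [orderOf_one] at hg
    exact hs.one_lt.ne hg
  have hax : Commute a x := comm_of_mem (mem_zpowers a) hxA
  have hbd : Commute b (w * x) := comm_of_mem (mem_zpowers b) hdB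
  have h1 : ¬ Commute a w := by
    intro hc
    have hcd : Commute a (w * x) := hc.mul_right hax
    apply hsm
    apply c.coreB _ hdB _ s hs (by rw [hd])
    apply normal_zpowers c.hT
    · rw [conj_eq hcd]; exact mem_zpowers _
    · rw [conj_eq hbd]; exact mem_zpowers _
  have h2 : ¬ Commute b w := by
    intro hc
    have hcx : Commute b x := by
      have := hc.inv_right.mul_right hbd
      simpa using this
    apply hne x hx
    apply c.coreA x hxA
    apply normal_zpowers c.hT
    · rw [conj_eq hax]; exact mem_zpowers _
    · rw [conj_eq hcx]; exact mem_zpowers _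
  obtain ⟨u, hu⟩ : ∃ u, u = b * w⁻¹ * b⁻¹ * w := ⟨_, rfl⟩
  have huW : u ∈ zpowers w := by
    rw [hu]
    exact mul_mem (hWN.conj_mem _ (inv_mem (mem_zpowers w)) b) (mem_zpowers w)
  have hu1 : u ≠ 1 := by
    intro h
    apply h2
    rw [hu, mul_eq_one_iff_eq_inv] at h
    have : Commute b w⁻¹ := mul_inv_eq_iff_eq_mul.mp h
    simpa using this.inv_right
  have hbx : b * x * b⁻¹ = u * x := by
    have e1 : b * (w * x) * b⁻¹ = w * x := conj_eq hbd
    have e2 : b * x * b⁻¹ = (b * w⁻¹ * b⁻¹) * (b * (w * x) * b⁻¹) := by group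
    rw [e2, e1, hu]; group
  have hzF : zpowers w ≤ commutator G := zpowers_le.mpr hwF
  have huF := hzF huW
  obtain ⟨f, hf⟩ : ∃ f, f = a * b * a⁻¹ * b⁻¹ := ⟨_, rfl⟩
  have hfF : f ∈ commutator G := by
    rw [hf, ← commutatorElement_def]
    exact Subgroup.commutator_mem_commutator (mem_top _) (mem_top _)
  obtain ⟨u', hu'⟩ : ∃ u', u' = u⁻¹ * (a * u * a⁻¹) := ⟨_, rfl⟩
  have hu'W : u' ∈ zpowers w := by
    rw [hu']; exact mul_mem (inv_mem huW) (hWN.conj_mem _ huW a)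
  have hcard : ∀ y ∈ zpowers w, y ≠ 1 → orderOf y = s := by
    intro y hy hy1
    have := orderOf_dvd_of_mem_zpowers hy
    rw [hw] at this
    exact ((Nat.dvd_prime hs).mp this).resolve_left (fun h => hy1 (orderOf_eq_one_iff.mp h))
  have hu'1 : u' ≠ 1 := by
    intro h
    rw [hu', inv_mul_eq_one, eq_comm] at h
    apply h1
    have h3 : Commute a u := mul_inv_eq_iff_eq_mul.mp h
    have h4 : w ∈ zpowers u :=
      mem_zpowers_of_dvd (mem_zpowers w) huW (by rw [hcard u huW hu1, hw])
    obtain ⟨i, rfl⟩ := mem_zpowers_iff.mp h4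
    exact h3.zpow_right i
  have hfx : f * x * f⁻¹ = u' * x := by
    have e1 : b⁻¹ * x * b = b⁻¹ * u⁻¹ * b * x := by
      have : b⁻¹ * u⁻¹ * b * x = b⁻¹ * u⁻¹ * (b * x * b⁻¹) * b := by group
      rw [this, hbx]; group
    have e2 : a⁻¹ * x * a = x := by
      have := conj_eq hax.inv_left
      simpa using this
    have e3 : a * x * a⁻¹ = x := conj_eq hax
    have e4 : f * u⁻¹ * f⁻¹ = u⁻¹ := conj_eq (hito f hfF _ (inv_mem huF))
    calc f * x * f⁻¹ = a * b * a⁻¹ * (b⁻¹ * x * b) * a * b⁻¹ * a⁻¹ := by rw [hf]; group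
      _ = a * b * a⁻¹ * b⁻¹ * u⁻¹ * b * a * (a⁻¹ * x * a) * b⁻¹ * a⁻¹ := by rw [e1]; group
      _ = f * u⁻¹ * f⁻¹ * (a * (b * x * b⁻¹) * a⁻¹) := by rw [e2, hf]; group
      _ = u⁻¹ * (a * u * a⁻¹) * (a * x * a⁻¹) := by rw [e4, hbx]; group
      _ = u' * x := by rw [e3, hu']
  have hfk : ∀ k : ℕ, f ^ k * x * (f ^ k)⁻¹ = u' ^ k * x := by
    have hcu : Commute f u' := hito f hfF _ (hzF hu'W)
    intro k
    induction k with
    | zero => simp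
    | succ k ih =>
      have e1 : f ^ (k + 1) * x * (f ^ (k + 1))⁻¹ = f * (f ^ k * x * (f ^ k)⁻¹) * f⁻¹ := by
        rw [pow_succ']; group
      have e2 : f * u' ^ k * f⁻¹ = u' ^ k := conj_eq (hcu.pow_right k)
      have e3 : f * (u' ^ k * x) * f⁻¹ = (f * u' ^ k * f⁻¹) * (f * x * f⁻¹) := by group
      rw [e1, ih, e3, e2, hfx, pow_succ, mul_assoc]
  have hncomm : ¬ Commute (f ^ M) x := by
    intro hc
    have := hfk M
    rw [conj_eq hc, right_eq_mul, ← orderOf_dvd_iff_pow_eq_one, hcard u' hu'W hu'1] at this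
    exact hM this
  have hg : f ^ M ∈ tors (commutator G) hito (s ^ k) := by
    refine ⟨pow_mem hfF _, ?_⟩
    rw [← pow_mul, mul_comm, ← hFc]
    exact orderOf_dvd_iff_pow_eq_one.mp (Subgroup.orderOf_dvd_natCard _ hfF)
  have hg1 : f ^ M ≠ 1 := by
    intro h
    apply hncomm
    rw [h]; exact Commute.one_left x
  obtain ⟨y, hy, hy1, hyc⟩ := orbit_small (commutator G) hito hs hFc hM hkv hz hg hg1
  apply hncomm
  have hxy : x ∈ zpowers y := by
    apply mem_zpowers_of_dvd hxz hy
    rw [hx]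
    have h3 := orderOf_dvd_of_mem_zpowers hy
    rw [hz] at h3
    obtain ⟨i, -, hi⟩ := (Nat.dvd_prime_pow hs).mp h3
    rw [hi]
    apply dvd_pow_self
    rintro rfl
    rw [pow_zero] at hi
    exact hy1 (orderOf_eq_one_iff.mp hi)
  obtain ⟨i, rfl⟩ := mem_zpowers_iff.mp hxy
  have hcy : Commute y (f ^ M) := hyc
  exact (hcy.zpow_left i).symm

end Ctx
end TightChiral

namespace TightChiral
open Subgroup
open scoped commutatorElement

namespace Ctx
variable {G : Type*} [Group G] [Finite G] {a b : G} {p q m : ℕ}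

lemma core_inv (c : Ctx a b p q m) (hm2 : m ≠ 2) {x : G} (hx : x ∈ core a b) :
    a * x * a⁻¹ = x⁻¹ := by
  obtain ⟨hxB, hxB'⟩ := mem_core.mp hx
  by_contra hne
  obtain ⟨y, hy⟩ : ∃ y, y = x * (a * x * a⁻¹) := ⟨_, rfl⟩
  have hyB : y ∈ zpowers b := by rw [hy]; exact mul_mem hxB hxB'
  have hy1 : y ≠ 1 := by
    intro h
    rw [hy] at h
    exact hne (eq_inv_of_mul_eq_one_right h)
  have hby : Commute b y := comm_of_mem (mem_zpowers b) hyB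
  have hti : (a * b)⁻¹ = a * b := by
    rw [inv_eq_iff_mul_eq_one, ← pow_two, c.ht]
  have e1 : (a * b) * x * (a * b)⁻¹ = a * x * a⁻¹ := by
    have := conj_eq (comm_of_mem (mem_zpowers b) hxB)
    calc (a * b) * x * (a * b)⁻¹ = a * (b * x * b⁻¹) * a⁻¹ := by group
      _ = _ := by rw [this]
  have e2 : (a * b) * (a * x * a⁻¹) * (a * b)⁻¹ = x := by
    rw [← e1, hti]
    have h2 : (a * b) * (a * b) = 1 := by rw [← pow_two, c.ht]
    calc a * b * (a * b * x * (a * b)) * (a * b)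
        = ((a * b) * (a * b)) * x * ((a * b) * (a * b)) := by group
      _ = x := by rw [h2]; group
  have hty : Commute (a * b) y := by
    have e3 : (a * b) * y * (a * b)⁻¹ = y := by
      calc (a * b) * y * (a * b)⁻¹
          = ((a * b) * x * (a * b)⁻¹) * ((a * b) * (a * x * a⁻¹) * (a * b)⁻¹) := by
            rw [hy]; group
        _ = y := by rw [e1, e2, hy, comm_of_mem hxB hxB']
    exact mul_inv_eq_iff_eq_mul.mp e3
  have hay : Commute a y := by
    have := hty.mul_left hby.inv_left
    simpa using this
  have hyN : (zpowers y).Normal := by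
    apply normal_zpowers c.hT
    · rw [conj_eq hay]; exact mem_zpowers _
    · rw [conj_eq hby]; exact mem_zpowers _
  obtain ⟨j, hj⟩ := c.order_pow hyB hyN
  obtain ⟨n, hnC, hno, hnF⟩ := c.hn
  have hny : n ∈ zpowers y := by
    apply mem_zpowers_of_dvd (mem_core.mp hnC).1 hyB
    rw [hno, hj]
    apply dvd_pow_self
    rintro rfl
    rw [pow_zero] at hj
    exact hy1 (orderOf_eq_one_iff.mp hj)
  have htn : Commute (a * b) n := by
    obtain ⟨i, rfl⟩ := mem_zpowers_iff.mp hny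
    exact hty.zpow_right i
  have h1 := c.invF hnF
  rw [conj_eq htn] at h1
  have h2 : n ^ 2 = 1 := by
    rw [pow_two]
    exact eq_inv_iff_mul_eq_one.mp h1
  have h3 := orderOf_dvd_of_pow_eq_one h2
  rw [hno] at h3
  exact hm2 ((Nat.prime_dvd_prime_iff_eq c.hm Nat.prime_two).mp h3)

lemma core_mem_F (c : Ctx a b p q m) (hm2 : m ≠ 2) {x : G} (hx : x ∈ core a b) :
    x ∈ commutator G := by
  have h1 := c.core_inv hm2 hx
  have h2 : ⁅a, x⁆ ∈ commutator G := Subgroup.commutator_mem_commutator (mem_top _) (mem_top _)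
  rw [commutatorElement_def, h1] at h2
  have h3 : x ^ 2 ∈ commutator G := by
    have := inv_mem h2
    simpa [pow_two] using this
  obtain ⟨j, hj⟩ := c.order_pow (mem_core.mp hx).1 (core_normal c.hT hx)
  have hodd : Odd (m ^ j) := (c.hm.odd_of_ne_two hm2).pow
  obtain ⟨k, hk⟩ := hodd
  have h4 : x = (x ^ 2) ^ (k + 1) := by
    rw [← pow_mul]
    have : 2 * (k + 1) = orderOf x + 1 := by rw [hj, hk]; ring
    rw [this, pow_succ, pow_orderOf_eq_one, one_mul]
  rw [h4]
  exact pow_mem h3 _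

lemma concl (c : Ctx a b p q m) :
    (∃ m α β : ℕ, m.Prime ∧ Odd m ∧ 1 ≤ α ∧ 1 ≤ β ∧
        p = 2 * m ^ α ∧ q = m ^ (α + β)) ∨
    (∃ α β : ℕ, p = 2 ^ α ∧ q = 2 ^ β) := by
  have hp2 := c.hp2
  have hq2 := c.hq2
  by_cases hm2 : m = 2
  · right
    subst hm2
    refine ⟨_, _, Nat.eq_prime_pow_of_unique_prime_dvd (p := 2) (by omega) ?_,
      Nat.eq_prime_pow_of_unique_prime_dvd (p := 2) (by omega) ?_⟩
    · intro d hd hdd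
      by_contra hne
      exact c.no_odd hd hne hne (Or.inl hdd)
    · intro d hd hdd
      by_contra hne
      exact c.no_odd hd hne hne (Or.inr hdd)
  left
  have := Fact.mk c.hm
  have hCp : IsPGroup m (core a b) := by
    rintro ⟨x, hx⟩
    obtain ⟨j, hj⟩ := c.order_pow (mem_core.mp hx).1 (core_normal c.hT hx)
    refine ⟨j, Subtype.ext ?_⟩
    change x ^ (m ^ j) = 1
    rw [← hj, pow_orderOf_eq_one]
  obtain ⟨i, hi⟩ := IsPGroup.iff_card.mp hCp
  have hi1 : 1 ≤ i := by
    obtain ⟨n, hnC, hno, -⟩ := c.hn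
    have h1 := Subgroup.orderOf_dvd_natCard _ hnC
    rw [hno, hi] at h1
    by_contra h
    have : i = 0 := by omega
    subst this
    exact c.hm.one_lt.ne' (by simpa using h1)
  have hCB : core a b ≤ zpowers b := fun x hx => (mem_core.mp hx).1
  have hCq : Nat.card (core a b) ∣ q := by
    rw [← c.hqb, ← Nat.card_zpowers]
    exact Subgroup.card_dvd_of_le hCB
  obtain ⟨l, hl⟩ := hCq
  have hCpos : 0 < Nat.card (core a b) := Nat.card_pos
  have hl0 : 0 < l := by
    rcases Nat.eq_zero_or_pos l with h | h
    · subst h; simp at hl; omega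
    · exact h
  have hblo : orderOf (b ^ l) = Nat.card (core a b) := by
    rw [orderOf_pow_of_dvd hl0.ne' (by rw [c.hqb, hl]; exact Dvd.intro_left _ rfl), c.hqb, hl,
      Nat.mul_div_cancel _ hl0]
  have hbl : b ^ l ∈ core a b := by
    have hle : core a b ≤ zpowers (b ^ l) := by
      intro x hx
      apply mem_zpowers_of_dvd (hCB hx) (npow_mem_zpowers b l)
      rw [hblo]
      exact Subgroup.orderOf_dvd_natCard _ hx
    have := Subgroup.eq_of_le_of_card_ge hle (by rw [Nat.card_zpowers, hblo])
    rw [this]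
    exact mem_zpowers _
  have hblF := c.core_mem_F hm2 hbl
  have hcc := card_core c.hT c.hAB (by
    rintro rfl
    have := c.hpa
    rw [orderOf_one] at this; omega)
  rw [c.hpa, c.hqb] at hcc
  have hlp : l < p := by
    rw [hl] at hcc
    have := Nat.le_of_mul_le_mul_left hcc hCpos
    omega
  have hp2l : p ∣ 2 * l := by
    apply c.apow_mem
    rw [mul_comm, pow_mul]
    exact pow_mem hblF _
  have hpl : p = 2 * l := by
    obtain ⟨e, he⟩ := hp2l
    have : e < 2 := by
      by_contra h
      have : p * 2 ≤ p * e := Nat.mul_le_mul_left _ (by omega)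
      omega
    interval_cases e
    · omega
    · omega
  have hlodd : ¬ 2 ∣ l := by
    rintro ⟨k, hk⟩
    have := c.apow_mem (k := k) (by rw [← hk]; exact hblF)
    have := Nat.le_of_dvd (by omega) this
    omega
  have hlm := Nat.eq_prime_pow_of_unique_prime_dvd (p := m) hl0.ne' (by
    intro d hd hdd
    by_contra hne
    apply c.no_odd hd _ hne (Or.inl (by rw [hpl]; exact hdd.mul_left 2))
    rintro rfl
    exact hlodd hdd)
  refine ⟨m, l.primeFactorsList.length, i, c.hm, c.hm.odd_of_ne_two hm2, ?_, hi1, ?_, ?_⟩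
  · by_contra h
    have h0 : l.primeFactorsList.length = 0 := by omega
    rw [h0, pow_zero] at hlm
    apply c.hch
    have hb := c.core_inv hm2 hbl
    rw [hlm, pow_one] at hb
    refine ⟨MulAut.conj a, ?_, ?_⟩
    · rw [MulAut.conj_apply, mul_inv_cancel_right, eq_inv_iff_mul_eq_one, ← pow_two,
        ← orderOf_dvd_iff_pow_eq_one, c.hpa, hpl, hlm, mul_one]
    · rw [MulAut.conj_apply, hb]
  · rw [← hlm]; exact hpl
  · rw [pow_add, ← hlm, hl, hi, mul_comm]

end Ctx
end TightChiral

/-- Possible types of atomic chiral rotation pairs with `q > p`. -/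
theorem atomic_possible_types {G : Type*} [Group G] [Finite G] (a b : G) (p q : ℕ)
    (hpq : p < q) (h : IsAtomicPair a b p q) :
    (∃ m α β : ℕ, m.Prime ∧ Odd m ∧ 1 ≤ α ∧ 1 ≤ β ∧
        p = 2 * m ^ α ∧ q = m ^ (α + β)) ∨
    (∃ α β : ℕ, p = 2 ^ α ∧ q = 2 ^ β) := by
  obtain ⟨m, c⟩ := TightChiral.exists_ctx hpq h
  exact c.concl
end

section
/- Let m be an odd prime, β ≥ 2 an integer, and k an integer with 1 ≤ k ≤ m − 1. Let G = Λ(2m, m^β; 3, 1 + k·m^(β−1), −3, −1 + k·m^(β−1)) and let a, b be the images in G of the two generators. Then (G, a, b) is a tight chiral rotation pair of type (2m, m^β); that is: G is finite with orderOf a = 2m, orderOf b = m^β, (a*b)^2 = 1, Subgroup.zpowers a ⊓ Subgroup.zpowers b = ⊥, every element of G equals a^i * b^j for some integers i, j, and no group automorphism of G sends a to a⁻¹ and b to b⁻¹. -/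
/-- The relators of the group `Λ(p, q; i₁, j₁, i₂, j₂)`:
`x^p`, `y^q`, `(xy)²`, `y⁻¹ x (x^(i₁) y^(j₁))⁻¹`, `y x⁻¹ (x^(i₂) y^(j₂))⁻¹`. -/
def lambdaRels (p q : ℕ) (i₁ j₁ i₂ j₂ : ℤ) : Set (FreeGroup (Fin 2)) :=
  {(FreeGroup.of 0) ^ p,
   (FreeGroup.of 1) ^ q,
   (FreeGroup.of 0 * FreeGroup.of 1) ^ 2,
   (FreeGroup.of 1)⁻¹ * FreeGroup.of 0 *
     ((FreeGroup.of 0) ^ i₁ * (FreeGroup.of 1) ^ j₁)⁻¹,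
   FreeGroup.of 1 * (FreeGroup.of 0)⁻¹ *
     ((FreeGroup.of 0) ^ i₂ * (FreeGroup.of 1) ^ j₂)⁻¹}

/-- The presented group `Λ(p, q; i₁, j₁, i₂, j₂)`. -/
abbrev Lambda (p q : ℕ) (i₁ j₁ i₂ j₂ : ℤ) : Type :=
  PresentedGroup (lambdaRels p q i₁ j₁ i₂ j₂)

namespace OddAtomics

section abstract
variable {G : Type*} [Group G]

lemma semi_nat (a b : G) (e : ℤ) (h : b * a ^ (2:ℤ) = a ^ (2:ℤ) * b ^ (1 + e))
    (he : b ^ (e * e) = 1) (n : ℕ) (w : ℤ) :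
    b ^ w * a ^ (2 * (n:ℤ)) = a ^ (2 * (n:ℤ)) * b ^ (w * (1 + e * n)) := by
  have h1 : ∀ w : ℤ, b ^ w * a ^ (2:ℤ) = a ^ (2:ℤ) * b ^ (w * (1 + e)) := by
    intro w
    have hs : SemiconjBy (a ^ (2:ℤ)) (b ^ (1 + e)) b := h.symm
    have := hs.zpow_right w
    rw [← zpow_mul] at this
    rw [mul_comm w]
    exact this.symm
  have he2 : ∀ t : ℤ, b ^ (e * e * t) = 1 := by
    intro t; rw [zpow_mul, he, one_zpow]
  induction n with
  | zero => simp
  | succ n ih =>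
    have : (2 * ((n + 1 : ℕ) : ℤ)) = 2 * (n:ℤ) + 2 := by push_cast; ring
    rw [this, zpow_add, ← mul_assoc, ih, mul_assoc, h1, ← mul_assoc]
    congr 1
    have : w * (1 + e * n) * (1 + e) = w * (1 + e * ((n + 1 : ℕ) : ℤ)) + e * e * (w * n) := by
      push_cast; ring
    rw [this, zpow_add, he2, mul_one]

lemma semi_int (a b : G) (e : ℤ) (h : b * a ^ (2:ℤ) = a ^ (2:ℤ) * b ^ (1 + e))
    (he : b ^ (e * e) = 1) (n : ℤ) (w : ℤ) :
    b ^ w * a ^ (2 * n) = a ^ (2 * n) * b ^ (w * (1 + e * n)) := by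
  obtain ⟨n, rfl | rfl⟩ := n.eq_nat_or_neg
  · exact semi_nat a b e h he n w
  · have he2 : ∀ t : ℤ, b ^ (e * e * t) = 1 := by
      intro t; rw [zpow_mul, he, one_zpow]
    have key := semi_nat a b e h he n (w * (1 + e * (-(n:ℤ))))
    have h3 : w * (1 + e * -(n:ℤ)) * (1 + e * n) = w + e * e * (-(w * n * n)) := by ring
    rw [h3, zpow_add, he2, mul_one] at key
    have h4 : (2 * -(n:ℤ)) = -(2 * (n:ℤ)) := by ring
    rw [h4, zpow_neg, eq_inv_mul_iff_mul_eq, ← mul_assoc, ← key, mul_assoc, mul_inv_cancel,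
      mul_one]

lemma rel_of (a b : G) (e : ℤ) (h2 : (a * b) ^ 2 = 1)
    (h : b⁻¹ * a = a ^ (3:ℤ) * b ^ (1 + e)) : b * a ^ (2:ℤ) = a ^ (2:ℤ) * b ^ (1 + e) := by
  have hb : b⁻¹ = a * b * a := by
    rw [inv_eq_iff_mul_eq_one, ← h2, pow_two]
    have h5 : (a * b) * (a * b) = 1 := by rw [← pow_two, h2]
    rw [h5]
    have : b * (a * b * a) = a⁻¹ * ((a * b) * (a * b)) * a := by group
    rw [this, h5]; group
  rw [hb] at h
  have h3 : a ^ (3:ℤ) = a * a ^ (2:ℤ) := by group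
  rw [h3, mul_assoc, mul_assoc, mul_assoc] at h
  have := mul_left_cancel h
  rw [← this]; rw [zpow_two]

lemma main_abstract (a b : G) (m β : ℕ) (hm : m.Prime) (hmodd : Odd m)
    (hβ : 2 ≤ β) (k : ℤ) (hk1 : 1 ≤ k) (hk2 : k ≤ (m : ℤ) - 1)
    (hgen : Subgroup.closure {a, b} = ⊤)
    (ha : a ^ (2 * m) = 1) (hb : b ^ (m ^ β) = 1) (hab : (a * b) ^ 2 = 1)
    (h : b⁻¹ * a = a ^ (3:ℤ) * b ^ (1 + k * (m:ℤ) ^ (β - 1)))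
    (hord : ∀ n : ℤ, b ^ n = 1 → ((m:ℤ) ^ β) ∣ n)
    (f : G →* ℤˣ) (fa : f a = -1) (fb : f b = 1) :
    Finite G ∧ orderOf a = 2 * m ∧ orderOf b = m ^ β ∧ (a * b) ^ 2 = 1 ∧
      Subgroup.zpowers a ⊓ Subgroup.zpowers b = ⊥ ∧
      (∀ g : G, ∃ i j : ℤ, g = a ^ i * b ^ j) ∧
      ¬ ∃ φ : G ≃* G, φ a = a⁻¹ ∧ φ b = b⁻¹ := by
  set e : ℤ := k * (m:ℤ) ^ (β - 1) with he_def
  have hm0 : (m:ℤ) ≠ 0 := by exact_mod_cast hm.ne_zero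
  have hmp : Prime (m:ℤ) := Nat.prime_iff_prime_int.mp hm
  have hbq : ∀ n : ℤ, ((m:ℤ) ^ β) ∣ n → b ^ n = 1 := by
    rintro n ⟨t, rfl⟩
    rw [zpow_mul]
    have : b ^ ((m:ℤ) ^ β) = 1 := by
      rw [← hb]; exact_mod_cast zpow_natCast b (m ^ β)
    rw [this, one_zpow]
  have hpow : (m:ℤ) ^ β = (m:ℤ) ^ (β - 1) * m := by
    rw [← pow_succ]; congr 1; omega
  have he : b ^ (e * e) = 1 := by
    apply hbq
    have : e * e = k * k * (m:ℤ) ^ ((β - 1) + (β - 1)) := by rw [he_def, pow_add]; ring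
    rw [this]
    exact Dvd.dvd.mul_left (pow_dvd_pow _ (by omega)) _
  have hrel := rel_of a b e hab h
  have semi := semi_int a b e hrel he
  have hkm : ¬ (m:ℤ) ∣ k := fun hd => by
    have := Int.le_of_dvd (by omega) hd
    omega
  have hdvd : ∀ n : ℤ, b ^ (e * n) = 1 → (m:ℤ) ∣ n := by
    intro n hn
    have h1 := hord _ hn
    rw [hpow] at h1
    have h2 : e * n = (m:ℤ) ^ (β - 1) * (k * n) := by rw [he_def]; ring
    rw [h2] at h1
    have h3 := (mul_dvd_mul_iff_left (pow_ne_zero _ hm0)).mp h1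
    exact (hmp.dvd_or_dvd h3).resolve_left hkm
  have hcomm : ∀ n : ℤ, b * a ^ (2 * n) = a ^ (2 * n) * b → (m:ℤ) ∣ n := by
    intro n hn
    have h1 := semi n 1
    rw [zpow_one, hn, one_mul] at h1
    have h2 := mul_left_cancel h1
    rw [zpow_add, zpow_one] at h2
    exact hdvd n (left_eq_mul.mp h2)
  have heven : ∀ n : ℤ, f (a ^ n) = 1 → Even n := by
    intro n hn
    rw [map_zpow, fa] at hn
    by_contra hodd
    rw [Int.not_even_iff_odd] at hodd
    rw [hodd.neg_one_zpow] at hn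
    exact absurd hn (by decide)
  have haz : a ^ (2 * (m:ℤ)) = 1 := by rw [← ha]; exact_mod_cast zpow_natCast a (2 * m)
  have htight : ∀ g : G, ∃ i j : ℤ, g = a ^ i * b ^ j := by
    have hba : b * a = a⁻¹ * b⁻¹ := by
      rw [← mul_inv_rev, eq_inv_iff_mul_eq_one]
      have : b * a * (b * a) = a⁻¹ * ((a * b) ^ 2) * a := by rw [pow_two]; group
      rw [this, hab]; group
    have hba' : b⁻¹ * a⁻¹ = a * b := by
      rw [← mul_inv_rev, inv_eq_iff_mul_eq_one, ← pow_two, hab]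
    intro g
    have hg : g ∈ Subgroup.closure {a, b} := by rw [hgen]; trivial
    induction hg using Subgroup.closure_induction_left with
    | one => exact ⟨0, 0, by simp⟩
    | mul_left x hx y hy ih =>
      obtain ⟨i, j, rfl⟩ := ih
      rcases hx with rfl | rfl
      · exact ⟨1 + i, j, by rw [zpow_add, zpow_one, mul_assoc]⟩
      · obtain ⟨n, rfl | rfl⟩ := i.even_or_odd'
        · refine ⟨2 * n, 1 * (1 + e * n) + j, ?_⟩
          rw [zpow_add, ← mul_assoc, ← mul_assoc, ← semi, zpow_one]
        · refine ⟨-1 + 2 * n, (-1) * (1 + e * n) + j, ?_⟩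
          rw [zpow_add x, ← mul_assoc, ← mul_assoc, zpow_add a (-1), mul_assoc (a ^ (-1:ℤ)), ← semi,
            zpow_neg_one, zpow_neg_one, ← mul_assoc a⁻¹, ← hba, add_comm (2 * n), zpow_add, zpow_one,
            ← mul_assoc]
    | inv_mul_cancel x hx y hy ih =>
      obtain ⟨i, j, rfl⟩ := ih
      rcases hx with rfl | rfl
      · exact ⟨-1 + i, j, by rw [zpow_add, zpow_neg_one, mul_assoc]⟩
      · obtain ⟨n, rfl | rfl⟩ := i.even_or_odd'
        · refine ⟨2 * n, (-1) * (1 + e * n) + j, ?_⟩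
          rw [zpow_add, ← mul_assoc, ← mul_assoc, ← semi, zpow_neg_one]
        · refine ⟨1 + 2 * (n + 1), 1 * (1 + e * (n + 1)) + j, ?_⟩
          rw [zpow_add x, ← mul_assoc, ← mul_assoc, zpow_add a 1, mul_assoc (a ^ (1:ℤ)), ← semi,
            zpow_one, zpow_one, ← mul_assoc a, ← hba']
          have : a ^ (2 * (n + 1)) = a * a ^ (2 * n + 1) := by
            rw [← zpow_one_add]; congr 1; ring
          rw [this]; group
  have hmpos : 0 < m := hm.pos
  have fina : IsOfFinOrder a := isOfFinOrder_iff_pow_eq_one.mpr ⟨2 * m, by omega, ha⟩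
  have finb : IsOfFinOrder b := isOfFinOrder_iff_pow_eq_one.mpr ⟨m ^ β, pow_pos hmpos _, hb⟩
  have hfin : Finite G := by
    have : Finite (Subgroup.zpowers a) := finite_zpowers.mpr fina
    have : Finite (Subgroup.zpowers b) := finite_zpowers.mpr finb
    refine Finite.of_surjective
      (fun p : Subgroup.zpowers a × Subgroup.zpowers b => (p.1 : G) * (p.2 : G)) ?_
    intro g
    obtain ⟨i, j, rfl⟩ := htight g
    exact ⟨(⟨a ^ i, i, rfl⟩, ⟨b ^ j, j, rfl⟩), rfl⟩
  have hm2 : ¬ (m:ℤ) ∣ 2 := by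
    intro hd
    have h1 : m ∣ 2 := by exact_mod_cast hd
    have := (Nat.prime_dvd_prime_iff_eq hm Nat.prime_two).mp h1
    subst this
    exact absurd hmodd (by decide)
  refine ⟨hfin, ?_, ?_, hab, ?_, htight, ?_⟩
  · apply Nat.dvd_antisymm (orderOf_dvd_of_pow_eq_one ha)
    have h1 : a ^ ((orderOf a : ℕ) : ℤ) = 1 := by rw [zpow_natCast, pow_orderOf_eq_one]
    have h2 := heven (orderOf a) (by rw [h1, map_one])
    obtain ⟨n, hn⟩ := h2.two_dvd
    have h3 : (m:ℤ) ∣ n := by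
      apply hcomm
      rw [← hn, h1, one_mul, mul_one]
    have : (2 * (m:ℤ)) ∣ (orderOf a : ℤ) := by rw [hn]; exact mul_dvd_mul_left _ h3
    exact_mod_cast this
  · apply Nat.dvd_antisymm (orderOf_dvd_of_pow_eq_one hb)
    have := hord (orderOf b) (by rw [zpow_natCast, pow_orderOf_eq_one])
    exact_mod_cast this
  · rw [eq_bot_iff]
    rintro g ⟨⟨i, hi⟩, ⟨j, hj⟩⟩
    simp only at hi hj
    have h2 := heven i (by rw [hi, ← hj, map_zpow, fb, one_zpow])
    obtain ⟨n, rfl⟩ := h2.two_dvd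
    have h3 : (m:ℤ) ∣ n := by
      apply hcomm
      rw [hi, ← hj]
      exact ((Commute.refl b).zpow_right j).eq
    obtain ⟨t, rfl⟩ := h3
    rw [Subgroup.mem_bot, ← hi, ← mul_assoc, zpow_mul, haz, one_zpow]
  · rintro ⟨φ, pa, pb⟩
    have h1 := congrArg φ hrel
    simp only [map_mul, map_zpow, pa, pb, inv_zpow'] at h1
    have h2 := semi (-1) (-1)
    have h3 : b⁻¹ * a ^ (-2 : ℤ) = a ^ (-2:ℤ) * b ^ (-1 * (1 + e * -1)) := by
      rw [← zpow_neg_one]; exact h2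
    rw [h1] at h3
    have h4 := mul_left_cancel h3
    have h5 : b ^ (e * 2) = 1 := by
      have : e * 2 = (-1 * (1 + e * -1)) - (-(1 + e)) := by ring
      rw [this, zpow_sub, h4, mul_inv_cancel]
    exact hm2 (hdvd 2 h5)

end abstract

section model
variable {R : Type*} [CommRing R]

/-- The permutation by which `x` acts on the cosets of `⟨x⟩`. -/
def permA (s : R) (hs : s * s = 0) : Equiv.Perm R where
  toFun j := -j - s * (j ^ 2 - j)
  invFun j := -j - s * (j ^ 2 + j)
  left_inv j := by
    simp only
    grind
  right_inv j := by
    simp only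
    grind

lemma permA_apply (s : R) (hs : s * s = 0) (j : R) : permA s hs j = -j - s * (j ^ 2 - j) := rfl

lemma permA_inv_apply (s : R) (hs : s * s = 0) (j : R) :
    (permA s hs)⁻¹ j = -j - s * (j ^ 2 + j) := rfl

/-- The shift, by which `y` acts on the cosets of `⟨x⟩`. -/
def permB : Equiv.Perm R := Equiv.addRight 1

lemma permB_apply (j : R) : (permB : Equiv.Perm R) j = j + 1 := rfl

lemma permB_zpow (n : ℤ) (j : R) : ((permB : Equiv.Perm R) ^ n) j = j + n := by
  have hn : ∀ (n : ℕ) (j : R), ((permB : Equiv.Perm R) ^ n) j = j + n := by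
    intro n
    induction n with
    | zero => simp
    | succ n ih =>
      intro j
      rw [pow_succ, Equiv.Perm.mul_apply, ih, permB_apply]; push_cast; ring
  obtain ⟨n, rfl | rfl⟩ := n.eq_nat_or_neg
  · rw [zpow_natCast, hn]; simp
  · rw [zpow_neg, zpow_natCast, Equiv.Perm.inv_eq_iff_eq, hn]; simp

lemma permB_inv_apply (j : R) : (permB : Equiv.Perm R)⁻¹ j = j - 1 := by
  rw [← zpow_neg_one, permB_zpow]; push_cast; ring

lemma permA_sq_pow (s : R) (hs : s * s = 0) (n : ℕ) (j : R) :
    (permA s hs ^ (2 * n)) j = j * (1 - 2 * n * s) := by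
  induction n generalizing j with
  | zero => simp
  | succ n ih =>
    rw [mul_add, pow_add, Equiv.Perm.mul_apply, ih, mul_one, pow_two, Equiv.Perm.mul_apply,
      permA_apply, permA_apply]
    push_cast
    generalize (n : R) = t
    grind

lemma permAB_sq (s : R) (hs : s * s = 0) : (permA s hs * permB) ^ 2 = 1 := by
  ext j
  simp only [pow_two, Equiv.Perm.mul_apply, permA_apply, permB_apply, Equiv.Perm.one_apply]
  grind

lemma perm_rel1 (s : R) (hs : s * s = 0) (e : ℤ) (he : (e : R) = 2 * s) :
    permB⁻¹ * permA s hs = permA s hs ^ (3:ℤ) * permB ^ (1 + e) := by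
  ext j
  have h3 : permA s hs ^ (3:ℤ) = permA s hs ^ (2 * 1) * permA s hs := by
    rw [← pow_succ]; norm_cast
  rw [h3]
  simp only [Equiv.Perm.mul_apply, permB_zpow, permB_inv_apply, permA_sq_pow, permA_apply]
  push_cast
  rw [he]
  grind

lemma perm_rel2 (s : R) (hs : s * s = 0) (e : ℤ) (he : (e : R) = 2 * s) :
    permB * (permA s hs)⁻¹ = permA s hs ^ (-3:ℤ) * permB ^ (-1 + e) := by
  have h3 : permA s hs ^ (-3:ℤ) = (permA s hs ^ (2 * 1) * permA s hs)⁻¹ := by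
    rw [← pow_succ, zpow_neg]; norm_cast
  rw [h3, eq_inv_mul_iff_mul_eq]
  ext j
  simp only [Equiv.Perm.mul_apply, permB_zpow, permB_apply, permA_sq_pow, permA_apply,
    permA_inv_apply]
  push_cast
  rw [he]
  grind

end model

/-- Homomorphisms out of `Λ` from solutions of the relations. -/
lemma exists_hom {H : Type*} [Group H] (p q : ℕ) (i₁ j₁ i₂ j₂ : ℤ) (x y : H)
    (h1 : x ^ p = 1) (h2 : y ^ q = 1) (h3 : (x * y) ^ 2 = 1)
    (h4 : y⁻¹ * x = x ^ i₁ * y ^ j₁) (h5 : y * x⁻¹ = x ^ i₂ * y ^ j₂) :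
    ∃ f : Lambda p q i₁ j₁ i₂ j₂ →* H,
      f (PresentedGroup.of 0) = x ∧ f (PresentedGroup.of 1) = y := by
  have hr : ∀ r ∈ lambdaRels p q i₁ j₁ i₂ j₂, FreeGroup.lift ![x, y] r = 1 := by
    intro r hr
    simp only [lambdaRels, Set.mem_insert_iff, Set.mem_singleton_iff] at hr
    rcases hr with rfl | rfl | rfl | rfl | rfl
    · simpa using h1
    · simpa using h2
    · simpa using h3
    · rw [map_mul, map_inv, mul_inv_eq_one]; simpa using h4
    · rw [map_mul, map_inv, mul_inv_eq_one]; simpa using h5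
  exact ⟨PresentedGroup.toGroup hr, by simp, by simp⟩

end OddAtomics

/-- `Λ(2m, m^β; 3, 1 + k·m^(β-1), -3, -1 + k·m^(β-1))` is the automorphism group of a
tight chiral polyhedron of type `{2m, m^β}`, for `m` an odd prime, `β ≥ 2`, `1 ≤ k ≤ m-1`. -/
theorem odd_atomics_tight_chiral (m β : ℕ) (hm : m.Prime) (hmodd : Odd m)
    (hβ : 2 ≤ β) (k : ℤ) (hk1 : 1 ≤ k) (hk2 : k ≤ (m : ℤ) - 1) :
    let G := Lambda (2 * m) (m ^ β) 3 (1 + k * (m : ℤ) ^ (β - 1)) (-3)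
      (-1 + k * (m : ℤ) ^ (β - 1))
    let a : G := PresentedGroup.of 0
    let b : G := PresentedGroup.of 1
    Finite G ∧ orderOf a = 2 * m ∧ orderOf b = m ^ β ∧ (a * b) ^ 2 = 1 ∧
      Subgroup.zpowers a ⊓ Subgroup.zpowers b = ⊥ ∧
      (∀ g : G, ∃ i j : ℤ, g = a ^ i * b ^ j) ∧
      ¬ ∃ φ : G ≃* G, φ a = a⁻¹ ∧ φ b = b⁻¹ := by
  intro G a b
  have hm0 : (m:ℤ) ≠ 0 := by exact_mod_cast hm.ne_zero
  have rel : ∀ r ∈ lambdaRels (2 * m) (m ^ β) 3 (1 + k * (m : ℤ) ^ (β - 1)) (-3)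
      (-1 + k * (m : ℤ) ^ (β - 1)), (PresentedGroup.mk _ r : G) = 1 :=
    fun r hr => PresentedGroup.one_of_mem hr
  have r1 : a ^ (2 * m) = 1 := by
    have := rel ((FreeGroup.of 0) ^ (2 * m)) (by simp [lambdaRels])
    rwa [map_pow] at this
  have r2 : b ^ (m ^ β) = 1 := by
    have := rel ((FreeGroup.of 1) ^ (m ^ β)) (by simp [lambdaRels])
    rwa [map_pow] at this
  have r3 : (a * b) ^ 2 = 1 := by
    have := rel ((FreeGroup.of 0 * FreeGroup.of 1) ^ 2) (by simp [lambdaRels])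
    rwa [map_pow, map_mul] at this
  have r4 : b⁻¹ * a = a ^ (3:ℤ) * b ^ (1 + k * (m : ℤ) ^ (β - 1)) := by
    have := rel ((FreeGroup.of 1)⁻¹ * FreeGroup.of 0 *
     ((FreeGroup.of 0) ^ (3:ℤ) * (FreeGroup.of 1) ^ (1 + k * (m : ℤ) ^ (β - 1)))⁻¹)
      (Or.inr (Or.inr (Or.inr (Or.inl rfl))))
    rw [map_mul, map_inv, mul_inv_eq_one, map_mul, map_inv, map_mul, map_zpow, map_zpow] at this
    exact this
  have hgen : Subgroup.closure {a, b} = ⊤ := by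
    have h1 := PresentedGroup.closure_range_of (lambdaRels (2 * m) (m ^ β) 3
      (1 + k * (m : ℤ) ^ (β - 1)) (-3) (-1 + k * (m : ℤ) ^ (β - 1)))
    rw [← top_le_iff, ← h1]
    apply Subgroup.closure_mono
    rintro _ ⟨i, rfl⟩
    fin_cases i
    · left; rfl
    · right; rfl
  obtain ⟨f, fa, fb⟩ := OddAtomics.exists_hom (2 * m) (m ^ β) 3 (1 + k * (m : ℤ) ^ (β - 1)) (-3)
      (-1 + k * (m : ℤ) ^ (β - 1)) (-1 : ℤˣ) 1 (by simp [pow_mul]) (by simp) (by simp)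
      (by rw [one_zpow]; decide) (by rw [one_zpow]; decide)
  obtain ⟨h, hh⟩ := hmodd
  have hq : ((m:ZMod (m ^ β)) ^ β) = 0 := by
    have := ZMod.natCast_self (m ^ β)
    exact_mod_cast this
  have hq' : ∀ n, β ≤ n → ((m:ZMod (m ^ β)) ^ n) = 0 := by
    intro n hn
    rw [← Nat.add_sub_cancel' hn, pow_add, hq, zero_mul]
  have hpow : (m:ZMod (m ^ β)) ^ (β - 1) * m = 0 := by
    rw [← pow_succ]; exact hq' _ (by omega)
  let s : ZMod (m ^ β) := k * (m:ZMod (m ^ β)) ^ (β - 1) * (h + 1)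
  have hs : s * s = 0 := by
    have h1 : (m:ZMod (m ^ β)) ^ (β - 1) * m ^ (β - 1) = 0 := by
      rw [← pow_add]; exact hq' _ (by omega)
    show (k * (m:ZMod (m ^ β)) ^ (β - 1) * (h + 1)) * (k * (m:ZMod (m ^ β)) ^ (β - 1) * (h + 1)) = 0
    linear_combination ((k : ZMod (m ^ β)) * (h + 1)) ^ 2 * h1
  have hms : (m : ZMod (m ^ β)) * s = 0 := by
    show (m : ZMod (m ^ β)) * (k * (m:ZMod (m ^ β)) ^ (β - 1) * (h + 1)) = 0
    linear_combination ((k : ZMod (m ^ β)) * (h + 1)) * hpow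
  have h2s : ((k * (m : ℤ) ^ (β - 1) : ℤ) : ZMod (m ^ β)) = 2 * s := by
    have hh' : (m : ZMod (m ^ β)) = 2 * h + 1 := by
      have := congrArg (Nat.cast : ℕ → ZMod (m ^ β)) hh
      push_cast at this
      exact this
    show _ = 2 * (k * (m:ZMod (m ^ β)) ^ (β - 1) * (h + 1))
    push_cast
    linear_combination (-(k : ZMod (m ^ β))) * hpow +
      (k : ZMod (m ^ β)) * (m:ZMod (m ^ β)) ^ (β - 1) * hh'
  obtain ⟨g, ga, gb⟩ := OddAtomics.exists_hom (2 * m) (m ^ β) 3 (1 + k * (m : ℤ) ^ (β - 1)) (-3)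
      (-1 + k * (m : ℤ) ^ (β - 1)) (OddAtomics.permA s hs) OddAtomics.permB
      (by
        ext j
        rw [OddAtomics.permA_sq_pow, Equiv.Perm.one_apply]
        linear_combination (-2 * j) * hms)
      (by
        ext j
        rw [← zpow_natCast, OddAtomics.permB_zpow, Equiv.Perm.one_apply]
        push_cast
        rw [hq, add_zero])
      (OddAtomics.permAB_sq s hs) (OddAtomics.perm_rel1 s hs _ h2s)
      (OddAtomics.perm_rel2 s hs _ h2s)
  refine OddAtomics.main_abstract a b m β hm ⟨h, hh⟩ hβ k hk1 hk2 hgen r1 r2 r3 r4 ?_ f fa fb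
  intro n hn
  have h1 : (OddAtomics.permB : Equiv.Perm (ZMod (m ^ β))) ^ n = 1 := by
    rw [← gb, ← map_zpow]
    exact (congrArg g hn).trans (map_one g)
  have h2 := congrArg (fun σ : Equiv.Perm (ZMod (m ^ β)) => σ 0) h1
  simp only [OddAtomics.permB_zpow, Equiv.Perm.one_apply, zero_add] at h2
  have := (ZMod.intCast_zmod_eq_zero_iff_dvd n (m ^ β)).mp h2
  exact_mod_cast this
end

section
/- Let β ≥ 5 be an integer and let ε ∈ {1, −1}. Let G = Λ(2^(β−1), 2^β; −1 + 2^(β−2), −3 + ε·2^(β−2), 1 − 2^(β−2), 3 + ε·2^(β−2)) and let a, b be the images in G of the two generators. Then (G, a, b) is a tight chiral rotation pair of type (2^(β−1), 2^β); that is: G is finite with orderOf a = 2^(β−1), orderOf b = 2^β, (a*b)^2 = 1, Subgroup.zpowers a ⊓ Subgroup.zpowers b = ⊥, every element of G equals a^i * b^j for some integers i, j, and no group automorphism of G sends a to a⁻¹ and b to b⁻¹. -/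
namespace EvenAtomics

/-! ### Tightness from the relations -/

section Tight

variable {G : Type*} [Group G]

theorem conj_rel {a b : G} {n w : ℤ}
    (h4 : b⁻¹ * a = a ^ (-1 + n) * b ^ (-3 + w))
    (h5 : b * a⁻¹ = a ^ (1 - n) * b ^ (3 + w)) :
    b ^ (4 + w) * a = a * b ^ (4 - w) := by
  have e1 : a ^ (-1 + n) = b⁻¹ * a * b ^ (3 - w) := by
    rw [h4, mul_assoc, ← zpow_add]
    simp
  have e2 : a ^ (-1 + n) = b ^ (3 + w) * a * b⁻¹ := by
    have : a ^ (1 - n) = b * a⁻¹ * (b ^ (3 + w))⁻¹ := by rw [h5]; group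
    have h : a ^ (-1 + n) = (a ^ (1 - n))⁻¹ := by rw [← zpow_neg]; congr 1; ring
    rw [h, this]; group
  have e3 : b⁻¹ * a * b ^ (3 - w) = b ^ (3 + w) * a * b⁻¹ := e1.symm.trans e2
  calc b ^ (4 + w) * a = b * (b ^ (3 + w) * a * b⁻¹) * b := by
        rw [show (4 + w) = 1 + (3 + w) by ring, zpow_add]; group
    _ = b * (b⁻¹ * a * b ^ (3 - w)) * b := by rw [e3]
    _ = a * b ^ (4 - w) := by
        rw [show (4 - w) = (3 - w) + 1 by ring, zpow_add]; group

theorem exists_move {a b : G} {n w u r s q : ℤ} (hw : 4 + w = 4 * u)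
    (ha : IsOfFinOrder a)
    (hb : b ^ q = 1) (hu : r * u + s * q = 1)
    (h3 : (a * b) ^ 2 = 1)
    (h4 : b⁻¹ * a = a ^ (-1 + n) * b ^ (-3 + w))
    (h5 : b * a⁻¹ = a ^ (1 - n) * b ^ (3 + w)) (j : ℤ) :
    ∃ i' j' : ℤ, b ^ j * a = a ^ i' * b ^ j' := by
  have hc := conj_rel h4 h5
  have hb4 : (b ^ (4 + w)) ^ r = b ^ (4 : ℤ) := by
    have : (4 : ℤ) = (4 + w) * r + q * (4 * s) := by rw [hw]; linear_combination -4 * hu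
    conv_rhs => rw [this, zpow_add, zpow_mul, zpow_mul b q, hb, one_zpow, mul_one]
  have hsemi : SemiconjBy a (b ^ (4 - w)) (b ^ (4 + w)) := hc.symm
  have h3' : b * a = a⁻¹ * b⁻¹ := by
    have : a * b * (a * b) = 1 := by rw [← h3, sq]
    calc b * a = a⁻¹ * (a * b * (a * b)) * b⁻¹ := by group
      _ = a⁻¹ * b⁻¹ := by rw [this]; group
  have key : ∀ k : ℤ, ∀ g : G, (∃ i' j' : ℤ, g = a ^ i' * b ^ j') →
      ∃ i' j' : ℤ, b ^ (4 * k) * g = a ^ i' * b ^ j' := by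
    have hinv : ∀ i : ℤ, ∀ k : ℤ, ∃ c : ℤ, b ^ (4 * k) * a ^ i = a ^ i * b ^ (4 * c) := by
      have h1 : ∀ k : ℤ, b ^ (4 * k) * a = a * b ^ (4 * ((2 - u) * r * k)) := by
        intro k
        have := ((hsemi.zpow_right r).zpow_right k).eq
        rw [hb4, ← zpow_mul, ← zpow_mul, ← zpow_mul] at this
        rw [← this]
        congr 2
        linear_combination (-r * k) * hw
      have hn : ∀ m : ℕ, ∀ k : ℤ, ∃ c : ℤ, b ^ (4 * k) * a ^ m = a ^ m * b ^ (4 * c) := by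
        intro m
        induction m with
        | zero => intro k; exact ⟨k, by simp⟩
        | succ m ih =>
          intro k
          obtain ⟨c, hc⟩ := ih k
          exact ⟨(2 - u) * r * c, by rw [pow_succ, ← mul_assoc, hc, mul_assoc, h1, ← mul_assoc]⟩
      intro i k
      obtain ⟨m, hm⟩ := (ha.mem_powers_iff_mem_zpowers).2 (⟨i, rfl⟩ : a ^ i ∈ Subgroup.zpowers a)
      simp only at hm
      rw [← hm]
      exact hn m k
    rintro k g ⟨i, l, rfl⟩
    obtain ⟨c, hc⟩ := hinv i k
    exact ⟨i, 4 * c + l, by rw [← mul_assoc, hc, zpow_add, mul_assoc]⟩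
  have hr : ∃ k : ℤ, j = 4 * k ∨ j = 4 * k + 1 ∨ j = 4 * k + 2 ∨ j = 4 * k + -1 := by
    have : j % 4 = 0 ∨ j % 4 = 1 ∨ j % 4 = 2 ∨ j % 4 = 3 := by omega
    rcases this with h | h | h | h
    · exact ⟨j / 4, by omega⟩
    · exact ⟨j / 4, by omega⟩
    · exact ⟨j / 4, by omega⟩
    · exact ⟨j / 4 + 1, by omega⟩
  obtain ⟨k, hk | hk | hk | hk⟩ := hr
  · rw [hk]; exact key k a ⟨1, 0, by simp⟩
  · rw [hk, zpow_add, mul_assoc]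
    exact key k _ ⟨-1, -1, by simpa using h3'⟩
  · rw [hk, zpow_add, mul_assoc]
    refine key k _ ⟨1 - n, 3 + w + -1, ?_⟩
    rw [zpow_add _ (3 + w), ← mul_assoc, ← h5, zpow_neg_one, mul_assoc b, ← h3', ← mul_assoc]
    rw [zpow_two]
  · rw [hk, zpow_add, mul_assoc]
    exact key k _ ⟨-1 + n, -3 + w, by simpa using h4⟩

theorem tight {a b : G} (ha : IsOfFinOrder a) (hgen : Subgroup.closure {a, b} = ⊤)
    (hmove : ∀ j : ℤ, ∃ i' j' : ℤ, b ^ j * a = a ^ i' * b ^ j') (g : G) :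
    ∃ i j : ℤ, g = a ^ i * b ^ j := by
  have step : ∀ m : ℕ, ∀ i j : ℤ, ∃ i' j' : ℤ, a ^ i * b ^ j * a ^ m = a ^ i' * b ^ j' := by
    intro m
    induction m with
    | zero => intro i j; exact ⟨i, j, by simp⟩
    | succ m ih =>
      intro i j
      obtain ⟨i', j', h⟩ := ih i j
      obtain ⟨i2, j2, h2⟩ := hmove j'
      exact ⟨i' + i2, j2, by rw [pow_succ, ← mul_assoc, h, mul_assoc, h2, zpow_add, mul_assoc]⟩
  have hg : g ∈ Subgroup.closure {a, b} := hgen ▸ Subgroup.mem_top g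
  induction hg using Subgroup.closure_induction_right with
  | one => exact ⟨0, 0, by simp⟩
  | mul_right x hx y hy ih =>
    obtain ⟨i, j, rfl⟩ := ih
    rcases hy with hy | hy <;> subst hy
    · simpa using step 1 i j
    · exact ⟨i, j + 1, by rw [zpow_add, zpow_one, mul_assoc]⟩
  | mul_inv_cancel x hx y hy ih =>
    obtain ⟨i, j, rfl⟩ := ih
    rcases hy with hy | hy <;> subst hy
    · obtain ⟨m, hm⟩ := (ha.mem_powers_iff_mem_zpowers).2
        (⟨-1, by simp⟩ : y⁻¹ ∈ Subgroup.zpowers y)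
      simp only at hm
      rw [← hm]
      exact step m i j
    · exact ⟨i, j + -1, by rw [zpow_add, zpow_neg_one, mul_assoc]⟩

theorem chiral_rel {a b : G} {n w : ℤ}
    (h4 : b⁻¹ * a = a ^ (-1 + n) * b ^ (-3 + w))
    (h5 : b * a⁻¹ = a ^ (1 - n) * b ^ (3 + w)) (φ : G ≃* G) (hφa : φ a = a⁻¹)
    (hφb : φ b = b⁻¹) : b ^ (2 * w) = 1 := by
  have h := congrArg φ h4
  simp only [map_mul, map_inv, map_zpow, hφa, hφb, inv_inv, inv_zpow'] at h
  rw [h5, show -(-1 + n) = 1 - n by ring] at h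
  have h7 := mul_left_cancel h
  rw [show 2 * w = (3 + w) - (-(-3 + w)) by ring, zpow_sub, h7, mul_inv_cancel]

theorem finite_of_tight {a b : G} (ha : IsOfFinOrder a) (hb : IsOfFinOrder b)
    (ht : ∀ g : G, ∃ i j : ℤ, g = a ^ i * b ^ j) : Finite G := by
  have : Finite (Subgroup.zpowers a) := finite_zpowers.2 ha
  have : Finite (Subgroup.zpowers b) := finite_zpowers.2 hb
  refine Finite.of_surjective
    (fun p : Subgroup.zpowers a × Subgroup.zpowers b => (p.1 : G) * (p.2 : G)) ?_
  intro g
  obtain ⟨i, j, rfl⟩ := ht g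
  exact ⟨(⟨a ^ i, i, rfl⟩, ⟨b ^ j, j, rfl⟩), rfl⟩

end Tight

/-! ### A permutation representation on `ZMod (32 * M)` (the cosets of `⟨x⟩`) -/

section Model

/-- Displacement of the permutation `x`, depending on the residue modulo `8`. -/
def disp {R : Type*} [Ring R] (n w : R) : Fin 8 → R :=
  ![0, -2, w + 2 * n, -2 - w + 2 * n, 2 * n, -2 + 2 * n, w, -2 - w]

/-- Displacement of the fourth power of the permutation `x`. -/
def disp4 {R : Type*} [Ring R] (n : R) : Fin 8 → R :=
  ![0, -8 - 2 * n, 0, -8 - 2 * n, 0, -8 - 2 * n, 0, -8 - 2 * n]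

/-- Displacement of the `N`-th power of the permutation `x`. -/
def dispN {R : Type*} [Ring R] (n : R) : Fin 8 → R :=
  ![0, 2 * n, 0, 2 * n, 0, 2 * n, 0, 2 * n]

/-- Action of `x` on residues modulo `8`. -/
def sig : Fin 8 → Fin 8 := ![0, 7, 2, 1, 4, 3, 6, 5]

/-- Residue displacement. -/
def dres : Fin 8 → Fin 8 := ![0, 6, 0, 6, 0, 6, 0, 6]

variable {R : Type*} [CommRing R]

/-- The residue modulo `8`. -/
def res (c : R →+* ZMod 8) (j : R) : Fin 8 := c j

theorem res_add (c : R →+* ZMod 8) (j k : R) : res c (j + k) = res c j + res c k :=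
  map_add c j k

theorem sig_eq (r : Fin 8) : r + dres r = sig r := by
  revert r; decide

theorem sig_inj : Function.Injective sig := by
  unfold Function.Injective; decide

variable (c : R →+* ZMod 8) (n w : R)

theorem res_zero (t : R) (h : c t = 0) : res c t = 0 := h

theorem res_disp (hn : c n = 0) (hw : c w = 0) (r : Fin 8) :
    res c (disp n w r) = dres r := by
  have h2 : c 2 = 2 := map_ofNat c 2
  unfold res
  fin_cases r <;> simp [disp, dres, hn, hw, h2] <;> decide

/-- The map underlying the permutation `x`. -/
def xFun (j : R) : R := j + disp n w (res c j)

theorem res_xFun (hn : c n = 0) (hw : c w = 0) (j : R) :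
    res c (xFun c n w j) = sig (res c j) := by
  rw [xFun, res_add, res_disp c n w hn hw, sig_eq]

theorem xFun_inj (hn : c n = 0) (hw : c w = 0) : Function.Injective (xFun c n w) := by
  intro j k h
  have h1 := res_xFun c n w hn hw j
  rw [h, res_xFun c n w hn hw k] at h1
  have h3 := sig_inj h1
  simpa [xFun, h3] using h

theorem xFun_four (hn : c n = 0) (hw : c w = 0) (h4n : 4 * n = 0) (h2w : 2 * w = 2 * n) (j : R) :
    xFun c n w (xFun c n w (xFun c n w (xFun c n w j))) = j + disp4 n (res c j) := by
  have e : ∀ k, xFun c n w k = k + disp n w (res c k) := fun k => rfl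
  have hc := res_xFun c n w hn hw
  rw [e (xFun c n w (xFun c n w (xFun c n w j))), hc, hc, hc, e (xFun c n w (xFun c n w j)), hc, hc,
    e (xFun c n w j), hc, e j]
  generalize res c j = r
  fin_cases r <;> simp [disp, disp4, sig] <;> grind

theorem rel_three (hn : c n = 0) (hw : c w = 0) (h4n : 4 * n = 0) (j : R) :
    xFun c n w (xFun c n w (j + 1) + 1) = j := by
  have e : ∀ k, xFun c n w k = k + disp n w (res c k) := fun k => rfl
  have h1 : res c 1 = 1 := map_one c
  rw [e (xFun c n w (j + 1) + 1), res_add, res_xFun c n w hn hw, e (j + 1), res_add, h1]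
  generalize res c j = r
  fin_cases r <;> simp [disp, sig] <;> grind

theorem rel_four (hn : c n = 0) (hw : c w = 0) (h4n : 4 * n = 0) (h2w : 2 * w = 2 * n) (j : R) :
    xFun c n w (xFun c n w j + -1) = j + (-3 + w) + dispN n (res c (j + (-3 + w))) := by
  have e : ∀ k, xFun c n w k = k + disp n w (res c k) := fun k => rfl
  have h1 : res c (-1) = 7 := by unfold res; rw [map_neg, map_one]; decide
  have h3 : res c (-3) = 5 := by unfold res; rw [map_neg, map_ofNat]; decide
  rw [e (xFun c n w j + -1), res_add, res_xFun c n w hn hw, e j, res_add, res_add, h1, h3,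
    res_zero c w hw]
  generalize res c j = r
  fin_cases r <;> simp [disp, sig, dispN] <;> grind

theorem rel_five (hn : c n = 0) (hw : c w = 0) (h4n : 4 * n = 0) (h2w : 2 * w = 2 * n) (j : R) :
    xFun c n w (xFun c n w j + (3 + w) + dispN n (res c (xFun c n w j + (3 + w)))) = j + 1 := by
  have e : ∀ k, xFun c n w k = k + disp n w (res c k) := fun k => rfl
  have h3 : res c 3 = 3 := by unfold res; rw [map_ofNat]; decide
  have hd : ∀ r, res c (dispN n r) = 0 := by
    intro r
    unfold res
    fin_cases r <;> simp [dispN, hn]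
  rw [e (_ + _), res_add c (_ + _) (dispN _ _), hd, res_add, res_add, res_xFun c n w hn hw, e j, h3,
    res_zero c w hw]
  generalize res c j = r
  fin_cases r <;> simp [disp, sig, dispN] <;> grind

theorem addRight_zpow (j : ℤ) (k : R) : ((Equiv.addRight (1 : R)) ^ j : Equiv.Perm R) k = k + j := by
  induction j using Int.induction_on generalizing k with
  | zero => simp
  | succ i ih =>
    rw [zpow_add_one, Equiv.Perm.mul_apply, ih, Equiv.coe_addRight]
    push_cast
    ring
  | pred i ih =>
    rw [zpow_sub_one, Equiv.Perm.mul_apply, ih]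
    have : (Equiv.addRight (1 : R) : Equiv.Perm R)⁻¹ k = k - 1 := by
      rw [Equiv.Perm.inv_eq_iff_eq]; exact (sub_add_cancel k 1).symm
    rw [this]
    push_cast
    ring

/-- The permutation `x`. -/
noncomputable def xPerm [Finite R] (hn : c n = 0) (hw : c w = 0) : Equiv.Perm R :=
  Equiv.ofBijective (xFun c n w) (Finite.injective_iff_bijective.1 (xFun_inj c n w hn hw))

theorem xPerm_apply [Finite R] (hn : c n = 0) (hw : c w = 0) (j : R) :
    xPerm c n w hn hw j = xFun c n w j := rfl

theorem xPerm_pow [Finite R] (hn : c n = 0) (hw : c w = 0) (h4n : 4 * n = 0) (h2w : 2 * w = 2 * n)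
    (m : ℕ) (j : R) : (xPerm c n w hn hw ^ (4 * m)) j = j + m * disp4 n (res c j) := by
  have hd : ∀ r, res c (disp4 n r) = 0 := by
    have h2 : c 8 = 8 := map_ofNat c 8
    intro r
    unfold res
    fin_cases r <;> simp [disp4, hn, h2] <;> rfl
  induction m generalizing j with
  | zero => simp
  | succ m ih =>
    rw [mul_add, mul_one, pow_add, Equiv.Perm.mul_apply]
    have : (xPerm c n w hn hw ^ 4) j = j + disp4 n (res c j) := by
      rw [← xFun_four c n w hn hw h4n h2w]
      rfl
    rw [this, ih, res_add, hd]
    push_cast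
    simp only [add_zero]
    ring

end Model

theorem core (t : ℕ) (ε : ℤ) (hε : ε = 1 ∨ ε = -1) :
    let G := Lambda (16 * 2 ^ t) (32 * 2 ^ t) (-1 + 8 * 2 ^ t) (-3 + ε * (8 * 2 ^ t))
      (1 - 8 * 2 ^ t) (3 + ε * (8 * 2 ^ t))
    let a : G := PresentedGroup.of 0
    let b : G := PresentedGroup.of 1
    Finite G ∧ orderOf a = 16 * 2 ^ t ∧ orderOf b = 32 * 2 ^ t ∧ (a * b) ^ 2 = 1 ∧
      Subgroup.zpowers a ⊓ Subgroup.zpowers b = ⊥ ∧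
      (∀ g : G, ∃ i j : ℤ, g = a ^ i * b ^ j) ∧
      ¬ ∃ φ : G ≃* G, φ a = a⁻¹ ∧ φ b = b⁻¹ := by
  intro G a b
  -- the relations in `G`
  have rel : ∀ r ∈ lambdaRels (16 * 2 ^ t) (32 * 2 ^ t) (-1 + 8 * 2 ^ t)
      (-3 + ε * (8 * 2 ^ t)) (1 - 8 * 2 ^ t) (3 + ε * (8 * 2 ^ t)),
      (PresentedGroup.mk _ r : G) = 1 := fun r hr => PresentedGroup.one_of_mem hr
  have h1 : a ^ (16 * 2 ^ t) = 1 := rel _ (by simp [lambdaRels])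
  have h2 : b ^ (32 * 2 ^ t) = 1 := rel _ (by simp [lambdaRels])
  have h3 : (a * b) ^ 2 = 1 := rel _ (by simp [lambdaRels])
  have h4' : b⁻¹ * a * (a ^ (-1 + 8 * 2 ^ t : ℤ) * b ^ (-3 + ε * (8 * 2 ^ t)))⁻¹ = 1 :=
    rel _ (by simp [lambdaRels])
  have h5' : b * a⁻¹ * (a ^ (1 - 8 * 2 ^ t : ℤ) * b ^ (3 + ε * (8 * 2 ^ t)))⁻¹ = 1 :=
    rel _ (by simp [lambdaRels])
  have h4 := mul_inv_eq_one.1 h4'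
  have h5 := mul_inv_eq_one.1 h5'
  have hpos : 0 < 2 ^ t := by positivity
  have fa : IsOfFinOrder a := isOfFinOrder_iff_pow_eq_one.2 ⟨_, by positivity, h1⟩
  have fb : IsOfFinOrder b := isOfFinOrder_iff_pow_eq_one.2 ⟨_, by positivity, h2⟩
  -- tightness
  have hgen : Subgroup.closure {a, b} = (⊤ : Subgroup G) := by
    rw [← PresentedGroup.closure_range_of]
    congr 1
    ext g
    simp only [Set.mem_insert_iff, Set.mem_singleton_iff, Set.mem_range, Fin.exists_fin_two]
    simp only [eq_comm, a, b]
  have hcop : IsCoprime (1 + 2 * (ε * 2 ^ t) : ℤ) (32 * 2 ^ t) := by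
    have : IsCoprime (1 + 2 * (ε * 2 ^ t) : ℤ) (2 ^ (t + 5)) := by
      apply IsCoprime.pow_right
      exact ⟨1, -(ε * 2 ^ t), by ring⟩
    rwa [pow_add, mul_comm (2 ^ t)] at this
  obtain ⟨r, s, hrs⟩ := hcop
  have h2z : b ^ (32 * 2 ^ t : ℤ) = 1 := by exact_mod_cast h2
  have ht : ∀ g : G, ∃ i j : ℤ, g = a ^ i * b ^ j :=
    tight fa hgen (exists_move (u := 1 + 2 * (ε * 2 ^ t)) (by ring) fa h2z hrs h3 h4 h5)
  -- the permutation representation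
  have hne : NeZero (32 * 2 ^ t) := ⟨by positivity⟩
  let c : (ZMod (32 * 2 ^ t)) →+* ZMod 8 := ZMod.castHom (Dvd.intro (4 * 2 ^ t) (by ring)) (ZMod 8)
  let n : (ZMod (32 * 2 ^ t)) := 8 * 2 ^ t
  let w : (ZMod (32 * 2 ^ t)) := ε * (8 * 2 ^ t)
  have c8 : c 8 = 0 := by rw [map_ofNat]; rfl
  have hn : c n = 0 := by simp only [n, map_mul, c8, zero_mul]
  have hw : c w = 0 := by simp only [w, map_mul, c8, zero_mul, mul_zero]
  have hM : (32 : (ZMod (32 * 2 ^ t))) * 2 ^ t = 0 := by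
    have := ZMod.natCast_self (32 * 2 ^ t)
    exact_mod_cast this
  have h4n : 4 * n = 0 := by simp only [n]; linear_combination hM
  have h2w : 2 * w = 2 * n := by
    rcases hε with rfl | rfl
    · simp [w, n]
    · simp only [w, n]; push_cast; linear_combination -hM
  have h2n : 2 * n ≠ 0 := by
    intro h
    have : ((16 * 2 ^ t : ℕ) : (ZMod (32 * 2 ^ t))) = 0 := by
      push_cast; simp only [n] at h; linear_combination h
    rw [ZMod.natCast_eq_zero_iff] at this
    have := Nat.le_of_dvd (by positivity) this
    omega
  let X : Equiv.Perm (ZMod (32 * 2 ^ t)) := xPerm c n w hn hw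
  let Y : Equiv.Perm (ZMod (32 * 2 ^ t)) := Equiv.addRight 1
  have hY : ∀ (j : ℤ) (k : (ZMod (32 * 2 ^ t))), (Y ^ j) k = k + j := by
    intro j k
    exact addRight_zpow j k
  have hX : ∀ k, X k = xFun c n w k := fun k => rfl
  have hXN : ∀ k, (X ^ (8 * 2 ^ t)) k = k + dispN n (res c k) := by
    intro k
    rw [show 8 * 2 ^ t = 4 * (2 * 2 ^ t) by ring, xPerm_pow c n w hn hw h4n h2w]
    congr 1
    generalize res c k = r
    have : ((2 * 2 ^ t : ℕ) : (ZMod (32 * 2 ^ t))) * (-8 - 2 * n) = 2 * n := by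
      push_cast; simp only [n]; linear_combination (-1 - 2 ^ t) * hM
    fin_cases r <;> simp only [disp4, dispN] <;> first | exact this | exact mul_zero _
  have hX2N : X ^ (16 * 2 ^ t) = 1 := by
    ext1 k
    rw [show 16 * 2 ^ t = 4 * (4 * 2 ^ t) by ring, xPerm_pow c n w hn hw h4n h2w]
    have : ((4 * 2 ^ t : ℕ) : (ZMod (32 * 2 ^ t))) * (-8 - 2 * n) = 0 := by
      push_cast; simp only [n]; linear_combination (-1 - 2 * 2 ^ t) * hM
    have : ((4 * 2 ^ t : ℕ) : (ZMod (32 * 2 ^ t))) * disp4 n (res c k) = 0 := by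
      generalize res c k = r
      fin_cases r <;> simp only [disp4] <;> first | exact this | exact mul_zero _
    rw [this, add_zero]; rfl
  have hXneg : (X ^ (8 * 2 ^ t))⁻¹ = X ^ (8 * 2 ^ t) := by
    rw [inv_eq_iff_mul_eq_one, ← pow_add, ← hX2N]; congr 1; ring
  have hXz : X ^ (8 * 2 ^ t : ℤ) = X ^ (8 * 2 ^ t) := by
    rw [← zpow_natCast]; push_cast; rfl
  have hrel : ∀ r ∈ lambdaRels (16 * 2 ^ t) (32 * 2 ^ t) (-1 + 8 * 2 ^ t)
      (-3 + ε * (8 * 2 ^ t)) (1 - 8 * 2 ^ t) (3 + ε * (8 * 2 ^ t)),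
      FreeGroup.lift ![X, Y] r = 1 := by
    intro r hr
    simp only [lambdaRels, Set.mem_insert_iff, Set.mem_singleton_iff] at hr
    rcases hr with rfl | rfl | rfl | rfl | rfl
    · simpa using hX2N
    · simp only [map_pow, FreeGroup.lift_apply_of]
      ext1 k
      change (Y ^ (32 * 2 ^ t)) k = k
      rw [← zpow_natCast, hY]
      push_cast
      rw [hM, add_zero]
    · simp only [map_pow, map_mul, FreeGroup.lift_apply_of]
      ext1 k
      rw [sq]
      exact rel_three c n w hn hw h4n k
    · simp only [map_zpow, map_mul, map_inv, FreeGroup.lift_apply_of]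
      change Y⁻¹ * X * (X ^ (-1 + 8 * 2 ^ t : ℤ) * Y ^ (-3 + ε * (8 * 2 ^ t)))⁻¹ = 1
      rw [mul_inv_eq_one, zpow_add, zpow_neg_one, hXz, mul_assoc, eq_inv_mul_iff_mul_eq]
      ext1 k
      rw [← zpow_neg_one Y]
      simp only [Equiv.Perm.mul_apply, hY, hXN, hX]
      push_cast
      exact rel_four c n w hn hw h4n h2w k
    · simp only [map_zpow, map_mul, map_inv, FreeGroup.lift_apply_of]
      change Y * X⁻¹ * (X ^ (1 - 8 * 2 ^ t : ℤ) * Y ^ (3 + ε * (8 * 2 ^ t)))⁻¹ = 1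
      rw [mul_inv_eq_one, zpow_sub, zpow_one, hXz, hXneg, mul_inv_eq_iff_eq_mul]
      ext1 k
      simp only [Equiv.Perm.mul_apply, hY, hXN, hX]
      push_cast
      exact (rel_five c n w hn hw h4n h2w k).symm
  let f : G →* Equiv.Perm (ZMod (32 * 2 ^ t)) := PresentedGroup.toGroup hrel
  have fX : f a = X := PresentedGroup.toGroup.of hrel
  have fY : f b = Y := PresentedGroup.toGroup.of hrel
  have oa : orderOf a = 16 * 2 ^ t := by
    have : orderOf a = 2 ^ (t + 3 + 1) := by
      apply orderOf_eq_prime_pow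
      · intro h
        have h' : X ^ (8 * 2 ^ t) = 1 := by
          rw [← fX, ← map_pow, show 8 * 2 ^ t = 2 ^ (t + 3) by ring, h, map_one]
        have h6 := hXN 1
        have : res c 1 = 1 := map_one c
        rw [h', this, Equiv.Perm.one_apply] at h6
        apply h2n
        simpa [dispN] using h6
      · rw [← h1]; congr 1; ring
    rw [this]; ring
  have ob : orderOf b = 32 * 2 ^ t := by
    have : orderOf b = 2 ^ (t + 4 + 1) := by
      apply orderOf_eq_prime_pow
      · intro h
        have h' : Y ^ (16 * 2 ^ t : ℤ) = 1 := by
          rw [← fY, ← map_zpow, show (16 * 2 ^ t : ℤ) = ((2 ^ (t + 4) : ℕ) : ℤ) by push_cast; ring,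
            zpow_natCast, h, map_one]
        have h6 := hY (16 * 2 ^ t) 0
        rw [h', Equiv.Perm.one_apply] at h6
        push_cast at h6
        apply h2n
        simp only [n]
        linear_combination -h6
      · rw [← h2]; congr 1; ring
    rw [this]; ring
  refine ⟨finite_of_tight fa fb ht, oa, ob, h3, ?_, ht, ?_⟩
  · rw [eq_bot_iff]
    rintro g ⟨⟨i, hi⟩, ⟨j, hj⟩⟩
    simp only at hi hj
    have hfix : X 0 = 0 := by
      have : res c 0 = 0 := map_zero c
      rw [hX, xFun, this]; simp [disp]
    have hfixi : (X ^ i) 0 = 0 := Equiv.Perm.zpow_apply_eq_self_of_apply_eq_self hfix i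
    have e : X ^ i = Y ^ j := by rw [← fX, ← fY, ← map_zpow, ← map_zpow, hi, hj]
    rw [e, hY, zero_add, ZMod.intCast_zmod_eq_zero_iff_dvd] at hfixi
    rw [Subgroup.mem_bot, ← hj, ← orderOf_dvd_iff_zpow_eq_one, ob]
    exact hfixi
  · rintro ⟨φ, hφa, hφb⟩
    have h8 : b ^ (ε * (16 * 2 ^ t) : ℤ) = 1 := by
      rw [← chiral_rel h4 h5 φ hφa hφb]; congr 1; ring
    rw [← orderOf_dvd_iff_zpow_eq_one, ob] at h8
    have h9 : ((32 * 2 ^ t : ℕ) : ℤ) ∣ ((16 * 2 ^ t : ℕ) : ℤ) := by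
      rcases hε with rfl | rfl
      · simpa using h8
      · simpa using h8
    have := Nat.le_of_dvd (by positivity) (Int.natCast_dvd_natCast.1 h9)
    omega

end EvenAtomics

/-- `Λ(2^(β-1), 2^β; -1 + 2^(β-2), -3 + ε·2^(β-2), 1 - 2^(β-2), 3 + ε·2^(β-2))`
(for `β ≥ 5`, `ε = ±1`) is the automorphism group of a tight chiral polyhedron of
type `{2^(β-1), 2^β}`. -/
theorem even_atomics2_tight_chiral (β : ℕ) (hβ : 5 ≤ β) (ε : ℤ) (hε : ε = 1 ∨ ε = -1) :
    let G := Lambda (2 ^ (β - 1)) (2 ^ β) (-1 + 2 ^ (β - 2)) (-3 + ε * 2 ^ (β - 2))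
      (1 - 2 ^ (β - 2)) (3 + ε * 2 ^ (β - 2))
    let a : G := PresentedGroup.of 0
    let b : G := PresentedGroup.of 1
    Finite G ∧ orderOf a = 2 ^ (β - 1) ∧ orderOf b = 2 ^ β ∧ (a * b) ^ 2 = 1 ∧
      Subgroup.zpowers a ⊓ Subgroup.zpowers b = ⊥ ∧
      (∀ g : G, ∃ i j : ℤ, g = a ^ i * b ^ j) ∧
      ¬ ∃ φ : G ≃* G, φ a = a⁻¹ ∧ φ b = b⁻¹ := by
  obtain ⟨t, rfl⟩ : ∃ t, β = t + 5 := ⟨β - 5, by omega⟩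
  have e1 : 2 ^ (t + 5 - 1) = 16 * 2 ^ t := by
    rw [show t + 5 - 1 = t + 4 by omega]; ring
  have e2 : 2 ^ (t + 5) = 32 * 2 ^ t := by ring
  have e3 : (2 : ℤ) ^ (t + 5 - 2) = 8 * 2 ^ t := by
    rw [show t + 5 - 2 = t + 3 by omega]; ring
  rw [e1, e2, e3]
  exact EvenAtomics.core t ε hε
end

section
/- Let m be an odd prime, let α, β be integers with α ≥ 1 and β ≥ 2, and let k be an integer with 1 ≤ k ≤ m − 1. (i) The presented group on generators x, y with relators x^(2m^β), y^(m^β), (x*y)^2, y⁻¹*x*(x^(3 + k(m+1)m^(β−1)) * y^(1 + k·m^(β−1)))⁻¹, y*x⁻¹*(x^(−3 + k(m+1)m^(β−1)) * y^(−1 + k·m^(β−1)))⁻¹, and x^(2m)*y*x^(−2m)*y⁻¹, together with the images a, b of x, y, is a tight chiral rotation pair of type (2m^β, m^β). (ii) If moreover β > α, then the presented group on generators x, y with relators x^(2m^α), y^(m^β), (x*y)^2, y⁻¹*x*(x^3 * y^(1 + k·m^(β−1)))⁻¹, y*x⁻¹*(x^(−3) * y^(−1 + k·m^(β−1)))⁻¹,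 and x^(2m)*y*x^(−2m)*y⁻¹, together with the images a, b of x, y, is a tight chiral rotation pair of type (2m^α, m^β). -/
/-- Relators for the first group of Theorem 3.5: generators `x, y` with relators
`x^(2m^β)`, `y^(m^β)`, `(xy)²`, `y⁻¹x(x^(3+k(m+1)m^(β-1)) y^(1+k·m^(β-1)))⁻¹`,
`y x⁻¹ (x^(-3+k(m+1)m^(β-1)) y^(-1+k·m^(β-1)))⁻¹`, and `x^(2m) y x^(-2m) y⁻¹`. -/
def oddCentralRelsA (m β : ℕ) (k : ℤ) : Set (FreeGroup (Fin 2)) :=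
  {(FreeGroup.of 0) ^ (2 * m ^ β),
   (FreeGroup.of 1) ^ (m ^ β),
   (FreeGroup.of 0 * FreeGroup.of 1) ^ 2,
   (FreeGroup.of 1)⁻¹ * FreeGroup.of 0 *
     ((FreeGroup.of 0) ^ (3 + k * ((m : ℤ) + 1) * (m : ℤ) ^ (β - 1)) *
      (FreeGroup.of 1) ^ (1 + k * (m : ℤ) ^ (β - 1)))⁻¹,
   FreeGroup.of 1 * (FreeGroup.of 0)⁻¹ *
     ((FreeGroup.of 0) ^ (-3 + k * ((m : ℤ) + 1) * (m : ℤ) ^ (β - 1)) *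
      (FreeGroup.of 1) ^ (-1 + k * (m : ℤ) ^ (β - 1)))⁻¹,
   (FreeGroup.of 0) ^ (2 * m) * FreeGroup.of 1 *
     (FreeGroup.of 0) ^ (-(2 * (m : ℤ))) * (FreeGroup.of 1)⁻¹}

/-- Relators for the second group of Theorem 3.5: generators `x, y` with relators
`x^(2m^α)`, `y^(m^β)`, `(xy)²`, `y⁻¹x(x³ y^(1+k·m^(β-1)))⁻¹`,
`y x⁻¹ (x⁻³ y^(-1+k·m^(β-1)))⁻¹`, and `x^(2m) y x^(-2m) y⁻¹`. -/
def oddCentralRelsB (m α β : ℕ) (k : ℤ) : Set (FreeGroup (Fin 2)) :=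
  {(FreeGroup.of 0) ^ (2 * m ^ α),
   (FreeGroup.of 1) ^ (m ^ β),
   (FreeGroup.of 0 * FreeGroup.of 1) ^ 2,
   (FreeGroup.of 1)⁻¹ * FreeGroup.of 0 *
     ((FreeGroup.of 0) ^ (3 : ℤ) * (FreeGroup.of 1) ^ (1 + k * (m : ℤ) ^ (β - 1)))⁻¹,
   FreeGroup.of 1 * (FreeGroup.of 0)⁻¹ *
     ((FreeGroup.of 0) ^ (-3 : ℤ) * (FreeGroup.of 1) ^ (-1 + k * (m : ℤ) ^ (β - 1)))⁻¹,
   (FreeGroup.of 0) ^ (2 * m) * FreeGroup.of 1 *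
     (FreeGroup.of 0) ^ (-(2 * (m : ℤ))) * (FreeGroup.of 1)⁻¹}

section GroupPart
variable {G : Type*} [Group G]

theorem oc_pow_comm {x y E : G} (h : y * x = x * y * E) (hy : Commute E y)
    (n : ℕ) : y ^ n * x = x * y ^ n * E ^ n := by
  induction n with
  | zero => simp
  | succ n ih =>
    have h1 : E ^ n * y = y * E ^ n := (hy.pow_left n).eq
    have h2 : E * y ^ n = y ^ n * E := (hy.pow_right n).eq
    calc y ^ (n + 1) * x = y ^ n * (y * x) := by rw [pow_succ, mul_assoc]
      _ = (y ^ n * x) * y * E := by rw [h]; group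
      _ = x * y ^ n * (E ^ n * y) * E := by rw [ih]; group
      _ = x * y ^ (n + 1) * E ^ (n + 1) := by rw [h1]; simp only [pow_succ, mul_assoc]

theorem oc_mul_pow {x y E : G} (h : y * x = x * y * E) (hx : Commute E x) (hy : Commute E y)
    (n : ℕ) : (x * y) ^ n = x ^ n * y ^ n * E ^ (n.choose 2) := by
  induction n with
  | zero => simp
  | succ n ih =>
    have h1 : E ^ (n.choose 2) * x = x * E ^ (n.choose 2) := (hx.pow_left _).eq
    have h2 : E ^ (n.choose 2) * y = y * E ^ (n.choose 2) := (hy.pow_left _).eq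
    have h4 : E ^ n * y = y * E ^ n := (hy.pow_left _).eq
    have h3 := oc_pow_comm h hy n
    have hc : (n + 1).choose 2 = n + n.choose 2 := by
      rw [Nat.choose_succ_succ' n 1, Nat.choose_one_right]
    calc (x * y) ^ (n + 1) = x ^ n * y ^ n * (E ^ (n.choose 2) * x) * y := by
          rw [pow_succ, ih]; simp only [mul_assoc]
      _ = x ^ n * (y ^ n * x) * (E ^ (n.choose 2) * y) := by rw [h1]; simp only [mul_assoc]
      _ = x ^ n * x * y ^ n * (E ^ n * y) * E ^ (n.choose 2) := by
          rw [h3, h2]; simp only [mul_assoc]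
      _ = x ^ (n + 1) * y ^ (n + 1) * E ^ ((n + 1).choose 2) := by
          rw [h4, hc, pow_add E, pow_succ x, pow_succ y]; simp only [mul_assoc]

/-- Key structural consequences of the relations. -/
theorem oc_struct (a b : G) (m : ℕ) (hm : Odd m) (e f e' f' : ℤ)
    (he : e = 2 * m * e') (hf : f = m * f')
    (h3 : (a * b) ^ 2 = 1)
    (h4 : b⁻¹ * a = a ^ (3 + e) * b ^ (1 + f))
    (h5 : b * a⁻¹ = a ^ (-3 + e) * b ^ (-1 + f))
    (h6 : Commute (a ^ (2 * m)) b)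
    (h7 : a ^ (2 * e) = a ^ (2 * f)) :
    b * a ^ 2 = (a ^ e * b ^ f) * a ^ 2 * b ∧ Commute (a ^ e * b ^ f) b ∧
    Commute (a ^ e * b ^ f) (a ^ 2) ∧
    (a ^ e * b ^ f) * a⁻¹ = a⁻¹ * (a ^ e * b ^ f)⁻¹ ∧ Commute (a ^ e) b := by
  have hab : a * b = b⁻¹ * a⁻¹ := by
    have : (a * b) * (a * b) = 1 := by rw [← pow_two]; exact h3
    rw [← mul_inv_rev]; exact eq_inv_of_mul_eq_one_left this
  have hab' : a⁻¹ * b⁻¹ = b * a := by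
    have : (a * b) * (a * b) = 1 := by rw [← pow_two]; exact h3
    calc a⁻¹ * b⁻¹ = a⁻¹ * ((a * b) * (a * b)) * b⁻¹ := by rw [this]; group
      _ = _ := by group
  have hWb : Commute (a ^ e) b := by
    have : a ^ e = (a ^ (2 * m)) ^ e' := by
      rw [← zpow_natCast, ← zpow_mul, he]; push_cast; rfl
    rw [this]; exact h6.zpow_left e'
  have hWa : Commute (a ^ e) a := (Commute.refl a).zpow_left e
  obtain ⟨Z, hZ⟩ : ∃ Z, Z = a ^ e * b ^ f := ⟨_, rfl⟩
  have hZb : Commute Z b := by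
    rw [hZ]; exact hWb.mul_left ((Commute.refl b).zpow_left f)
  have h4' : b⁻¹ * a = a ^ 2 * b⁻¹ * a⁻¹ * Z := by
    have : a ^ (3 + e) * b ^ (1 + f) = a ^ 2 * (a * b) * Z := by
      have e1 : a ^ e * (a * b) = (a * b) * a ^ e := (hWa.mul_right hWb).eq
      calc a ^ (3 + e) * b ^ (1 + f) = a ^ 2 * (a * a ^ e * b) * b ^ f := by
            rw [zpow_add b, zpow_add a]; simp [pow_succ, mul_assoc, zpow_ofNat]
        _ = _ := by rw [← hWa.eq, mul_assoc (a ^ e), e1, hZ]; simp only [mul_assoc]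
    rw [h4, this, hab]; simp only [mul_assoc]
  have h5' : b * a⁻¹ = (a ^ 2)⁻¹ * b * a * Z := by
    have : a ^ (-3 + e) * b ^ (-1 + f) = (a ^ 2)⁻¹ * (a⁻¹ * b⁻¹) * Z := by
      have e1 : a ^ e * (a⁻¹ * b⁻¹) = (a⁻¹ * b⁻¹) * a ^ e :=
        (hWa.inv_right.mul_right hWb.inv_right).eq
      have e2 : a ^ (-3 + e) = (a ^ 2)⁻¹ * a⁻¹ * a ^ e := by
        rw [zpow_add]; congr 1; group
      have e3 : b ^ (-1 + f) = b⁻¹ * b ^ f := by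
        rw [zpow_add, zpow_neg_one]
      rw [e2, e3, hZ]
      have e4 : a ^ e * b⁻¹ = b⁻¹ * a ^ e := hWb.inv_right.eq
      calc (a ^ 2)⁻¹ * a⁻¹ * a ^ e * (b⁻¹ * b ^ f) 
          = (a ^ 2)⁻¹ * a⁻¹ * (a ^ e * b⁻¹) * b ^ f := by simp only [mul_assoc]
        _ = _ := by rw [e4]; simp only [mul_assoc]
    rw [h5, this, hab']; simp only [mul_assoc]
  obtain ⟨c, hc⟩ : ∃ c, c = a ^ 2 := ⟨_, rfl⟩
  obtain ⟨D, hD⟩ : ∃ D, D = a * Z⁻¹ * a⁻¹ := ⟨_, rfl⟩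
  rw [← hc] at h4' h5'
  have hac : Commute a c := by rw [hc]; exact (Commute.refl a).pow_right 2
  have hD1 : D = b * c * b⁻¹ * c⁻¹ := by
    have : Z⁻¹ = a⁻¹ * b * c * b⁻¹ * a⁻¹ := by
      have : Z = a * b * c⁻¹ * (b⁻¹ * a) := by rw [h4']; group
      rw [this]; group
    rw [hD, this, hc]; group
  have hD2 : D = c * b⁻¹ * c⁻¹ * b := by
    have : Z⁻¹ = a * b⁻¹ * c⁻¹ * b * a := by
      have : Z = a⁻¹ * b⁻¹ * c * (b * a⁻¹) := by rw [h5']; group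
      rw [this]; group
    rw [hD, this, hc, pow_two]; group
  have hDb : Commute D b := by
    have : D * b = b * D := by
      calc D * b = (b * c * b⁻¹ * c⁻¹) * b := by rw [hD1]
        _ = b * (c * b⁻¹ * c⁻¹ * b) := by group
        _ = b * D := by rw [hD2]
    exact this
  have hconj : a * b * a⁻¹ = b⁻¹ * c⁻¹ := by rw [hab, hc]; group
  have hDab : Commute D (a * b * a⁻¹) := by
    have := (hZb.inv_left).conj a 
    rwa [hD]
  have hDc : Commute D c := by
    rw [hconj] at hDab
    have : Commute D (b * (b⁻¹ * c⁻¹)) := hDb.mul_right hDab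
    rw [mul_inv_cancel_left] at this
    simpa using this.inv_right
  have hbc : b * c = D * c * b := by rw [hD1]; group
  have hbc' : c * b = b * c * D⁻¹ := by
    have : D * (c * b) = c * b * D := (hDc.mul_right hDb).eq
    rw [hbc, mul_assoc D, this]; group
  have hcm : Commute (c ^ m) b := by rw [hc, ← pow_mul]; exact h6
  have hDm : D ^ m = 1 := by
    have := oc_pow_comm hbc' hDc.inv_left m
    rw [hcm.eq] at this
    simpa using this
  have hxy : c⁻¹ * b⁻¹ = b⁻¹ * c⁻¹ * D⁻¹ := by
    have : D⁻¹ * (c⁻¹ * b⁻¹) = c⁻¹ * b⁻¹ * D⁻¹ :=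
      (hDc.inv_inv.mul_right hDb.inv_inv).eq
    rw [← mul_inv_rev, hbc]
    rw [mul_inv_rev, mul_inv_rev, ← mul_assoc]
  have hpm : (b⁻¹ * c⁻¹) ^ m = b⁻¹ ^ m * c⁻¹ ^ m := by
    rw [oc_mul_pow hxy hDb.inv_inv hDc.inv_inv m]
    have : (D⁻¹) ^ (m.choose 2) = 1 := by
      obtain ⟨r, hr⟩ := hm
      have : m.choose 2 = m * r := by
        rw [Nat.choose_two_right, hr, Nat.add_sub_cancel, Nat.mul_left_comm,
          Nat.mul_div_cancel_left _ (by norm_num)]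
      rw [this, pow_mul, inv_pow, hDm]; simp
    rw [this, mul_one]
  have hDZ : D = Z := by
    have e1 : a * Z * a⁻¹ = a ^ e * (a * b * a⁻¹) ^ f := by
      rw [conj_zpow, hZ]
      have : a * (a ^ e * b ^ f) * a⁻¹ = (a * a ^ e) * b ^ f * a⁻¹ := by
        simp only [mul_assoc]
      rw [this, ← hWa.eq]; simp only [mul_assoc]
    have e2 : (b⁻¹ * c⁻¹) ^ f = b ^ (-f) * c ^ (-f) := by
      rw [hf, zpow_mul, zpow_natCast, hpm]
      have : Commute (b⁻¹ ^ m) (c⁻¹ ^ m) := by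
        have := (hcm.inv_left.inv_right.pow_right m).symm
        rwa [← inv_pow] at this
      rw [this.mul_zpow]
      simp only [inv_pow, inv_zpow, zpow_neg, zpow_mul, zpow_natCast]
    have e3 : c ^ (-f) = a ^ (-(2 * e)) := by
      rw [zpow_neg, zpow_neg, h7, hc, zpow_mul]; norm_cast
    have e4 : a * Z * a⁻¹ = Z⁻¹ := by
      rw [e1, hconj, e2, e3, hZ, mul_inv_rev]
      have h8 : Commute (b ^ (-f)) (a ^ e) := (hWb.zpow_right (-f)).symm
      rw [← mul_assoc, ← h8.eq, mul_assoc, ← zpow_add, zpow_neg, ← zpow_neg a]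
      congr 2; ring
    have : D = (a * Z * a⁻¹)⁻¹ := by rw [hD]; group
    rw [this, e4, inv_inv]
  rw [← hZ, ← hc]
  refine ⟨?_, hZb, ?_, ?_, hWb⟩
  · rw [← hDZ]; exact hbc
  · rw [← hDZ]; exact hDc
  · have : Z = a * Z⁻¹ * a⁻¹ := hDZ.symm.trans hD
    have h' : Z⁻¹ = a * Z * a⁻¹ := by
      conv_lhs => rw [this]
      group
    rw [h']; group

theorem oc_tight (a b : G) (m : ℕ) (hm : Odd m) (e f e' f' : ℤ) (q : ℕ) (hq : 0 < q)
    (hgen : Subgroup.closure ({a, b} : Set G) = ⊤) (hbq : b ^ q = 1)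
    (he : e = 2 * m * e') (hf : f = m * f')
    (h3 : (a * b) ^ 2 = 1)
    (h4 : b⁻¹ * a = a ^ (3 + e) * b ^ (1 + f))
    (h5 : b * a⁻¹ = a ^ (-3 + e) * b ^ (-1 + f))
    (h6 : Commute (a ^ (2 * m)) b)
    (h7 : a ^ (2 * e) = a ^ (2 * f)) : IsTight a b := by
  obtain ⟨k1, k2, k3, k4, k5⟩ := oc_struct a b m hm e f e' f' he hf h3 h4 h5 h6 h7
  obtain ⟨Z, hZ⟩ : ∃ Z, Z = a ^ e * b ^ f := ⟨_, rfl⟩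
  rw [← hZ] at k1 k2 k3 k4
  have hZs : ∀ s : ℤ, Z ^ s = a ^ (e * s) * b ^ (f * s) := by
    intro s
    rw [hZ, (k5.zpow_right f).mul_zpow, zpow_mul, zpow_mul]
  have hbs : ∀ s : ℤ, b * (a ^ 2) ^ s = Z ^ s * (a ^ 2) ^ s * b := by
    intro s
    have e1 : b * a ^ 2 * b⁻¹ = Z * a ^ 2 := by rw [k1]; group
    have e2 : b * (a ^ 2) ^ s * b⁻¹ = Z ^ s * (a ^ 2) ^ s := by
      rw [← conj_zpow, e1, k3.mul_zpow]
    rw [← e2]; group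
  have hZa : ∀ s : ℤ, Z ^ s * a⁻¹ = a⁻¹ * Z ^ (-s) := by
    intro s
    have e1 : a * Z * a⁻¹ = Z⁻¹ := by rw [mul_assoc, k4]; group
    have e2 : a * Z ^ s * a⁻¹ = Z ^ (-s) := by
      rw [← conj_zpow, e1, inv_zpow, zpow_neg]
    rw [← e2]; group
  have hba : b * a = a⁻¹ * b⁻¹ := by
    have : (a * b) * (a * b) = 1 := by rw [← pow_two]; exact h3
    calc b * a = a⁻¹ * ((a * b) * (a * b)) * b⁻¹ := by group
      _ = _ := by rw [this]; group
  have key : ∀ i : ℤ, ∃ i' j' : ℤ, b * a ^ i = a ^ i' * b ^ j' := by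
    intro i
    rcases Int.even_or_odd' i with ⟨s, hs | hs⟩
    · refine ⟨e * s + i, f * s + 1, ?_⟩
      have : a ^ i = (a ^ 2) ^ s := by rw [hs, zpow_mul]; norm_cast
      rw [this, hbs, ((k3.zpow_left s).zpow_right s).eq, hZs, ← this]
      rw [zpow_add, zpow_add, ← zpow_mul_comm a i]
      simp [mul_assoc]
    · refine ⟨i - 2 - e * s, -(f * s) - 1, ?_⟩
      have h1 : a ^ i = (a ^ 2) ^ s * a := by
        rw [hs, zpow_add, zpow_mul]; norm_cast; simp
      have h2 : a ^ (i - 2) = (a ^ 2) ^ s * a⁻¹ := by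
        have : i - 2 = 2 * s - 1 := by omega
        rw [this, zpow_sub, zpow_mul]; norm_cast; simp
      calc b * a ^ i = Z ^ s * (a ^ 2) ^ s * (b * a) := by
            rw [h1, ← mul_assoc, hbs]; simp only [mul_assoc]
        _ = (a ^ 2) ^ s * (Z ^ s * a⁻¹) * b⁻¹ := by
            rw [((k3.zpow_left s).zpow_right s).eq, hba]; simp only [mul_assoc]
        _ = a ^ (i - 2) * Z ^ (-s) * b⁻¹ := by rw [hZa, h2]; simp only [mul_assoc]
        _ = _ := by
            rw [hZs, sub_eq_add_neg (i - 2), zpow_add a, sub_eq_add_neg (-(f * s)), zpow_add b,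
              zpow_neg_one]
            simp only [mul_assoc, mul_neg]
  have keyn : ∀ (n : ℕ) (g : G), (∃ i j : ℤ, g = a ^ i * b ^ j) →
      ∃ i j : ℤ, b ^ n * g = a ^ i * b ^ j := by
    intro n
    induction n with
    | zero => intro g hg; simpa using hg
    | succ n ih =>
      rintro g ⟨i, j, rfl⟩
      obtain ⟨i', j', h⟩ := key i
      rw [pow_succ, mul_assoc]
      apply ih
      refine ⟨i', j' + j, ?_⟩
      rw [← mul_assoc, h, zpow_add, mul_assoc]
  have hbinv : b⁻¹ = b ^ (q - 1) := by
    rw [inv_eq_iff_mul_eq_one, ← pow_succ', Nat.sub_add_cancel hq, hbq]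
  intro g
  have hg : g ∈ Subgroup.closure ({a, b} : Set G) := by rw [hgen]; trivial
  induction hg using Subgroup.closure_induction_left with
  | one => exact ⟨0, 0, by simp⟩
  | mul_left x hx y hy ih =>
    rcases hx with rfl | rfl
    · obtain ⟨i, j, rfl⟩ := ih
      exact ⟨1 + i, j, by rw [zpow_add, zpow_one, mul_assoc]⟩
    · simpa using keyn 1 y ih
  | inv_mul_cancel x hx y hy ih =>
    rcases hx with rfl | rfl
    · obtain ⟨i, j, rfl⟩ := ih
      exact ⟨-1 + i, j, by rw [zpow_add, zpow_neg_one, mul_assoc]⟩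
    · rw [hbinv]; exact keyn _ y ih

theorem oc_finite (a b : G) (p q : ℕ) (hp : 0 < p) (hq : 0 < q) (ha : a ^ p = 1) (hb : b ^ q = 1)
    (h : IsTight a b) : Finite G := by
  have h1 : (Subgroup.zpowers a : Set G).Finite := by
    have : IsOfFinOrder a := isOfFinOrder_iff_pow_eq_one.2 ⟨p, hp, ha⟩
    exact this.finite_zpowers
  have h2 : (Subgroup.zpowers b : Set G).Finite := by
    have : IsOfFinOrder b := isOfFinOrder_iff_pow_eq_one.2 ⟨q, hq, hb⟩
    exact this.finite_zpowers
  have h3 := Set.Finite.image2 (fun x y => x * y) h1 h2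
  rw [← Set.finite_univ_iff]
  refine h3.subset ?_
  rintro g -
  obtain ⟨i, j, rfl⟩ := h g
  exact ⟨a ^ i, ⟨i, rfl⟩, b ^ j, ⟨j, rfl⟩, rfl⟩

theorem oc_chiral (a b : G) (e f : ℤ) (hint : Subgroup.zpowers a ⊓ Subgroup.zpowers b = ⊥)
    (h4 : b⁻¹ * a = a ^ (3 + e) * b ^ (1 + f))
    (h5 : b * a⁻¹ = a ^ (-3 + e) * b ^ (-1 + f))
    (hf : b ^ (2 * f) ≠ 1) : IsChiral a b := by
  rintro ⟨φ, h1, h2⟩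
  apply hf
  have h := congrArg φ h4
  simp only [map_mul, map_inv, map_zpow, h1, h2, inv_inv] at h
  rw [h5, inv_zpow', inv_zpow'] at h
  have h' : b ^ (2 * f) = a ^ (-(2 * e)) := by
    have e1 : b ^ (2 * f) = b ^ (-1 + f) * b ^ (1 + f) := by rw [← zpow_add]; congr 1; ring
    have e2 : b ^ (-1 + f) = a ^ (3 - e) * (a ^ (-(3 + e)) * b ^ (-(1 + f))) := by
      rw [← h, ← mul_assoc, ← zpow_add]; ring_nf; simp
    rw [e1, e2, mul_assoc, mul_assoc, ← zpow_add b, ← mul_assoc, ← zpow_add a]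
    ring_nf; simp
  have : b ^ (2 * f) ∈ Subgroup.zpowers a ⊓ Subgroup.zpowers b :=
    ⟨by rw [h']; exact ⟨_, rfl⟩, ⟨_, rfl⟩⟩
  rwa [hint, Subgroup.mem_bot] at this

end GroupPart

/-- The affine group of a commutative ring: maps `t ↦ u t + v`. -/
@[ext] structure OCAff (R : Type*) [CommRing R] where
  u : Rˣ
  v : R

namespace OCAff
variable {R : Type*} [CommRing R]

instance : Mul (OCAff R) := ⟨fun x y => ⟨x.u * y.u, x.u * y.v + x.v⟩⟩
instance : One (OCAff R) := ⟨⟨1, 0⟩⟩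
instance : Inv (OCAff R) := ⟨fun x => ⟨x.u⁻¹, -((x.u⁻¹ : Rˣ) : R) * x.v⟩⟩

@[simp] theorem mul_u (x y : OCAff R) : (x * y).u = x.u * y.u := rfl
@[simp] theorem mul_v (x y : OCAff R) : (x * y).v = x.u * y.v + x.v := rfl
@[simp] theorem one_u : (1 : OCAff R).u = 1 := rfl
@[simp] theorem one_v : (1 : OCAff R).v = 0 := rfl
@[simp] theorem inv_u (x : OCAff R) : (x⁻¹).u = x.u⁻¹ := rfl
@[simp] theorem inv_v (x : OCAff R) : (x⁻¹).v = -((x.u⁻¹ : Rˣ) : R) * x.v := rfl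

instance : Group (OCAff R) :=
  Group.ofLeftAxioms
    (fun x y z => by ext <;> simp [mul_assoc]; ring)
    (fun x => by ext <;> simp)
    (fun x => by ext <;> simp)

theorem zpow_u (x : OCAff R) (n : ℤ) : (x ^ n).u = x.u ^ n :=
  map_zpow (⟨⟨OCAff.u, rfl⟩, fun _ _ => rfl⟩ : OCAff R →* Rˣ) x n

theorem zpow_v_zero (r : Rˣ) (n : ℤ) : ((⟨r, 0⟩ : OCAff R) ^ n) = ⟨r ^ n, 0⟩ :=
  (map_zpow (⟨⟨fun r => ⟨r, 0⟩, rfl⟩, fun _ _ => by ext <;> simp⟩ : Rˣ →* OCAff R) r n).symm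

end OCAff

section Model
variable {R : Type*} [CommRing R]

/-- The unit `1 + h` for `h` of square zero. -/
def ocUnit (h : R) (hh : h * h = 0) : Rˣ :=
  ⟨1 + h, 1 - h, by linear_combination -hh, by linear_combination -hh⟩

theorem ocUnit_zpow (h : R) (hh : h * h = 0) (n : ℤ) :
    ((ocUnit h hh ^ n : Rˣ) : R) = 1 + n * h := by
  induction n using Int.induction_on with
  | zero => simp
  | succ n ih =>
    rw [zpow_add_one, Units.val_mul, ih]; push_cast
    simp only [ocUnit]; linear_combination (n : R) * hh
  | pred n ih =>
    rw [zpow_sub_one, Units.val_mul, ih]; push_cast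
    simp only [ocUnit, Units.inv_mk]; linear_combination (n : R) * hh

theorem ocB_zpow_v (h g : R) (hh : h * h = 0) (hg : 2 * g = h) (n : ℤ) :
    ((⟨ocUnit h hh, 1⟩ : OCAff R) ^ n).v = n + g * n * (n - 1) := by
  induction n using Int.induction_on with
  | zero => simp
  | succ n ih =>
    rw [zpow_add_one, OCAff.mul_v, ih, OCAff.zpow_u, ocUnit_zpow]; push_cast
    linear_combination -(n : R) * hg
  | pred n ih =>
    rw [zpow_sub_one, OCAff.mul_v, ih, OCAff.zpow_u, ocUnit_zpow]; push_cast
    simp only [OCAff.inv_v, ocUnit, Units.inv_mk]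
    linear_combination -(n + 1 : R) * hg - (n : R) * hh

theorem oc_neg_zpow_even (s : Rˣ) (n : ℤ) : (-s⁻¹) ^ (2 * n) = s ^ (-(2 * n)) := by
  rw [(even_two_mul n).neg_zpow, inv_zpow']

theorem oc_neg_zpow_odd (s : Rˣ) (n : ℤ) : (-s⁻¹) ^ (2 * n + 1) = -s ^ (-(2 * n + 1)) := by
  rw [(odd_two_mul_add_one n).neg_zpow, inv_zpow']

/-- The affine model of the group. -/
theorem oc_model (m P Q : ℕ) (e f e' : ℤ) (he : e = 2 * m * e')
    (w : R) (hw : 2 * w = 1) (hff : (f : R) * f = 0) (hfm : (f : R) * m = 0)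
    (hQ : (Q : R) = 0) (hmP : m ∣ P) :
    ∃ A B : OCAff R, A ^ (2 * P) = 1 ∧ B ^ Q = 1 ∧ (A * B) ^ 2 = 1 ∧
      B⁻¹ * A = A ^ (3 + e) * B ^ (1 + f) ∧
      B * A⁻¹ = A ^ (-3 + e) * B ^ (-1 + f) ∧
      A ^ (2 * m) * B = B * A ^ (2 * m) ∧
      (∀ i j : ℤ, A ^ i = B ^ j → (j : R) = 0) := by
  have hh : (f * w : R) * (f * w) = 0 := by linear_combination w * w * hff
  obtain ⟨s, hs⟩ : ∃ s, s = ocUnit (f * w : R) hh := ⟨_, rfl⟩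
  have hsn : ∀ n : ℤ, ((s ^ n : Rˣ) : R) = 1 + n * (f * w) := by
    intro n; rw [hs]; exact ocUnit_zpow _ hh n
  have hbv : ∀ n : ℤ, ((⟨s, 1⟩ : OCAff R) ^ n).v = n + (f * w * w) * n * (n - 1) := by
    intro n; rw [hs]; exact ocB_zpow_v _ _ hh (by linear_combination f * w * hw) n
  have hA := OCAff.zpow_v_zero (-s⁻¹)
  have hsm : ∀ n : ℤ, s ^ (m * n) = 1 := by
    intro n; ext; rw [hsn]; push_cast; linear_combination n * w * hfm
  have hse : s ^ e = 1 := by rw [he, mul_comm 2, mul_assoc]; exact hsm _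
  have hse' : s ^ (-e) = 1 := by rw [zpow_neg, hse, inv_one]
  have hsf : s ^ f = 1 := by
    ext; rw [hsn]; push_cast; linear_combination w * hff
  have hA2 : ∀ n : ℤ, (⟨-s⁻¹, 0⟩ : OCAff R) ^ (2 * (m * n)) = 1 := by
    intro n
    rw [hA, oc_neg_zpow_even]
    have : s ^ (-(2 * ((m : ℤ) * n))) = 1 := by
      rw [← hsm (-(2 * n))]; congr 1; ring
    rw [this]; rfl
  have hr3 : (-s⁻¹) ^ (3 + e) = -s ^ (-3 : ℤ) := by
    have : 3 + e = 2 * (1 + m * e') + 1 := by rw [he]; ring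
    rw [this, oc_neg_zpow_odd, ← this, neg_add, zpow_add, hse', mul_one]
  have hr3' : (-s⁻¹) ^ (-3 + e) = -s ^ (3 : ℤ) := by
    have : -3 + e = 2 * (-2 + m * e') + 1 := by rw [he]; ring
    rw [this, oc_neg_zpow_odd, ← this, neg_add, zpow_add, hse', mul_one, neg_neg]
  have hs1 : (s : R) = 1 + f * w := by simpa using hsn 1
  have hsi : ((s⁻¹ : Rˣ) : R) = 1 - f * w := by
    have := hsn (-1); rw [zpow_neg_one] at this; rw [this]; push_cast; ring
  refine ⟨⟨-s⁻¹, 0⟩, ⟨s, 1⟩, ?_, ?_, ?_, ?_, ?_, ?_, ?_⟩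
  · obtain ⟨d, rfl⟩ := hmP
    have := hA2 d
    rw [← zpow_natCast]; push_cast; exact this
  · rw [← zpow_natCast]
    ext
    · rw [OCAff.zpow_u, hsn]; push_cast; rw [hQ]; simp
    · rw [hbv]; push_cast; rw [hQ]; simp
  · rw [pow_two]; ext
    · simp
    · simp
  · ext
    · rw [OCAff.mul_u, OCAff.mul_u, OCAff.zpow_u, OCAff.zpow_u]
      simp only [OCAff.inv_u]
      rw [hr3, zpow_add, hsf, mul_one, zpow_one]
      rw [mul_neg, neg_mul]
      group
    · rw [OCAff.mul_v, OCAff.mul_v, OCAff.zpow_u, hbv, hA]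
      simp only [OCAff.inv_u, OCAff.inv_v]
      rw [hr3, Units.val_neg, hsn, hsi]
      push_cast
      linear_combination -(f : R) * hw + (-3 * w + w ^ 2 * (1 - 3 * f * w) * (1 + f)) * hff
  · ext
    · rw [OCAff.mul_u, OCAff.mul_u, OCAff.zpow_u, OCAff.zpow_u]
      simp only [OCAff.inv_u]
      rw [hr3', zpow_add, hsf, mul_one]
      rw [inv_neg, inv_inv, mul_neg, neg_mul, ← zpow_add,
        show (3 : ℤ) + -1 = 2 by norm_num, zpow_two]
    · rw [OCAff.mul_v, OCAff.mul_v, OCAff.zpow_u, hbv, hA]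
      simp only [OCAff.inv_v]
      rw [hr3', Units.val_neg, hsn]
      push_cast
      linear_combination -(f : R) * (1 - w) * hw -
        (-3 * w - 6 * w ^ 3 - (1 + 3 * f * w) * w ^ 2 * (f - 3)) * hff
  · have : (⟨-s⁻¹, 0⟩ : OCAff R) ^ (2 * m) = 1 := by
      have := hA2 1
      rw [← zpow_natCast]; push_cast; simpa using this
    rw [this]; simp
  · intro i j hij
    have := congrArg OCAff.v hij
    rw [hA, hbv] at this
    simp only at this
    linear_combination (-(1 - f * w * w * (j - 1 : R))) * this + j * (j - 1 : R) ^ 2 * w ^ 4 * hff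
end Model

/-- The common shape of the two presentations. -/
def ocRels (p q m : ℕ) (e f : ℤ) : Set (FreeGroup (Fin 2)) :=
  {(FreeGroup.of 0) ^ p,
   (FreeGroup.of 1) ^ q,
   (FreeGroup.of 0 * FreeGroup.of 1) ^ 2,
   (FreeGroup.of 1)⁻¹ * FreeGroup.of 0 *
     ((FreeGroup.of 0) ^ (3 + e) * (FreeGroup.of 1) ^ (1 + f))⁻¹,
   FreeGroup.of 1 * (FreeGroup.of 0)⁻¹ *
     ((FreeGroup.of 0) ^ (-3 + e) * (FreeGroup.of 1) ^ (-1 + f))⁻¹,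
   (FreeGroup.of 0) ^ (2 * m) * FreeGroup.of 1 *
     (FreeGroup.of 0) ^ (-(2 * (m : ℤ))) * (FreeGroup.of 1)⁻¹}

theorem oc_lift {H : Type*} [Group H] (p q m : ℕ) (e f : ℤ) (A B : H)
    (h1 : A ^ p = 1) (h2 : B ^ q = 1) (h3 : (A * B) ^ 2 = 1)
    (h4 : B⁻¹ * A = A ^ (3 + e) * B ^ (1 + f))
    (h5 : B * A⁻¹ = A ^ (-3 + e) * B ^ (-1 + f))
    (h6 : A ^ (2 * m) * B = B * A ^ (2 * m)) :
    ∃ φ : PresentedGroup (ocRels p q m e f) →* H,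
      φ (PresentedGroup.of 0) = A ∧ φ (PresentedGroup.of 1) = B := by
  have h : ∀ r ∈ ocRels p q m e f, FreeGroup.lift ![A, B] r = 1 := by
    intro r hr
    simp only [ocRels, Set.mem_insert_iff, Set.mem_singleton_iff] at hr
    rcases hr with rfl | rfl | rfl | rfl | rfl | rfl
    · simpa using h1
    · simpa using h2
    · simpa using h3
    · simp only [map_mul, map_inv, map_zpow, FreeGroup.lift_apply_of, Matrix.cons_val_zero,
        Matrix.cons_val_one]
      rw [mul_inv_eq_one]; exact h4
    · simp only [map_mul, map_inv, map_zpow, FreeGroup.lift_apply_of, Matrix.cons_val_zero,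
        Matrix.cons_val_one]
      rw [mul_inv_eq_one]; exact h5
    · simp only [map_mul, map_inv, map_zpow, map_pow, FreeGroup.lift_apply_of,
        Matrix.cons_val_zero, Matrix.cons_val_one]
      rw [h6, zpow_neg]
      have : A ^ (2 * (m : ℤ)) = A ^ (2 * m) := by
        rw [← zpow_natCast]; push_cast; rfl
      rw [this]; group
  refine ⟨PresentedGroup.toGroup h, ?_, ?_⟩
  · rw [PresentedGroup.toGroup.of]; rfl
  · rw [PresentedGroup.toGroup.of]; rfl

theorem oc_rels_hold (p q m : ℕ) (e f : ℤ) 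
    (a b : PresentedGroup (ocRels p q m e f)) (ha : a = PresentedGroup.of 0)
    (hb : b = PresentedGroup.of 1) :
    a ^ p = 1 ∧ b ^ q = 1 ∧ (a * b) ^ 2 = 1 ∧ b⁻¹ * a = a ^ (3 + e) * b ^ (1 + f) ∧
    b * a⁻¹ = a ^ (-3 + e) * b ^ (-1 + f) ∧ Commute (a ^ (2 * m)) b := by
  have key : ∀ r ∈ ocRels p q m e f, PresentedGroup.mk (ocRels p q m e f) r = 1 :=
    fun r hr => PresentedGroup.one_of_mem hr
  have ha' : PresentedGroup.mk (ocRels p q m e f) (FreeGroup.of 0) = a := ha.symm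
  have hb' : PresentedGroup.mk (ocRels p q m e f) (FreeGroup.of 1) = b := hb.symm
  have h1 := key _ (Or.inl rfl)
  have h2 := key _ (Or.inr (Or.inl rfl))
  have h3 := key _ (Or.inr (Or.inr (Or.inl rfl)))
  have h4 := key _ (Or.inr (Or.inr (Or.inr (Or.inl rfl))))
  have h5 := key _ (Or.inr (Or.inr (Or.inr (Or.inr (Or.inl rfl)))))
  have h6 := key _ (Or.inr (Or.inr (Or.inr (Or.inr (Or.inr rfl)))))
  simp only [map_mul, map_inv, map_zpow, map_pow, ha', hb'] at h1 h2 h3 h4 h5 h6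
  refine ⟨h1, h2, h3, mul_inv_eq_one.1 h4, mul_inv_eq_one.1 h5, ?_⟩
  have h7 : a ^ (-(2 * (m : ℤ))) = (a ^ (2 * m))⁻¹ := by
    rw [zpow_neg, ← zpow_natCast]; push_cast; rfl
  rw [h7] at h6
  exact (mul_inv_eq_iff_eq_mul.1 (mul_inv_eq_one.1 h6))

theorem oc_main (m P Q : ℕ) (e f e' f' : ℤ) (hm : Odd m) (hP : Odd P) (hQ : Odd Q)
    (hQ2 : 2 ≤ Q) (hPQ : P ∣ Q) (hmP : m ∣ P)
    (he : e = 2 * m * e') (hf : f = m * f') (hPe : (P : ℤ) ∣ e - f)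
    (hff : (Q : ℤ) ∣ f * f) (hfm : (Q : ℤ) ∣ f * m) (hnf : ¬ (Q : ℤ) ∣ 2 * f) :
    Finite (PresentedGroup (ocRels (2 * P) Q m e f)) ∧
    IsRotPair (PresentedGroup.of 0 : PresentedGroup (ocRels (2 * P) Q m e f))
      (PresentedGroup.of 1) (2 * P) Q ∧
    IsTight (PresentedGroup.of 0 : PresentedGroup (ocRels (2 * P) Q m e f))
      (PresentedGroup.of 1) ∧
    IsChiral (PresentedGroup.of 0 : PresentedGroup (ocRels (2 * P) Q m e f))
      (PresentedGroup.of 1) := by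
  have hP0 : 0 < P := hP.pos
  obtain ⟨a, ha⟩ : ∃ a, a = (PresentedGroup.of 0 : PresentedGroup (ocRels (2 * P) Q m e f)) :=
    ⟨_, rfl⟩
  obtain ⟨b, hb⟩ : ∃ b, b = (PresentedGroup.of 1 : PresentedGroup (ocRels (2 * P) Q m e f)) :=
    ⟨_, rfl⟩
  rw [← ha, ← hb]
  obtain ⟨h1, h2, h3, h4, h5, h6⟩ := oc_rels_hold _ _ _ _ _ a b ha hb
  have hgen : Subgroup.closure ({a, b} : Set (PresentedGroup (ocRels (2 * P) Q m e f))) = ⊤ := by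
    rw [← PresentedGroup.closure_range_of]
    congr 1
    ext x
    simp [Fin.exists_fin_two, ha, hb, eq_comm]
  have h7 : a ^ (2 * e) = a ^ (2 * f) := by
    obtain ⟨t, ht⟩ := hPe
    have : 2 * e = (2 * P : ℕ) * t + 2 * f := by push_cast; linear_combination 2 * ht
    rw [this, zpow_add, zpow_mul, zpow_natCast, h1, one_zpow, one_mul]
  have htight := oc_tight a b m hm e f e' f' Q (by omega) hgen h2 he hf h3 h4 h5 h6 h7
  have hfin := oc_finite a b (2 * P) Q (by omega) (by omega) h1 h2 htight
  -- the affine model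
  have hb_key : ∀ i j : ℤ, a ^ i = b ^ j → (Q : ℤ) ∣ j := by
    obtain ⟨w, hw⟩ := hQ
    obtain ⟨A, B, k1, k2, k3, k4, k5, k6, k7⟩ := oc_model (R := ZMod Q) m P Q e f e' he
      ((w + 1 : ℕ) : ZMod Q)
      (by
        have : ((2 * (w + 1) : ℕ) : ZMod Q) = ((Q + 1 : ℕ) : ZMod Q) := by congr 1; omega
        push_cast at this ⊢
        rw [this]; simp)
      (by rw [← Int.cast_mul]; exact (ZMod.intCast_zmod_eq_zero_iff_dvd _ _).2 hff)
      (by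
        have := (ZMod.intCast_zmod_eq_zero_iff_dvd _ Q).2 hfm
        push_cast at this; exact this)
      (by simp) hmP
    obtain ⟨φ, hφa, hφb⟩ := oc_lift (2 * P) Q m e f A B k1 k2 k3 k4 k5 k6
    rw [← ha] at hφa
    rw [← hb] at hφb
    intro i j hij
    have := congrArg φ hij
    rw [map_zpow, map_zpow, hφa, hφb] at this
    exact (ZMod.intCast_zmod_eq_zero_iff_dvd _ _).1 (k7 i j this)
  -- the cyclic model
  have ha_key : ∀ i : ℤ, a ^ i = 1 → ((2 * P : ℕ) : ℤ) ∣ i := by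
    obtain ⟨x, hx⟩ := hP
    obtain ⟨d, hd⟩ := hPQ
    obtain ⟨t, ht⟩ := hPe
    obtain ⟨y, hy⟩ : ∃ y, f + t = 2 * y := by
      refine ⟨m * e' - x * t, ?_⟩
      have hx' : (P : ℤ) = 2 * x + 1 := by exact_mod_cast hx
      rw [he, hx'] at ht
      linear_combination -ht
    have q0 : (2 * P : ZMod (2 * P)) = 0 := by
      have := ZMod.natCast_self (2 * P); push_cast at this; exact this
    have qx : (P : ZMod (2 * P)) = 2 * x + 1 := by
      have := congrArg (Nat.cast (R := ZMod (2 * P))) hx; push_cast at this; exact this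
    have qd : (Q : ZMod (2 * P)) = P * d := by
      have := congrArg (Nat.cast (R := ZMod (2 * P))) hd; push_cast at this; exact this
    have qt : (e - f : ZMod (2 * P)) = P * t := by
      have := congrArg (Int.cast (R := ZMod (2 * P))) ht; push_cast at this; exact this
    have qy : (f + t : ZMod (2 * P)) = 2 * y := by
      have := congrArg (Int.cast (R := ZMod (2 * P))) hy; push_cast at this; exact this
    obtain ⟨φ, hφa, -⟩ := oc_lift (H := Multiplicative (ZMod (2 * P))) (2 * P) Q m e f
      (Multiplicative.ofAdd 1) (Multiplicative.ofAdd (P - 1))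
      (by
        apply Multiplicative.toAdd.injective
        simp only [toAdd_pow, toAdd_ofAdd, toAdd_one, nsmul_eq_mul]
        push_cast
        linear_combination q0)
      (by
        apply Multiplicative.toAdd.injective
        simp only [toAdd_pow, toAdd_ofAdd, toAdd_one, nsmul_eq_mul]
        linear_combination (P - 1 : ZMod (2 * P)) * qd + P * d * qx + x * d * q0)
      (by
        apply Multiplicative.toAdd.injective
        simp only [toAdd_pow, toAdd_mul, toAdd_ofAdd, toAdd_one, nsmul_eq_mul]
        push_cast
        linear_combination q0)
      (by
        apply Multiplicative.toAdd.injective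
        simp only [toAdd_zpow, toAdd_mul, toAdd_inv, toAdd_ofAdd, zsmul_eq_mul]
        push_cast
        linear_combination -q0 - qt - P * qy - y * q0)
      (by
        apply Multiplicative.toAdd.injective
        simp only [toAdd_zpow, toAdd_mul, toAdd_inv, toAdd_ofAdd, zsmul_eq_mul]
        push_cast
        linear_combination q0 - qt - P * qy - y * q0)
      (mul_comm _ _)
    rw [← ha] at hφa
    intro i hi
    have := congrArg φ hi
    rw [map_zpow, map_one, hφa] at this
    have := congrArg Multiplicative.toAdd this
    simp only [toAdd_zpow, toAdd_ofAdd, toAdd_one, zsmul_eq_mul, mul_one] at this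
    exact (ZMod.intCast_zmod_eq_zero_iff_dvd _ _).1 this
  have hoa : orderOf a = 2 * P := by
    apply Nat.dvd_antisymm (orderOf_dvd_of_pow_eq_one h1)
    have := ha_key (orderOf a) (by rw [zpow_natCast, pow_orderOf_eq_one])
    exact_mod_cast this
  have hob : orderOf b = Q := by
    apply Nat.dvd_antisymm (orderOf_dvd_of_pow_eq_one h2)
    have := hb_key 0 (orderOf b) (by rw [zpow_natCast, pow_orderOf_eq_one, zpow_zero])
    exact_mod_cast this
  have hint : Subgroup.zpowers a ⊓ Subgroup.zpowers b = ⊥ := by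
    rw [eq_bot_iff]
    rintro g ⟨⟨i, hi⟩, ⟨j, hj⟩⟩
    simp only at hi hj
    obtain ⟨d, rfl⟩ := hb_key i j (hi.trans hj.symm)
    rw [Subgroup.mem_bot, ← hj, zpow_mul, zpow_natCast, h2, one_zpow]
  refine ⟨hfin, ⟨hgen, hoa, hob, by omega, hQ2, h3, hint⟩, htight, ?_⟩
  refine oc_chiral a b e f hint h4 h5 ?_
  intro h
  exact hnf (hb_key 0 _ (by rw [h, zpow_zero]))

/-- Theorem 3.5: the two presented groups above give tight chiral rotation pairs of
types `(2m^β, m^β)` and (when `β > α`) `(2m^α, m^β)`. -/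
theorem odd_centrals_tight_chiral (m α β : ℕ) (hm : m.Prime) (hmodd : Odd m)
    (hα : 1 ≤ α) (hβ : 2 ≤ β) (k : ℤ) (hk1 : 1 ≤ k) (hk2 : k ≤ (m : ℤ) - 1) :
    ((let G := PresentedGroup (oddCentralRelsA m β k)
      let a : G := PresentedGroup.of 0
      let b : G := PresentedGroup.of 1
      Finite G ∧ IsRotPair a b (2 * m ^ β) (m ^ β) ∧ IsTight a b ∧ IsChiral a b) ∧
     (α < β →
      let G := PresentedGroup (oddCentralRelsB m α β k)
      let a : G := PresentedGroup.of 0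
      let b : G := PresentedGroup.of 1
      Finite G ∧ IsRotPair a b (2 * m ^ α) (m ^ β) ∧ IsTight a b ∧ IsChiral a b)) := by
  obtain ⟨r, hr⟩ := hmodd
  have hmodd : Odd m := ⟨r, hr⟩
  have hrz : (m : ℤ) = 2 * r + 1 := by exact_mod_cast hr
  obtain ⟨γ, rfl⟩ : ∃ γ, β = γ + 2 := ⟨β - 2, by omega⟩
  have hm0 : (m : ℤ) ≠ 0 := by exact_mod_cast hm.ne_zero
  have hQ2 : 2 ≤ m ^ (γ + 2) := le_trans hm.two_le (Nat.le_self_pow (by omega) m)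
  have hsub : γ + 2 - 1 = γ + 1 := rfl
  have hnf : ¬ ((m ^ (γ + 2) : ℕ) : ℤ) ∣ 2 * (k * (m : ℤ) ^ (γ + 1)) := by
    intro h
    have h1 : (m : ℤ) ^ (γ + 1) * m ∣ (m : ℤ) ^ (γ + 1) * (2 * k) := by
      have e1 : (m : ℤ) ^ (γ + 1) * m = ((m ^ (γ + 2) : ℕ) : ℤ) := by push_cast; ring
      rw [e1]; convert h using 1; ring
    have h2 : (m : ℤ) ∣ 2 * k := (mul_dvd_mul_iff_left (pow_ne_zero _ hm0)).1 h1
    have h3 : (m : ℤ) ∣ k := by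
      have : k = m * k - r * (2 * k) := by rw [hrz]; ring
      rw [this]; exact dvd_sub (dvd_mul_right _ _) (h2.mul_left _)
    have := Int.le_of_dvd (by omega) h3
    omega
  have hff : ((m ^ (γ + 2) : ℕ) : ℤ) ∣ (k * (m : ℤ) ^ (γ + 1)) * (k * (m : ℤ) ^ (γ + 1)) :=
    ⟨k * k * m ^ γ, by push_cast; ring⟩
  have hfm : ((m ^ (γ + 2) : ℕ) : ℤ) ∣ (k * (m : ℤ) ^ (γ + 1)) * m :=
    ⟨k, by push_cast; ring⟩
  refine ⟨?_, fun hαβ => ?_⟩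
  · exact oc_main m (m ^ (γ + 2)) (m ^ (γ + 2)) (k * ((m : ℤ) + 1) * (m : ℤ) ^ (γ + 1))
      (k * (m : ℤ) ^ (γ + 1)) (k * (r + 1) * (m : ℤ) ^ γ) (k * (m : ℤ) ^ γ)
      hmodd hmodd.pow hmodd.pow hQ2 dvd_rfl (dvd_pow_self _ (by omega))
      (by rw [hrz]; ring) (by ring) ⟨k, by push_cast; ring⟩ hff hfm hnf
  · have hrel : oddCentralRelsB m α (γ + 2) k =
        ocRels (2 * m ^ α) (m ^ (γ + 2)) m 0 (k * (m : ℤ) ^ (γ + 1)) := by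
      simp only [oddCentralRelsB, ocRels, add_zero, hsub]
    rw [hrel]
    obtain ⟨δ, hδ⟩ : ∃ δ, γ + 1 = α + δ := ⟨γ + 1 - α, by omega⟩
    exact oc_main m (m ^ α) (m ^ (γ + 2)) 0
      (k * (m : ℤ) ^ (γ + 1)) 0 (k * (m : ℤ) ^ γ)
      hmodd hmodd.pow hmodd.pow hQ2 (pow_dvd_pow _ hαβ.le) (dvd_pow_self _ (by omega))
      (by ring) (by ring) ⟨-k * m ^ δ, by rw [hδ]; push_cast; ring⟩ hff hfm hnf
end
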